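/- For every integer d ≥ 1 and every a > 0 there exists b > 0 such that the following holds for all n ≥ 2: if P is a set of n points in ℝ², f is a nonzero real polynomial in two variables of degree at most d, and the zero set Z(f) = {(x,y) ∈ ℝ² : f(x,y) = 0} contains at least a·n^{7/8} points of P, then P determines at least b·n distinct distances. (Quantitative form of: if D(P) = o(n), then no constant-degree algebraic curve contains Ω(n^{7/8}) points of P.) -/

import Mathlib

/-- Cauchy–Schwarz for the fibres of a map on a finite set. -/
theorem card_sq_le_card_image_mul_card_fiber_pairs {α β : Type*} [DecidableEq β]
    (X : Finset α) (φ : α → β) :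
    X.card ^ 2 ≤ (X.image φ).card * ((X ×ˢ X).filter fun z => φ z.1 = φ z.2).card := by
  classical
  have h1 : X.card = ∑ b ∈ X.image φ, (X.filter fun x => φ x = b).card :=
    Finset.card_eq_sum_card_fiberwise (fun x hx => Finset.mem_image_of_mem φ hx)
  have h2 : ((X ×ˢ X).filter fun z => φ z.1 = φ z.2).card
      = ∑ b ∈ X.image φ, (X.filter fun x => φ x = b).card ^ 2 := by
    rw [Finset.card_eq_sum_card_fiberwise (f := fun z : α × α => φ z.1) (t := X.image φ)]
    · refine Finset.sum_congr rfl fun b _ => ?_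
      rw [sq, ← Finset.card_product]
      congr 1
      ext ⟨x, y⟩
      simp only [Finset.mem_filter, Finset.mem_product]
      constructor
      · rintro ⟨⟨⟨hx, hy⟩, hxy⟩, hb⟩
        exact ⟨⟨hx, hb⟩, hy, hxy ▸ hb⟩
      · rintro ⟨⟨hx, hb⟩, hy, hb'⟩
        exact ⟨⟨⟨hx, hy⟩, hb.trans hb'.symm⟩, hb⟩
    · intro z hz
      simp only [Finset.coe_filter, Finset.mem_product, Set.mem_ofPred_eq] at hz
      exact Finset.mem_coe.2 (Finset.mem_image_of_mem φ hz.1.1)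
  rw [h2, h1]
  exact sq_sum_le_card_mul_sum_sq

/-- If every subset of `X` with more than `L` elements contains a tuple from `T`, then `X` has at
most `L` elements more than `T`. -/
theorem card_le_add_card_of_forall_exists_tuple {α : Type*} [DecidableEq α] {k L : ℕ}
    (X : Finset α) (T : Finset (Fin (k + 1) → α))
    (h : ∀ Y ⊆ X, L < Y.card → ∃ τ ∈ T, ∀ i, τ i ∈ Y) :
    X.card ≤ L + T.card := by
  by_contra! hc
  have h1 : L < (X \ T.image fun τ => τ 0).card := by
    have := Finset.le_card_sdiff (T.image fun τ => τ 0) X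
    have := Finset.card_image_le (s := T) (f := fun τ => τ 0)
    omega
  obtain ⟨τ, hτ, hm⟩ := h _ Finset.sdiff_subset h1
  exact (Finset.mem_sdiff.1 (hm 0)).2 (Finset.mem_image_of_mem (fun τ => τ 0) hτ)

open Classical in
/-- Incidence bound for a grid `S₁ × S₂` cut into `r × r` cells such that every curve meets few
cells, every rich cell of a curve contains a good tuple, and every good tuple lies on few curves. -/
theorem sum_incidences_le {α β ι : Type*} {k L K t B₁ B₂ r : ℕ}
    (S₁ : Finset α) (S₂ : Finset β) (b₁ : α → ℕ) (b₂ : β → ℕ) (Γ : Finset ι)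
    (I : ι → α → β → Prop) (G : (Fin (k + 1) → α × β) → Prop)
    (hr₁ : ∀ x ∈ S₁, b₁ x < r) (hr₂ : ∀ y ∈ S₂, b₂ y < r)
    (hB₁ : ∀ i, (S₁.filter fun x => b₁ x = i).card ≤ B₁)
    (hB₂ : ∀ i, (S₂.filter fun x => b₂ x = i).card ≤ B₂)
    (hcell : ∀ c ∈ Γ, ((Finset.range r ×ˢ Finset.range r).filter fun z =>
      ∃ x ∈ S₁, ∃ y ∈ S₂, b₁ x = z.1 ∧ b₂ y = z.2 ∧ I c x y).card ≤ K)
    (hgood : ∀ c ∈ Γ, ∀ X ⊆ S₁ ×ˢ S₂, (∀ z ∈ X, I c z.1 z.2) → L < X.card →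
      ∃ τ, G τ ∧ ∀ i, τ i ∈ X)
    (hmult : ∀ τ, G τ → (Γ.filter fun c => ∀ i, I c (τ i).1 (τ i).2).card ≤ t) :
    ∑ c ∈ Γ, ((S₁ ×ˢ S₂).filter fun z => I c z.1 z.2).card
      ≤ L * K * Γ.card + t * (r ^ 2 * (B₁ * B₂) ^ (k + 1)) := by
  set R := Finset.range r ×ˢ Finset.range r with hR
  let cell : ℕ × ℕ → Finset (α × β) := fun z =>
    (S₁ ×ˢ S₂).filter fun w => b₁ w.1 = z.1 ∧ b₂ w.2 = z.2
  have hcellcard : ∀ z, (cell z).card ≤ B₁ * B₂ := by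
    intro z
    have : cell z = (S₁.filter fun x => b₁ x = z.1) ×ˢ (S₂.filter fun x => b₂ x = z.2) := by
      ext w
      simp only [cell, Finset.mem_filter, Finset.mem_product]
      tauto
    rw [this, Finset.card_product]
    exact Nat.mul_le_mul (hB₁ _) (hB₂ _)
  let tup : ℕ × ℕ → Finset (Fin (k + 1) → α × β) := fun z =>
    (Fintype.piFinset fun _ => cell z).filter G
  have htup : ∀ z, (tup z).card ≤ (B₁ * B₂) ^ (k + 1) := by
    intro z
    refine (Finset.card_filter_le _ _).trans ?_
    rw [Fintype.card_piFinset_const]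
    exact Nat.pow_le_pow_left (hcellcard z) _
  have hone : ∀ c ∈ Γ, ((S₁ ×ˢ S₂).filter fun z => I c z.1 z.2).card
      ≤ L * K + ∑ z ∈ R, ((tup z).filter fun τ => ∀ i, I c (τ i).1 (τ i).2).card := by
    intro c hc
    set H := R.filter fun z => ∃ x ∈ S₁, ∃ y ∈ S₂, b₁ x = z.1 ∧ b₂ y = z.2 ∧ I c x y with hH
    rw [Finset.card_eq_sum_card_fiberwise (f := fun w : α × β => (b₁ w.1, b₂ w.2)) (t := H)]
    · calc _ ≤ ∑ z ∈ H, (L + ((tup z).filter fun τ => ∀ i, I c (τ i).1 (τ i).2).card) := by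
            refine Finset.sum_le_sum fun z _ => ?_
            refine card_le_add_card_of_forall_exists_tuple _ _ fun Y hY hL => ?_
            obtain ⟨τ, hτ, hm⟩ := hgood c hc Y
              (fun w hw => (Finset.mem_filter.1 (Finset.mem_filter.1 (hY hw)).1).1)
              (fun w hw => (Finset.mem_filter.1 (Finset.mem_filter.1 (hY hw)).1).2) hL
            refine ⟨τ, ?_, hm⟩
            simp only [tup, Finset.mem_filter, Fintype.mem_piFinset, cell]
            have hY' := fun i => Finset.mem_filter.1 (hY (hm i))
            refine ⟨⟨fun i => ⟨(Finset.mem_filter.1 (hY' i).1).1, ?_⟩, hτ⟩,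
              fun i => (Finset.mem_filter.1 (hY' i).1).2⟩
            exact Prod.ext_iff.1 (hY' i).2
        _ = H.card * L + ∑ z ∈ H, ((tup z).filter fun τ => ∀ i, I c (τ i).1 (τ i).2).card := by
            rw [Finset.sum_add_distrib, Finset.sum_const, smul_eq_mul]
        _ ≤ _ := by
            refine Nat.add_le_add ?_ ?_
            · rw [mul_comm]
              exact Nat.mul_le_mul_left _ (hcell c hc)
            · exact Finset.sum_le_sum_of_subset (Finset.filter_subset _ _)
    · intro w hw
      simp only [Finset.coe_filter, Finset.mem_product, Set.mem_ofPred_eq] at hw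
      simp only [hH, hR, Finset.coe_filter, Finset.mem_product, Set.mem_ofPred_eq, Finset.mem_range]
      exact ⟨⟨hr₁ _ hw.1.1, hr₂ _ hw.1.2⟩, w.1, hw.1.1, w.2, hw.1.2, rfl, rfl, hw.2⟩
  calc _ ≤ ∑ c ∈ Γ, (L * K + ∑ z ∈ R, ((tup z).filter fun τ => ∀ i, I c (τ i).1 (τ i).2).card) :=
        Finset.sum_le_sum hone
    _ = L * K * Γ.card
        + ∑ z ∈ R, ∑ c ∈ Γ, ((tup z).filter fun τ => ∀ i, I c (τ i).1 (τ i).2).card := by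
        rw [Finset.sum_add_distrib, Finset.sum_const, smul_eq_mul, mul_comm, Finset.sum_comm]
    _ ≤ L * K * Γ.card + ∑ z ∈ R, t * (B₁ * B₂) ^ (k + 1) := by
        refine Nat.add_le_add_left (Finset.sum_le_sum fun z _ => ?_) _
        have : ∑ c ∈ Γ, ((tup z).filter fun τ => ∀ i, I c (τ i).1 (τ i).2).card
            = ∑ τ ∈ tup z, (Γ.filter fun c => ∀ i, I c (τ i).1 (τ i).2).card := by
          simp only [Finset.card_filter]
          exact Finset.sum_comm
        rw [this]
        calc _ ≤ ∑ τ ∈ tup z, t := Finset.sum_le_sum fun τ hτ => hmult τ (Finset.mem_filter.1 hτ).2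
          _ = (tup z).card * t := by rw [Finset.sum_const, smul_eq_mul]
          _ ≤ _ := by
            rw [mul_comm]
            exact Nat.mul_le_mul_left _ (htup z)
    _ = _ := by
        rw [Finset.sum_const, smul_eq_mul, hR, Finset.card_product, Finset.card_range]
        ring

/-- A finite set of reals is cut by a monotone map into `r` blocks of nearly equal size. -/
theorem exists_monotone_blocks (A : Finset ℝ) (r : ℕ) (hr : 0 < r) :
    ∃ b : ℝ → ℕ, Monotone b ∧ (∀ x ∈ A, b x < r) ∧
      ∀ i, (A.filter fun x => b x = i).card ≤ A.card / r + 1 := by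
  classical
  let rk : ℝ → ℕ := fun x => (A.filter fun a => a < x).card
  have hmono : Monotone rk := fun x y hxy => Finset.card_le_card fun a ha => by
    simp only [Finset.mem_filter] at ha ⊢
    exact ⟨ha.1, ha.2.trans_le hxy⟩
  have hlt : ∀ x ∈ A, ∀ y, x < y → rk x < rk y := fun x hx y hxy =>
    Finset.card_lt_card <| by
      refine Finset.ssubset_iff_of_subset (fun a ha => ?_) |>.2 ⟨x, ?_, ?_⟩
      · simp only [Finset.mem_filter] at ha ⊢
        exact ⟨ha.1, ha.2.trans hxy⟩
      · simp [hx, hxy]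
      · simp
  refine ⟨fun x => rk x * r / A.card, fun x y hxy => ?_, fun x hx => ?_, fun i => ?_⟩
  · exact Nat.div_le_div_right (Nat.mul_le_mul_right _ (hmono hxy))
  · have h1 : rk x < A.card := Finset.card_lt_card <| by
      refine Finset.ssubset_iff_of_subset (Finset.filter_subset _ _) |>.2 ⟨x, hx, by simp⟩
    rw [Nat.div_lt_iff_lt_mul (by omega), mul_comm r]
    exact Nat.mul_lt_mul_of_pos_right h1 hr
  · rcases Nat.eq_zero_or_pos A.card with h0 | h0
    · rw [Finset.card_eq_zero] at h0
      simp [h0]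
    set q := (i * A.card + r - 1) / r with hq
    have hsub : (A.filter fun x => rk x * r / A.card = i).image rk
        ⊆ Finset.Ico q (q + (A.card / r + 1)) := by
      intro k hk
      obtain ⟨x, hx, rfl⟩ := Finset.mem_image.1 hk
      obtain ⟨hxA, hx⟩ := Finset.mem_filter.1 hx
      rw [Nat.div_eq_iff h0] at hx
      have e1 : i * A.card ≤ rk x * r := by omega
      have e2 : rk x * r < i * A.card + A.card := by omega
      have e3 : i * A.card ≤ q * r := by
        have h1 := Nat.div_add_mod (i * A.card + r - 1) r
        have h2 := Nat.mod_lt (i * A.card + r - 1) hr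
        rw [← hq, mul_comm] at h1
        generalize q * r = u at *
        generalize (i * A.card + r - 1) % r = v at *
        omega
      have e4 : A.card < (A.card / r + 1) * r := by
        have := Nat.div_add_mod A.card r
        have := Nat.mod_lt A.card hr
        rw [add_mul, mul_comm (A.card / r)]
        omega
      rw [Finset.mem_Ico]
      constructor
      · rw [hq]
        refine Nat.le_of_lt_succ ((Nat.div_lt_iff_lt_mul hr).2 ?_)
        rw [Nat.succ_mul]
        omega
      · refine lt_of_mul_lt_mul_right (a := r) ?_ (Nat.zero_le _)
        rw [add_mul]
        omega
    have hinj : Set.InjOn rk (A.filter fun x => rk x * r / A.card = i) := by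
      intro x hx y hy hxy
      have hx := (Finset.mem_filter.1 (Finset.mem_coe.1 hx)).1
      have hy := (Finset.mem_filter.1 (Finset.mem_coe.1 hy)).1
      rcases lt_trichotomy x y with h | h | h
      · exact absurd hxy (hlt x hx y h).ne
      · exact h
      · exact absurd hxy (hlt y hy x h).ne'
    have := Finset.card_le_card hsub
    rwa [Finset.card_image_of_injOn hinj, Nat.card_Ico, Nat.add_sub_cancel_left] at this

/-- The square of the Euclidean distance of two points of the plane. -/
def dsq (s p : ℝ × ℝ) : ℝ := (s.1 - p.1) ^ 2 + (s.2 - p.2) ^ 2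

theorem dsq_nonneg (s p : ℝ × ℝ) : 0 ≤ dsq s p := by
  unfold dsq
  positivity

theorem dsq_eq_zero_iff {s p : ℝ × ℝ} : dsq s p = 0 ↔ s = p := by
  unfold dsq
  constructor
  · intro h
    have h1 : s.1 - p.1 = 0 := by nlinarith [sq_nonneg (s.1 - p.1), sq_nonneg (s.2 - p.2)]
    have h2 : s.2 - p.2 = 0 := by nlinarith [sq_nonneg (s.1 - p.1), sq_nonneg (s.2 - p.2)]
    exact Prod.ext (by linarith) (by linarith)
  · rintro rfl
    simp

theorem continuous_dsq (p : ℝ × ℝ) : Continuous fun s => dsq s p := by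
  unfold dsq
  fun_prop

/-- The values of `dsq · p` on a closed set between two vertical lines form a closed set. -/
theorem isClosed_image_dsq {Z : Set (ℝ × ℝ)} (hZ : IsClosed Z) (p : ℝ × ℝ) :
    IsClosed ((fun s => dsq s p) '' Z) := by
  refine IsSeqClosed.isClosed ?_
  intro u a hu ha
  choose z hzZ hz using hu
  obtain ⟨M, hM⟩ := ha.bddAbove_range
  have hM' : ∀ n, dsq (z n) p ≤ M := fun n => by
    have := hM ⟨n, rfl⟩
    rw [← hz n] at this
    exact this
  have hbox : ∀ n, z n ∈ Set.Icc (p.1 - (M + 1), p.2 - (M + 1)) (p.1 + (M + 1), p.2 + (M + 1)) := by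
    intro n
    have h := hM' n
    have h0 := dsq_nonneg (z n) p
    unfold dsq at h h0
    have h1 : |(z n).1 - p.1| ≤ M + 1 :=
      abs_le_of_sq_le_sq (by nlinarith [sq_nonneg ((z n).2 - p.2)]) (by linarith)
    have h2 : |(z n).2 - p.2| ≤ M + 1 :=
      abs_le_of_sq_le_sq (by nlinarith [sq_nonneg ((z n).1 - p.1)]) (by linarith)
    rw [abs_le] at h1 h2
    exact ⟨⟨by simp only; linarith, by simp only; linarith⟩,
      ⟨by simp only; linarith, by simp only; linarith⟩⟩
  obtain ⟨w, -, φ, hφ, hw⟩ := isCompact_Icc.tendsto_subseq hbox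
  refine ⟨w, hZ.mem_of_tendsto hw (Filter.Eventually.of_forall fun n => hzZ _), ?_⟩
  refine tendsto_nhds_unique (((continuous_dsq p).tendsto w).comp hw) ?_
  have := ha.comp hφ.tendsto_atTop
  refine this.congr fun n => ?_
  simp [← hz]

/-- Near `z`, all distances to `p` close to that of `z` are attained on `Z` close to `z`. -/
def LocallyOntoAt (Z : Set (ℝ × ℝ)) (p z : ℝ × ℝ) : Prop :=
  ∀ ε > 0, ∃ δ > 0, ∀ u, |u - dsq z p| < δ → ∃ w ∈ Z, |w.1 - z.1| < ε ∧ dsq w p = u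

/-- Two distance functions on slabs of a closed set with a common value have a common value
attained at an exceptional point or on the boundary of a slab. -/
theorem exists_boundary_point_of_inter {Z E F : Set (ℝ × ℝ)} (hZ : IsClosed Z) {p q : ℝ × ℝ}
    (hE : ∀ z ∈ Z, z ∉ E → LocallyOntoAt Z p z) (hF : ∀ z ∈ Z, z ∉ F → LocallyOntoAt Z q z)
    {a b c d : ℝ} {s t : ℝ × ℝ} (hs : s ∈ Z) (ht : t ∈ Z) (hsx : s.1 ∈ Set.Icc a b)
    (htx : t.1 ∈ Set.Icc c d) (hst : dsq s p = dsq t q) :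
    ∃ s' ∈ Z, ∃ t' ∈ Z, s'.1 ∈ Set.Icc a b ∧ t'.1 ∈ Set.Icc c d ∧ dsq s' p = dsq t' q ∧
      ((s' ∈ E ∨ s'.1 = a ∨ s'.1 = b) ∨ (t' ∈ F ∨ t'.1 = c ∨ t'.1 = d)) := by
  have hslab : ∀ a b : ℝ, IsClosed (Z ∩ {z | z.1 ∈ Set.Icc a b}) := fun a b =>
    hZ.inter (isClosed_Icc.preimage continuous_fst)
  set A := (fun s => dsq s p) '' (Z ∩ {z | z.1 ∈ Set.Icc a b})
  set B := (fun s => dsq s q) '' (Z ∩ {z | z.1 ∈ Set.Icc c d})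
  have hA : IsClosed A := isClosed_image_dsq (hslab a b) p
  have hB : IsClosed B := isClosed_image_dsq (hslab c d) q
  set u := dsq s p
  let V : Set ℝ := {v | v ≤ u ∧ Set.Icc v u ⊆ A ∩ B}
  have huV : u ∈ V := by
    refine ⟨le_rfl, ?_⟩
    rw [Set.Icc_self, Set.singleton_subset_iff]
    exact ⟨⟨s, ⟨hs, hsx⟩, rfl⟩, ⟨t, ⟨ht, htx⟩, hst.symm⟩⟩
  have hVnn : ∀ v ∈ V, 0 ≤ v := by
    rintro v ⟨hv, hv'⟩
    obtain ⟨z, -, hz⟩ := (hv' ⟨le_rfl, hv⟩).1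
    rw [← hz]
    exact dsq_nonneg _ _
  have hbdd : BddBelow V := ⟨0, hVnn⟩
  set v₀ := sInf V
  have hv₀u : v₀ ≤ u := csInf_le hbdd huV
  have hIoc : Set.Ioc v₀ u ⊆ A ∩ B := by
    rintro x ⟨hx, hxu⟩
    obtain ⟨v, hv, hvx⟩ := exists_lt_of_csInf_lt ⟨u, huV⟩ hx
    exact hv.2 ⟨hvx.le, hxu⟩
  have hv₀ : v₀ ∈ A ∩ B := by
    rcases hv₀u.eq_or_lt with h | h
    · rw [h]
      exact huV.2 ⟨le_rfl, le_rfl⟩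
    · have := closure_mono hIoc
      rw [closure_Ioc h.ne, (hA.inter hB).closure_eq] at this
      exact this ⟨le_rfl, hv₀u⟩
  have hext : ∀ (Z E : Set (ℝ × ℝ)) (p : ℝ × ℝ) (a b : ℝ) (z : ℝ × ℝ),
      (∀ z ∈ Z, z ∉ E → LocallyOntoAt Z p z) → z ∈ Z → z.1 ∈ Set.Icc a b → dsq z p = v₀ →
      ¬ (z ∈ E ∨ z.1 = a ∨ z.1 = b) →
      ∃ δ > 0, ∀ u, |u - v₀| < δ → u ∈ (fun s => dsq s p) '' (Z ∩ {z | z.1 ∈ Set.Icc a b}) := by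
    intro Z E p a b z hloc hz hzx hzv hn
    push Not at hn
    obtain ⟨hzE, hza, hzb⟩ := hn
    have h1 : a < z.1 := lt_of_le_of_ne hzx.1 (Ne.symm hza)
    have h2 : z.1 < b := lt_of_le_of_ne hzx.2 hzb
    obtain ⟨δ, hδ, H⟩ := hloc z hz hzE (min (z.1 - a) (b - z.1))
      (lt_min (by linarith) (by linarith))
    rw [hzv] at H
    refine ⟨δ, hδ, fun u hu => ?_⟩
    obtain ⟨w, hw, hwz, hwu⟩ := H u hu
    have h3 := hwz.trans_le (min_le_left _ _)
    have h4 := hwz.trans_le (min_le_right _ _)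
    rw [abs_lt] at h3 h4
    exact ⟨w, ⟨hw, by constructor <;> linarith⟩, hwu⟩
  obtain ⟨s', ⟨hs', hs'x⟩, hs'v⟩ := hv₀.1
  obtain ⟨t', ⟨ht', ht'x⟩, ht'v⟩ := hv₀.2
  refine ⟨s', hs', t', ht', hs'x, ht'x, hs'v.trans ht'v.symm, ?_⟩
  by_contra hcon
  rw [not_or] at hcon
  obtain ⟨δ₁, hδ₁, H₁⟩ := hext Z E p a b s' hE hs' hs'x hs'v hcon.1
  obtain ⟨δ₂, hδ₂, H₂⟩ := hext Z F q c d t' hF ht' ht'x ht'v hcon.2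
  have hδ : 0 < min δ₁ δ₂ := lt_min hδ₁ hδ₂
  have hmem : v₀ - min δ₁ δ₂ / 2 ∈ V := by
    refine ⟨by linarith, fun x hx => ?_⟩
    rcases lt_or_ge v₀ x with h | h
    · exact hIoc ⟨h, hx.2⟩
    · have h3 : |x - v₀| < min δ₁ δ₂ := by
        rw [abs_lt]
        constructor <;> linarith [hx.1]
      exact ⟨H₁ x (h3.trans_le (min_le_left _ _)), H₂ x (h3.trans_le (min_le_right _ _))⟩
  have := csInf_le hbdd hmem
  linarith

theorem exists_finset_of_encard_le {α : Type*} {X : Set α} {κ : ℕ} (h : X.encard ≤ κ) :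
    ∃ F : Finset α, (∀ x, x ∈ F ↔ x ∈ X) ∧ F.card ≤ κ := by
  have hfin := Set.finite_of_encard_le_coe h
  refine ⟨hfin.toFinset, fun x => hfin.mem_toFinset, ?_⟩
  rw [hfin.encard_eq_coe_toFinset_card] at h
  exact_mod_cast h

theorem card_le_of_forall_mem {α : Type*} {X : Set α} {κ : ℕ} (h : X.encard ≤ κ) (F : Finset α)
    (hF : ∀ x ∈ F, x ∈ X) : F.card ≤ κ := by
  have := (Set.encard_le_encard (s := (F : Set α)) (t := X) hF).trans h
  rw [Set.encard_coe_eq_coe_finsetCard] at this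
  exact_mod_cast this

open Classical in
/-- The curve of pairs `(s, t)` with `dsq s p = dsq t q` meets linearly many cells of a grid on
`S × S`. -/
theorem card_cells_le {Z E F : Set (ℝ × ℝ)} {p q : ℝ × ℝ} {κ r : ℕ} (hr : 0 < r) (hZ : IsClosed Z)
    (hE : ∀ z ∈ Z, z ∉ E → LocallyOntoAt Z p z) (hF : ∀ z ∈ Z, z ∉ F → LocallyOntoAt Z q z)
    (hEκ : E.encard ≤ κ) (hFκ : F.encard ≤ κ)
    (hvert : ∀ c, {z ∈ Z | z.1 = c}.encard ≤ κ)
    (hp : ∀ ρ, {z ∈ Z | dsq z p = ρ}.encard ≤ κ) (hq : ∀ ρ, {z ∈ Z | dsq z q = ρ}.encard ≤ κ)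
    (S : Finset (ℝ × ℝ)) (hS : ∀ s ∈ S, s ∈ Z) (β : ℝ → ℕ) (hβ : Monotone β) :
    ((Finset.range r ×ˢ Finset.range r).filter fun z =>
      ∃ x ∈ S, ∃ y ∈ S, β x.1 = z.1 ∧ β y.1 = z.2 ∧ dsq x p = dsq y q).card ≤ 6 * r * κ ^ 2 := by
  have hwall : ∀ i, ∃ lo hi : ℝ, ∀ s ∈ S, β s.1 = i →
      s.1 ∈ Set.Icc lo hi ∧ β lo = i ∧ β hi = i := by
    intro i
    by_cases hne : ((S.filter fun s => β s.1 = i).image Prod.fst).Nonempty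
    · refine ⟨Finset.min' _ hne, Finset.max' _ hne, fun s hs hi => ?_⟩
      have hmem : s.1 ∈ (S.filter fun s => β s.1 = i).image Prod.fst :=
        Finset.mem_image_of_mem _ (Finset.mem_filter.2 ⟨hs, hi⟩)
      have hβi : ∀ x ∈ (S.filter fun s => β s.1 = i).image Prod.fst, β x = i := by
        intro x hx
        obtain ⟨s, hs, rfl⟩ := Finset.mem_image.1 hx
        exact (Finset.mem_filter.1 hs).2
      exact ⟨⟨Finset.min'_le _ _ hmem, Finset.le_max' _ _ hmem⟩, hβi _ (Finset.min'_mem _ _),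
        hβi _ (Finset.max'_mem _ _)⟩
    · refine ⟨0, 0, fun s hs hi => ?_⟩
      exact absurd ⟨s.1, Finset.mem_image_of_mem _ (Finset.mem_filter.2 ⟨hs, hi⟩)⟩ hne
  choose lo hi hlohi using hwall
  set W : Finset ℝ := (Finset.range r).image lo ∪ (Finset.range r).image hi with hW
  have hWcard : W.card ≤ 2 * r := by
    refine (Finset.card_union_le _ _).trans ?_
    have h1 := Finset.card_image_le (s := Finset.range r) (f := lo)
    have h2 := Finset.card_image_le (s := Finset.range r) (f := hi)
    rw [Finset.card_range] at h1 h2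
    omega
  choose V hV hVκ using fun c => exists_finset_of_encard_le (hvert c)
  choose Cp hCp hCpκ using fun ρ => exists_finset_of_encard_le (hp ρ)
  choose Cq hCq hCqκ using fun ρ => exists_finset_of_encard_le (hq ρ)
  obtain ⟨E', hE', hE'κ⟩ := exists_finset_of_encard_le hEκ
  obtain ⟨F', hF', hF'κ⟩ := exists_finset_of_encard_le hFκ
  have hVW : (W.biUnion V).card ≤ 2 * r * κ :=
    (Finset.card_biUnion_le_card_mul _ _ _ fun c _ => hVκ c).trans (Nat.mul_le_mul_right _ hWcard)
  set Sp := E' ∪ W.biUnion V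
  set Sq := F' ∪ W.biUnion V
  have hSp : Sp.card ≤ 3 * r * κ := by
    refine (Finset.card_union_le _ _).trans ?_
    nlinarith
  have hSq : Sq.card ≤ 3 * r * κ := by
    refine (Finset.card_union_le _ _).trans ?_
    nlinarith
  set M := (Sp.biUnion fun s => (Cq (dsq s p)).image fun t => (β s.1, β t.1)) ∪
    (Sq.biUnion fun t => (Cp (dsq t q)).image fun s => (β s.1, β t.1))
  have hM : M.card ≤ 6 * r * κ ^ 2 := by
    refine (Finset.card_union_le _ _).trans ?_
    have h1 := Finset.card_biUnion_le_card_mul Sp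
      (fun s => (Cq (dsq s p)).image fun t => (β s.1, β t.1)) κ
      fun s _ => Finset.card_image_le.trans (hCqκ _)
    have h2 := Finset.card_biUnion_le_card_mul Sq
      (fun t => (Cp (dsq t q)).image fun s => (β s.1, β t.1)) κ
      fun s _ => Finset.card_image_le.trans (hCpκ _)
    have h3 := Nat.mul_le_mul_right κ hSp
    have h4 := Nat.mul_le_mul_right κ hSq
    nlinarith
  refine (Finset.card_le_card ?_).trans hM
  rintro ⟨i, j⟩ hij
  simp only [Finset.mem_filter, Finset.mem_product, Finset.mem_range] at hij
  obtain ⟨⟨hi', hj'⟩, x, hx, y, hy, hxi, hyj, hxy⟩ := hij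
  obtain ⟨hx1, hx2, hx3⟩ := hlohi i x hx hxi
  obtain ⟨hy1, hy2, hy3⟩ := hlohi j y hy hyj
  obtain ⟨s, hs, t, ht, hsx, htx, hst, hor⟩ := exists_boundary_point_of_inter hZ hE hF
    (hS x hx) (hS y hy) hx1 hy1 hxy
  have hsi : β s.1 = i := le_antisymm ((hβ hsx.2).trans hx3.le) (hx2.symm.le.trans (hβ hsx.1))
  have htj : β t.1 = j := le_antisymm ((hβ htx.2).trans hy3.le) (hy2.symm.le.trans (hβ htx.1))
  have hwl : ∀ i < r, lo i ∈ W ∧ hi i ∈ W := fun i hi' =>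
    ⟨Finset.mem_union_left _ (Finset.mem_image_of_mem _ (Finset.mem_range.2 hi')),
      Finset.mem_union_right _ (Finset.mem_image_of_mem _ (Finset.mem_range.2 hi'))⟩
  rcases hor with h | h
  · refine Finset.mem_union_left _ (Finset.mem_biUnion.2 ⟨s, ?_, Finset.mem_image.2 ⟨t, ?_, ?_⟩⟩)
    · rcases h with h | h | h
      · exact Finset.mem_union_left _ ((hE' s).2 h)
      · exact Finset.mem_union_right _
          (Finset.mem_biUnion.2 ⟨lo i, (hwl i hi').1, (hV _ _).2 ⟨hs, h⟩⟩)
      · exact Finset.mem_union_right _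
          (Finset.mem_biUnion.2 ⟨hi i, (hwl i hi').2, (hV _ _).2 ⟨hs, h⟩⟩)
    · exact (hCq _ _).2 ⟨ht, hst.symm⟩
    · rw [hsi, htj]
  · refine Finset.mem_union_right _ (Finset.mem_biUnion.2 ⟨t, ?_, Finset.mem_image.2 ⟨s, ?_, ?_⟩⟩)
    · rcases h with h | h | h
      · exact Finset.mem_union_left _ ((hF' t).2 h)
      · exact Finset.mem_union_right _
          (Finset.mem_biUnion.2 ⟨lo j, (hwl j hj').1, (hV _ _).2 ⟨ht, h⟩⟩)
      · exact Finset.mem_union_right _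
          (Finset.mem_biUnion.2 ⟨hi j, (hwl j hj').2, (hV _ _).2 ⟨ht, h⟩⟩)
    · exact (hCp _ _).2 ⟨hs, hst⟩
    · rw [hsi, htj]

/-- `p` is a centre whose distance function on `Z` has fibres of size at most `κ` and is locally
onto away from at most `κ` points. -/
def AdmissibleCentre (Z : Set (ℝ × ℝ)) (κ : ℕ) (p : ℝ × ℝ) : Prop :=
  (∃ E : Set (ℝ × ℝ), E.encard ≤ κ ∧ ∀ z ∈ Z, z ∉ E → LocallyOntoAt Z p z) ∧
    ∀ ρ, {z ∈ Z | dsq z p = ρ}.encard ≤ κ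

open Classical in
/-- The pairs of points of `S` with the same distance to `p` and `q` respectively. -/
noncomputable def isodistantPairs (S : Finset (ℝ × ℝ)) (p q : ℝ × ℝ) :
    Finset ((ℝ × ℝ) × (ℝ × ℝ)) :=
  (S ×ˢ S).filter fun z => dsq z.1 p = dsq z.2 q

open Classical in
theorem sum_card_isodistantPairs_le {Z : Set (ℝ × ℝ)} {k κ r L t : ℕ} (hr : 0 < r)
    (hZ : IsClosed Z) (hvert : ∀ c, {z ∈ Z | z.1 = c}.encard ≤ κ)
    (S : Finset (ℝ × ℝ)) (hS : ∀ s ∈ S, s ∈ Z) (Γ : Finset ((ℝ × ℝ) × (ℝ × ℝ)))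
    (hΓ : ∀ c ∈ Γ, AdmissibleCentre Z κ c.1 ∧ AdmissibleCentre Z κ c.2)
    (G : (Fin (k + 1) → (ℝ × ℝ) × (ℝ × ℝ)) → Prop)
    (hgood : ∀ c ∈ Γ, ∀ X ⊆ S ×ˢ S, (∀ z ∈ X, dsq z.1 c.1 = dsq z.2 c.2) → L < X.card →
      ∃ τ, G τ ∧ ∀ i, τ i ∈ X)
    (hmult : ∀ τ, G τ →
      (Γ.filter fun c => ∀ i, dsq (τ i).1 c.1 = dsq (τ i).2 c.2).card ≤ t) :
    ∑ c ∈ Γ, (isodistantPairs S c.1 c.2).card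
      ≤ L * (6 * r * κ ^ 2) * Γ.card +
        t * (r ^ 2 * ((κ * (S.card / r + 1)) * (κ * (S.card / r + 1))) ^ (k + 1)) := by
  obtain ⟨β, hβ, hβr, hβB⟩ := exists_monotone_blocks (S.image Prod.fst) r hr
  have hβr' : ∀ s ∈ S, β s.1 < r := fun s hs => hβr _ (Finset.mem_image_of_mem _ hs)
  have hB : ∀ i, (S.filter fun s => β s.1 = i).card ≤ κ * (S.card / r + 1) := by
    intro i
    rw [Finset.card_eq_sum_card_fiberwise (f := Prod.fst)
      (t := (S.image Prod.fst).filter fun x => β x = i)]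
    · calc _ ≤ ∑ x ∈ (S.image Prod.fst).filter fun x => β x = i, κ := by
            refine Finset.sum_le_sum fun x _ => ?_
            refine card_le_of_forall_mem (hvert x) _ fun s hs => ?_
            rw [Finset.mem_filter, Finset.mem_filter] at hs
            exact ⟨hS s hs.1.1, hs.2⟩
        _ ≤ _ := by
            rw [Finset.sum_const, smul_eq_mul, mul_comm]
            refine Nat.mul_le_mul_left _ ((hβB i).trans ?_)
            exact Nat.add_le_add_right (Nat.div_le_div_right Finset.card_image_le) _
    · intro s hs
      rw [Finset.coe_filter, Set.mem_ofPred_eq] at hs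
      rw [Finset.coe_filter, Set.mem_ofPred_eq]
      exact ⟨Finset.mem_image_of_mem _ hs.1, hs.2⟩
  refine sum_incidences_le S S (fun s => β s.1) (fun s => β s.1) Γ
    (fun c x y => dsq x c.1 = dsq y c.2) G hβr' hβr' hB hB ?_ hgood hmult
  intro c hc
  obtain ⟨⟨⟨E, hE, hE'⟩, hp⟩, ⟨F, hF, hF'⟩, hq⟩ := hΓ c hc
  exact card_cells_le hr hZ hE' hF' hE hF hvert hp hq S hS β hβ

/-- The number of distinct squared distances, including zero, within a finite set of points. -/
noncomputable def numDist (P : Finset (ℝ × ℝ)) : ℕ :=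
  ((P ×ˢ P).image fun z => dsq z.1 z.2).card

open Classical in
theorem sq_mul_sq_le_numDist_mul_sum {S P : Finset (ℝ × ℝ)} (hSP : S ⊆ P) :
    S.card ^ 2 * P.card ^ 2 ≤
      numDist P * ∑ c ∈ P ×ˢ P, (isodistantPairs S c.1 c.2).card := by
  have h := card_sq_le_card_image_mul_card_fiber_pairs (S ×ˢ P) fun z => dsq z.1 z.2
  rw [Finset.card_product, mul_pow] at h
  refine h.trans (Nat.mul_le_mul ?_ ?_)
  · exact Finset.card_le_card (Finset.image_subset_image (Finset.product_subset_product_left hSP))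
  · rw [← Finset.card_sigma]
    refine Finset.card_le_card_of_injOn
      (fun z => ⟨(z.1.2, z.2.2), (z.1.1, z.2.1)⟩) ?_ ?_
    · rintro ⟨⟨s, p⟩, ⟨t, q⟩⟩ hz
      simp only [Finset.coe_filter, Finset.mem_product, Set.mem_ofPred_eq] at hz
      simp only [Finset.mem_coe, Finset.mem_sigma, Finset.mem_product, isodistantPairs,
        Finset.mem_filter]
      exact ⟨⟨hz.1.1.2, hz.1.2.2⟩, ⟨hz.1.1.1, hz.1.2.1⟩, hz.2⟩
    · rintro ⟨⟨s, p⟩, ⟨t, q⟩⟩ _ ⟨⟨s', p'⟩, ⟨t', q'⟩⟩ _ h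
      simp only [Sigma.mk.injEq, Prod.mk.injEq, heq_eq_eq] at h
      obtain ⟨⟨rfl, rfl⟩, rfl, rfl⟩ := h
      rfl

theorem card_isodistantPairs_le {Z : Set (ℝ × ℝ)} {κ : ℕ} {S : Finset (ℝ × ℝ)}
    (hS : ∀ s ∈ S, s ∈ Z) {p q : ℝ × ℝ} (hq : ∀ ρ, {z ∈ Z | dsq z q = ρ}.encard ≤ κ) :
    (isodistantPairs S p q).card ≤ S.card * κ := by
  classical
  rw [Finset.card_eq_sum_card_fiberwise (f := Prod.fst) (t := S)]
  · calc _ ≤ ∑ s ∈ S, κ := by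
          refine Finset.sum_le_sum fun s _ => ?_
          rw [← Finset.card_image_of_injOn (f := Prod.snd)]
          · refine card_le_of_forall_mem (hq (dsq s p)) _ fun t ht => ?_
            obtain ⟨z, hz, rfl⟩ := Finset.mem_image.1 ht
            simp only [isodistantPairs, Finset.mem_filter, Finset.mem_product] at hz
            obtain ⟨⟨⟨h1, h2⟩, h3⟩, h4⟩ := hz
            exact ⟨hS _ h2, by rw [← h3, ← h4]⟩
          · intro z hz w hw hzw
            simp only [Finset.coe_filter, Set.mem_ofPred_eq] at hz hw
            exact Prod.ext (hz.2.trans hw.2.symm) hzw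
      _ = _ := by rw [Finset.sum_const, smul_eq_mul]
  · intro z hz
    simp only [isodistantPairs, Finset.coe_filter, Finset.mem_product, Set.mem_ofPred_eq] at hz
    exact hz.1.1

open Filter Topology in
theorem locallyOntoAt_of_hasFDerivAt_of_pos {F : ℝ × ℝ → ℝ} (hF : Continuous F) {p z : ℝ × ℝ}
    {L : ℝ × ℝ →L[ℝ] ℝ} (hL : HasFDerivAt F L z) (hz : F z = 0)
    (hpos : 0 < L (-(z.2 - p.2), z.1 - p.1)) :
    LocallyOntoAt {w | F w = 0} p z := by
  intro ε hε
  set ρ := dsq z p with hρ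
  have hρ0 : 0 < ρ := by
    rcases (dsq_nonneg z p).eq_or_lt with h | h
    · have := dsq_eq_zero_iff.1 h.symm
      subst this
      simp only [sub_self, neg_zero] at hpos
      rw [show ((0 : ℝ), (0 : ℝ)) = 0 from rfl, map_zero] at hpos
      exact absurd hpos (lt_irrefl _)
    · exact h
  let γ : ℝ → ℝ → ℝ × ℝ := fun l θ =>
    (p.1 + l * (Real.cos θ * (z.1 - p.1) - Real.sin θ * (z.2 - p.2)),
      p.2 + l * (Real.sin θ * (z.1 - p.1) + Real.cos θ * (z.2 - p.2)))
  have hγ0 : γ 1 0 = z := by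
    ext <;> simp [γ]
  have hγc : Continuous fun x : ℝ × ℝ => γ x.1 x.2 := by
    simp only [γ]
    fun_prop
  have hγd : ∀ l θ, dsq (γ l θ) p = l ^ 2 * ρ := by
    intro l θ
    simp only [γ, hρ, dsq]
    have := Real.sin_sq_add_cos_sq θ
    linear_combination (l ^ 2 * ((z.1 - p.1) ^ 2 + (z.2 - p.2) ^ 2)) * this
  have hder : HasDerivAt (fun θ => F (γ 1 θ)) (L (-(z.2 - p.2), z.1 - p.1)) 0 := by
    have h1 : HasDerivAt (fun θ => γ 1 θ) (-(z.2 - p.2), z.1 - p.1) 0 := by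
      refine HasDerivAt.prodMk ?_ ?_
      · have := ((((Real.hasDerivAt_cos 0).mul_const (z.1 - p.1)).sub
          ((Real.hasDerivAt_sin 0).mul_const (z.2 - p.2))).const_mul 1).const_add p.1
        simpa using this
      · have := ((((Real.hasDerivAt_sin 0).mul_const (z.1 - p.1)).add
          ((Real.hasDerivAt_cos 0).mul_const (z.2 - p.2))).const_mul 1).const_add p.2
        simpa using this
    have h2 : HasFDerivAt F L (γ 1 0) := by rwa [hγ0]
    exact h2.comp_hasDerivAt 0 h1
  have h0 : F (γ 1 0) = 0 := by rw [hγ0, hz]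
  have hnear : ∀ᶠ x : ℝ × ℝ in 𝓝 (1, 0), |(γ x.1 x.2).1 - z.1| < ε := by
    have hc : Continuous fun x : ℝ × ℝ => |(γ x.1 x.2).1 - z.1| := by fun_prop
    refine hc.continuousAt.eventually_lt continuousAt_const ?_
    simp [hγ0, hε]
  obtain ⟨η₀, hη₀, hη₀'⟩ := Metric.eventually_nhds_iff.1 hnear
  have hslope := hasDerivAt_iff_tendsto_slope.1 hder
  have hsl := hslope.eventually (lt_mem_nhds hpos)
  obtain ⟨η₁, hη₁, hη₁'⟩ := Metric.eventually_nhds_iff.1 (eventually_nhdsWithin_iff.1 hsl)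
  set η := min η₀ η₁ / 2 with hη
  have hηpos : 0 < η := by positivity
  have hη0 : η < η₀ := by have := min_le_left η₀ η₁; linarith
  have hη1 : η < η₁ := by have := min_le_right η₀ η₁; linarith
  have hp1 : 0 < F (γ 1 η) := by
    have := hη₁' (y := η) (by simp [abs_of_pos hηpos, hη1]) (by simp [hηpos.ne'])
    rw [slope_def_field, h0] at this
    simp only [sub_zero] at this
    exact (div_pos_iff_of_pos_right hηpos).1 this
  have hn1 : F (γ 1 (-η)) < 0 := by
    have := hη₁' (y := -η) (by simp [abs_of_pos hηpos, hη1]) (by simp [hηpos.ne'])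
    rw [slope_def_field, h0] at this
    simp only [sub_zero] at this
    by_contra! hc
    have := div_nonpos_of_nonneg_of_nonpos hc (by linarith : -η ≤ 0)
    linarith
  have hμc : ContinuousAt (fun u => Real.sqrt (u / ρ)) ρ := by fun_prop
  have hμ1 : Real.sqrt (ρ / ρ) = 1 := by rw [div_self hρ0.ne', Real.sqrt_one]
  have hFγ : ∀ θ, ContinuousAt (fun u => F (γ (Real.sqrt (u / ρ)) θ)) ρ := by
    intro θ
    have : Continuous fun l => F (γ l θ) :=
      hF.comp (hγc.comp (Continuous.prodMk continuous_id continuous_const))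
    exact ContinuousAt.comp (g := fun l => F (γ l θ)) this.continuousAt hμc
  have e1 : ∀ᶠ u in 𝓝 ρ, 0 < F (γ (Real.sqrt (u / ρ)) η) := by
    refine continuousAt_const.eventually_lt (hFγ η) ?_
    rw [hμ1]
    exact hp1
  have e2 : ∀ᶠ u in 𝓝 ρ, F (γ (Real.sqrt (u / ρ)) (-η)) < 0 := by
    refine (hFγ (-η)).eventually_lt continuousAt_const ?_
    rw [hμ1]
    exact hn1
  have e3 : ∀ᶠ u in 𝓝 ρ, dist (Real.sqrt (u / ρ)) 1 < η₀ := by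
    have : ContinuousAt (fun u => dist (Real.sqrt (u / ρ)) 1) ρ := hμc.dist continuousAt_const
    refine this.eventually_lt continuousAt_const ?_
    rw [hμ1, dist_self]
    exact hη₀
  obtain ⟨δ, hδ, H⟩ := Metric.eventually_nhds_iff.1
    (e1.and (e2.and (e3.and (lt_mem_nhds hρ0))))
  refine ⟨δ, hδ, fun u hu => ?_⟩
  obtain ⟨u1, u2, u3, u4⟩ := H (y := u) (by rwa [Real.dist_eq])
  set l := Real.sqrt (u / ρ)
  have hcont : ContinuousOn (fun θ => F (γ l θ)) (Set.Icc (-η) η) :=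
    (hF.comp (hγc.comp (Continuous.prodMk continuous_const continuous_id))).continuousOn
  obtain ⟨θ, hθ, hθ0⟩ := intermediate_value_Icc (by linarith : -η ≤ η) hcont ⟨u2.le, u1.le⟩
  refine ⟨γ l θ, hθ0, ?_, ?_⟩
  · refine hη₀' (y := (l, θ)) ?_
    rw [Prod.dist_eq, max_lt_iff]
    refine ⟨u3, ?_⟩
    rw [Real.dist_eq, sub_zero]
    exact (abs_le.2 hθ).trans_lt hη0
  · rw [hγd, Real.sq_sqrt (by positivity)]
    field_simp

theorem locallyOntoAt_of_hasFDerivAt {F : ℝ × ℝ → ℝ} (hF : Continuous F) {p z : ℝ × ℝ}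
    {L : ℝ × ℝ →L[ℝ] ℝ} (hL : HasFDerivAt F L z) (hz : F z = 0)
    (hne : L (-(z.2 - p.2), z.1 - p.1) ≠ 0) :
    LocallyOntoAt {w | F w = 0} p z := by
  rcases hne.lt_or_gt with h | h
  · have := locallyOntoAt_of_hasFDerivAt_of_pos (F := -F) hF.neg (p := p) hL.neg (by simp [hz])
      (by simpa using h)
    simpa using this
  · exact locallyOntoAt_of_hasFDerivAt_of_pos hF hL hz h

/-- The value of a bivariate polynomial at a point of the plane. -/
noncomputable def evalAt (f : MvPolynomial (Fin 2) ℝ) (s : ℝ × ℝ) : ℝ :=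
  MvPolynomial.eval ![s.1, s.2] f

theorem MvPolynomial.exists_natDegree_le_of_unique {σ : Type*} [Unique σ]
    {u : MvPolynomial σ ℝ} (hu : u ≠ 0) :
    ∃ v : Polynomial ℝ, v ≠ 0 ∧ v.natDegree ≤ u.totalDegree ∧
      ∀ x : σ → ℝ, MvPolynomial.eval x u = v.eval (x default) := by
  refine ⟨MvPolynomial.uniqueAlgEquiv ℝ σ u, ?_, ?_, ?_⟩
  · exact (map_ne_zero_iff _ (AlgEquiv.injective _)).2 hu
  · have := MvPolynomial.aeval_natDegree_le (m := u.totalDegree) (n := 1) u le_rfl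
      (fun _ => Polynomial.X) (fun _ => Polynomial.natDegree_X_le)
    rw [mul_one] at this
    exact this
  · intro x
    have := MvPolynomial.eval₂_uniqueAlgEquiv (R := ℝ) (σ := σ) (f := u) (φ := RingHom.id ℝ)
      (a := x)
    rw [Polynomial.eval, MvPolynomial.eval, MvPolynomial.coe_eval₂Hom]
    exact this.symm

theorem MvPolynomial.totalDegree_det_le {σ ι : Type*} [Fintype ι] [DecidableEq ι]
    {A : Matrix ι ι (MvPolynomial σ ℝ)} {e : ℕ} (hA : ∀ i j, (A i j).totalDegree ≤ e) :
    A.det.totalDegree ≤ Fintype.card ι * e := by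
  rw [Matrix.det_apply]
  refine MvPolynomial.totalDegree_finsetSum_le fun τ _ => ?_
  have h : (∏ i, A (τ i) i).totalDegree ≤ Fintype.card ι * e := by
    refine (MvPolynomial.totalDegree_finsetProd _ _).trans ?_
    refine (Finset.sum_le_sum fun i _ => hA (τ i) i).trans ?_
    simp
  rcases Int.units_eq_one_or (Equiv.Perm.sign τ) with h1 | h1
  · rwa [h1, one_smul]
  · rwa [h1, Units.neg_smul, one_smul, MvPolynomial.totalDegree_neg]

open Polynomial in
theorem Polynomial.totalDegree_resultant_le {σ : Type*} {f g : (MvPolynomial σ ℝ)[X]} {e m n : ℕ}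
    (hf : ∀ i, (f.coeff i).totalDegree ≤ e) (hg : ∀ i, (g.coeff i).totalDegree ≤ e) :
    (resultant f g m n).totalDegree ≤ (m + n) * e := by
  have := MvPolynomial.totalDegree_det_le (A := sylvester f g m n) (e := e) ?_
  · rwa [Fintype.card_fin] at this
  · intro i j
    induction j using Fin.addCases <;>
    · simp only [sylvester, Matrix.of_apply, Fin.addCases_left, Fin.addCases_right]
      split_ifs
      · first | exact hf _ | exact hg _
      · simp

open Polynomial in
/-- Two polynomials, one of them irreducible and not dividing the other one, have a nonzero
resultant. -/
theorem Irreducible.resultant_ne_zero {R : Type*} [CommRing R] [IsDomain R]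
    [NormalizedGCDMonoid R] {f g : R[X]} (hf : Irreducible f) (hf0 : f.natDegree ≠ 0)
    (hfg : ¬ f ∣ g) : resultant f g ≠ 0 := by
  have hp := hf.isPrimitive hf0
  have hinj : Function.Injective (algebraMap R (FractionRing R)) :=
    FaithfulSMul.algebraMap_injective _ _
  have h1 : Irreducible (f.map (algebraMap R (FractionRing R))) :=
    hp.irreducible_iff_irreducible_map_fraction_map.1 hf
  have h2 : ¬ f.map (algebraMap R (FractionRing R)) ∣ g.map (algebraMap R (FractionRing R)) :=
    fun h => hfg (hp.dvd_of_fraction_map_dvd_fraction_map h)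
  have h3 := Polynomial.resultant_ne_zero _ _ (h1.coprime_iff_not_dvd.2 h2)
  rw [natDegree_map_eq_of_injective hinj, natDegree_map_eq_of_injective hinj,
    resultant_map_map] at h3
  intro h
  rw [h, map_zero] at h3
  exact h3 rfl

theorem exists_eliminant {f g : MvPolynomial (Fin 2) ℝ} {d e : ℕ} (hf : Irreducible f)
    (hd : f.totalDegree ≤ d) (he : g.totalDegree ≤ e) (hfg : ¬ f ∣ g) :
    ∃ v : Polynomial ℝ, v ≠ 0 ∧ v.natDegree ≤ (d + e + 1) ^ 2 ∧
      ∀ s, evalAt f s = 0 → evalAt g s = 0 → v.eval s.2 = 0 := by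
  let Φ := MvPolynomial.finSuccEquiv ℝ 1
  have hev : ∀ (h : MvPolynomial (Fin 2) ℝ) (s : ℝ × ℝ),
      evalAt h s = Polynomial.eval s.1 (Polynomial.map (MvPolynomial.eval ![s.2]) (Φ h)) :=
    fun h s => MvPolynomial.eval_eq_eval_mv_eval' ![s.2] s.1 h
  have hcoeff : ∀ (h : MvPolynomial (Fin 2) ℝ) i, ((Φ h).coeff i).totalDegree ≤ h.totalDegree := by
    intro h i
    by_cases hi : (Φ h).coeff i = 0
    · simp [hi]
    · have := MvPolynomial.totalDegree_coeff_finSuccEquiv_add_le h i hi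
      simp only [Φ]
      omega
  have hdeg : ∀ h : MvPolynomial (Fin 2) ℝ, (Φ h).natDegree ≤ h.totalDegree := by
    intro h
    rw [MvPolynomial.natDegree_finSuccEquiv]
    exact MvPolynomial.degreeOf_le_totalDegree _ _
  have hfΦ : Irreducible (Φ f) := (MulEquiv.irreducible_iff Φ).2 hf
  have hfgΦ : ¬ Φ f ∣ Φ g := fun h => hfg ((map_dvd_iff Φ).1 h)
  suffices ∃ u : MvPolynomial (Fin 1) ℝ, u ≠ 0 ∧ u.totalDegree ≤ (d + e + 1) ^ 2 ∧
      ∀ s : ℝ × ℝ, evalAt f s = 0 → evalAt g s = 0 → MvPolynomial.eval ![s.2] u = 0 by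
    obtain ⟨u, hu, hu', H⟩ := this
    obtain ⟨v, hv, hv', hv''⟩ := MvPolynomial.exists_natDegree_le_of_unique hu
    refine ⟨v, hv, hv'.trans hu', fun s h1 h2 => ?_⟩
    have := H s h1 h2
    rw [hv''] at this
    simpa using this
  by_cases h0 : (Φ f).natDegree = 0
  · rw [Polynomial.natDegree_eq_zero] at h0
    obtain ⟨u, hu⟩ := h0
    refine ⟨u, ?_, ?_, ?_⟩
    · rintro rfl
      exact hfΦ.ne_zero (by rw [← hu, map_zero])
    · have := hcoeff f 0
      rw [← hu, Polynomial.coeff_C_zero] at this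
      nlinarith
    · intro s h1 _
      rw [hev, ← hu] at h1
      simpa using h1
  · have : Nonempty (NormalizedGCDMonoid (MvPolynomial (Fin 1) ℝ)) := inferInstance
    have := this.some
    refine ⟨Polynomial.resultant (Φ f) (Φ g), hfΦ.resultant_ne_zero h0 hfgΦ, ?_, ?_⟩
    · refine (Polynomial.totalDegree_resultant_le (e := d + e)
        (fun i => (hcoeff f i).trans (by omega)) (fun i => (hcoeff g i).trans (by omega))).trans ?_
      have h1 := hdeg f
      have h2 := hdeg g
      rw [pow_two]
      exact Nat.mul_le_mul (by omega) (by omega)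
    · intro s h1 h2
      obtain ⟨p, q, -, -, h⟩ := Polynomial.exists_mul_add_mul_eq_C_resultant (Φ f) (Φ g) le_rfl
        le_rfl (Or.inl h0)
      have := congrArg
        (fun P => Polynomial.eval s.1 (Polynomial.map (MvPolynomial.eval ![s.2]) P)) h
      simp only [Polynomial.map_add, Polynomial.map_mul, Polynomial.eval_add, Polynomial.eval_mul,
        ← hev, h1, h2, zero_mul, add_zero, Polynomial.map_C, Polynomial.eval_C] at this
      exact this.symm

theorem evalAt_rename_swap (f : MvPolynomial (Fin 2) ℝ) (s : ℝ × ℝ) :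
    evalAt (MvPolynomial.renameEquiv ℝ (Equiv.swap 0 1) f) s = evalAt f s.swap := by
  rw [evalAt, evalAt, MvPolynomial.renameEquiv_apply, MvPolynomial.eval_rename]
  congr 2
  ext i
  fin_cases i <;> simp

/-- A weak form of Bézout's theorem. -/
theorem encard_common_zeros_le {f g : MvPolynomial (Fin 2) ℝ} {d e : ℕ} (hf : Irreducible f)
    (hd : f.totalDegree ≤ d) (he : g.totalDegree ≤ e) (hfg : ¬ f ∣ g) :
    {s | evalAt f s = 0 ∧ evalAt g s = 0}.encard ≤ ((d + e + 1) ^ 4 : ℕ) := by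
  obtain ⟨v, hv, hv', hvr⟩ := exists_eliminant hf hd he hfg
  let τ := MvPolynomial.renameEquiv ℝ (Equiv.swap (0 : Fin 2) 1)
  obtain ⟨w, hw, hw', hwr⟩ := exists_eliminant (f := τ f) (g := τ g) (d := d) (e := e)
    ((MulEquiv.irreducible_iff τ).2 hf)
    (by rwa [MvPolynomial.totalDegree_renameEquiv]) (by rwa [MvPolynomial.totalDegree_renameEquiv])
    (fun h => hfg ((map_dvd_iff τ).1 h))
  classical
  have hsub : {s | evalAt f s = 0 ∧ evalAt g s = 0} ⊆ (w.roots.toFinset ×ˢ v.roots.toFinset :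
      Finset (ℝ × ℝ)) := by
    rintro s ⟨h1, h2⟩
    rw [Finset.mem_coe, Finset.mem_product, Multiset.mem_toFinset, Multiset.mem_toFinset,
      Polynomial.mem_roots hv, Polynomial.mem_roots hw]
    refine ⟨?_, hvr s h1 h2⟩
    have := hwr s.swap
    rw [evalAt_rename_swap, evalAt_rename_swap, Prod.swap_swap] at this
    exact this h1 h2
  refine (Set.encard_le_encard hsub).trans ?_
  rw [Set.encard_coe_eq_coe_finsetCard, Finset.card_product]
  have h1 : w.roots.toFinset.card ≤ (d + e + 1) ^ 2 :=
    (Multiset.toFinset_card_le _).trans ((Polynomial.card_roots' _).trans hw')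
  have h2 : v.roots.toFinset.card ≤ (d + e + 1) ^ 2 :=
    (Multiset.toFinset_card_le _).trans ((Polynomial.card_roots' _).trans hv')
  have := Nat.mul_le_mul h1 h2
  rw [← pow_add] at this
  exact_mod_cast this

section evalAt

variable (f g : MvPolynomial (Fin 2) ℝ) (s : ℝ × ℝ)

theorem evalAt_add : evalAt (f + g) s = evalAt f s + evalAt g s := map_add _ _ _

theorem evalAt_mul : evalAt (f * g) s = evalAt f s * evalAt g s := map_mul _ _ _

theorem evalAt_sub : evalAt (f - g) s = evalAt f s - evalAt g s := map_sub _ _ _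

theorem evalAt_C (a : ℝ) : evalAt (MvPolynomial.C a) s = a := MvPolynomial.eval_C a

theorem evalAt_X_zero : evalAt (MvPolynomial.X 0) s = s.1 := by simp [evalAt]

theorem evalAt_X_one : evalAt (MvPolynomial.X 1) s = s.2 := by simp [evalAt]

end evalAt

open MvPolynomial in
/-- The linear polynomial `a x + b y + c`. -/
noncomputable def linPoly (a b c : ℝ) : MvPolynomial (Fin 2) ℝ :=
  C a * X 0 + C b * X 1 + C c

open MvPolynomial in
/-- The polynomial `a x² + b x y + c y² + d x + e y + k`. -/
noncomputable def quadPoly (a b c d e k : ℝ) : MvPolynomial (Fin 2) ℝ :=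
  linPoly a b d * X 0 + linPoly 0 c e * X 1 + C k

theorem evalAt_linPoly (a b c : ℝ) (s : ℝ × ℝ) :
    evalAt (linPoly a b c) s = a * s.1 + b * s.2 + c := by
  simp [linPoly, evalAt_add, evalAt_mul, evalAt_C, evalAt_X_zero, evalAt_X_one]

theorem evalAt_quadPoly (a b c d e k : ℝ) (s : ℝ × ℝ) :
    evalAt (quadPoly a b c d e k) s =
      a * s.1 ^ 2 + b * s.1 * s.2 + c * s.2 ^ 2 + d * s.1 + e * s.2 + k := by
  simp only [quadPoly, evalAt_add, evalAt_mul, evalAt_C, evalAt_X_zero, evalAt_X_one,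
    evalAt_linPoly]
  ring

theorem totalDegree_linPoly_le (a b c : ℝ) : (linPoly a b c).totalDegree ≤ 1 := by
  have h : ∀ (a : ℝ) (i : Fin 2), (MvPolynomial.C a * MvPolynomial.X i).totalDegree ≤ 1 := by
    intro a i
    refine (MvPolynomial.totalDegree_mul _ _).trans ?_
    simp
  refine (MvPolynomial.totalDegree_add _ _).trans (max_le ?_ (by simp))
  exact (MvPolynomial.totalDegree_add _ _).trans (max_le (h _ _) (h _ _))

theorem totalDegree_quadPoly_le (a b c d e k : ℝ) : (quadPoly a b c d e k).totalDegree ≤ 2 := by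
  have h : ∀ (a b c : ℝ) (i : Fin 2),
      (linPoly a b c * MvPolynomial.X i).totalDegree ≤ 2 := by
    intro a b c i
    refine (MvPolynomial.totalDegree_mul _ _).trans ?_
    have := totalDegree_linPoly_le a b c
    simp only [MvPolynomial.totalDegree_X]
    omega
  refine (MvPolynomial.totalDegree_add _ _).trans (max_le ?_ (by simp))
  exact (MvPolynomial.totalDegree_add _ _).trans (max_le (h _ _ _ _) (h _ _ _ _))

theorem totalDegree_pderiv_lt {f : MvPolynomial (Fin 2) ℝ} {i : Fin 2}
    (h : MvPolynomial.pderiv i f ≠ 0) :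
    (MvPolynomial.pderiv i f).totalDegree < f.totalDegree := by
  have h0 : 0 < f.totalDegree := by
    by_contra! h0
    rw [nonpos_iff_eq_zero, MvPolynomial.totalDegree_eq_zero_iff_eq_C] at h0
    rw [h0, MvPolynomial.pderiv_C] at h
    exact h rfl
  rw [← Nat.le_sub_one_iff_lt h0]
  conv_lhs => rw [f.as_sum, map_sum]
  refine MvPolynomial.totalDegree_finsetSum_le fun m hm => ?_
  rw [MvPolynomial.pderiv_monomial]
  by_cases hi : m i = 0
  · simp [hi]
  · refine (MvPolynomial.totalDegree_monomial_le _ _).trans ?_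
    have h1 := MvPolynomial.le_totalDegree hm
    rw [Finsupp.sum_fintype _ _ (by simp), Fin.sum_univ_two] at h1 ⊢
    fin_cases i <;> simp at hi ⊢ <;> omega

theorem continuous_evalAt (f : MvPolynomial (Fin 2) ℝ) : Continuous (evalAt f) := by
  unfold evalAt
  refine (MvPolynomial.continuous_eval f).comp ?_
  refine continuous_pi fun i => ?_
  fin_cases i
  · exact continuous_fst
  · exact continuous_snd

theorem hasFDerivAt_evalAt (f : MvPolynomial (Fin 2) ℝ) (s : ℝ × ℝ) :
    HasFDerivAt (evalAt f)
      (evalAt (MvPolynomial.pderiv 0 f) s • ContinuousLinearMap.fst ℝ ℝ ℝ +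
        evalAt (MvPolynomial.pderiv 1 f) s • ContinuousLinearMap.snd ℝ ℝ ℝ) s := by
  induction f using MvPolynomial.induction_on with
  | C a =>
    have : evalAt (MvPolynomial.C a) = fun _ => a := funext fun s => evalAt_C s a
    rw [this, MvPolynomial.pderiv_C, MvPolynomial.pderiv_C]
    convert! hasFDerivAt_const a s
    ext <;> simp [evalAt]
  | add p q hp hq =>
    have : evalAt (p + q) = evalAt p + evalAt q := funext fun s => evalAt_add p q s
    rw [this]
    refine (hp.add hq).congr_fderiv ?_
    ext <;> simp [evalAt_add]
  | mul_X p i hp =>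
    have h : evalAt (p * MvPolynomial.X i) = evalAt p * evalAt (MvPolynomial.X i) :=
      funext fun s => evalAt_mul p _ s
    rw [h]
    fin_cases i
    · have hX : evalAt (MvPolynomial.X 0) = Prod.fst := funext evalAt_X_zero
      simp only [Fin.zero_eta, hX]
      refine (hp.mul hasFDerivAt_fst).congr_fderiv ?_
      ext <;> simp [evalAt_add, evalAt_mul, evalAt_X_zero, MvPolynomial.pderiv_X]
    · have hX : evalAt (MvPolynomial.X 1) = Prod.snd := funext evalAt_X_one
      simp only [Fin.mk_one, hX]
      refine (hp.mul hasFDerivAt_snd).congr_fderiv ?_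
      ext <;> simp [evalAt_add, evalAt_mul, evalAt_X_one, MvPolynomial.pderiv_X]

/-- The substitution of an affine map into a polynomial. -/
noncomputable def affineSubst (a b u c d v : ℝ) (f : MvPolynomial (Fin 2) ℝ) :
    MvPolynomial (Fin 2) ℝ :=
  MvPolynomial.bind₁ ![linPoly a b u, linPoly c d v] f

theorem evalAt_affineSubst (a b u c d v : ℝ) (f : MvPolynomial (Fin 2) ℝ) (s : ℝ × ℝ) :
    evalAt (affineSubst a b u c d v f) s =
      evalAt f (a * s.1 + b * s.2 + u, c * s.1 + d * s.2 + v) := by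
  rw [affineSubst]
  induction f using MvPolynomial.induction_on with
  | C a => simp [evalAt]
  | add p q hp hq => rw [map_add, evalAt_add, evalAt_add, hp, hq]
  | mul_X p i hp =>
    rw [map_mul, evalAt_mul, evalAt_mul, hp, MvPolynomial.bind₁_X_right]
    fin_cases i <;> simp [evalAt_linPoly, evalAt_X_zero, evalAt_X_one]

theorem totalDegree_affineSubst_le (a b u c d v : ℝ) (f : MvPolynomial (Fin 2) ℝ) :
    (affineSubst a b u c d v f).totalDegree ≤ f.totalDegree := by
  rw [affineSubst, MvPolynomial.bind₁, MvPolynomial.aeval_def, MvPolynomial.eval₂_eq']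
  refine MvPolynomial.totalDegree_finsetSum_le fun m hm => ?_
  have h1 := MvPolynomial.le_totalDegree hm
  rw [Finsupp.sum_fintype _ _ (by simp), Fin.sum_univ_two] at h1
  refine (MvPolynomial.totalDegree_mul _ _).trans ?_
  rw [Fin.prod_univ_two]
  have h2 := MvPolynomial.totalDegree_mul (linPoly a b u ^ m 0) (linPoly c d v ^ m 1)
  have h3 := MvPolynomial.totalDegree_pow (linPoly a b u) (m 0)
  have h4 := MvPolynomial.totalDegree_pow (linPoly c d v) (m 1)
  have h5 := Nat.mul_le_mul_left (m 0) (totalDegree_linPoly_le a b u)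
  have h6 := Nat.mul_le_mul_left (m 1) (totalDegree_linPoly_le c d v)
  have h7 : (algebraMap ℝ (MvPolynomial (Fin 2) ℝ) (MvPolynomial.coeff m f)).totalDegree = 0 :=
    MvPolynomial.totalDegree_C _
  simp only [Matrix.cons_val_zero, Matrix.cons_val_one]
  omega

/-- A bound for the number of common zeros of an irreducible polynomial of degree at most `d` and
another polynomial of degree at most `d + 2`. -/
def zeroBound (d : ℕ) : ℕ := (2 * d + 3) ^ 4

theorem encard_le_zeroBound {f g : MvPolynomial (Fin 2) ℝ} {d : ℕ} (hf : Irreducible f)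
    (hd : f.totalDegree ≤ d) (he : g.totalDegree ≤ d + 2) (hfg : ¬ f ∣ g) :
    {s | evalAt f s = 0 ∧ evalAt g s = 0}.encard ≤ zeroBound d := by
  have := encard_common_zeros_le hf hd he hfg
  rwa [show d + (d + 2) + 1 = 2 * d + 3 by ring] at this

/-- The properties of an irreducible algebraic curve that is neither a line nor a circle that are
used for counting distances. -/
structure RigidCurve (Z : Set (ℝ × ℝ)) (κ : ℕ) : Prop where
  isClosed : IsClosed Z
  line : ∀ a b c : ℝ, (a ≠ 0 ∨ b ≠ 0) → {z ∈ Z | a * z.1 + b * z.2 + c = 0}.encard ≤ κ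
  circle : ∀ (q : ℝ × ℝ) (ρ : ℝ), {z ∈ Z | dsq z q = ρ}.encard ≤ κ
  admissible : ∃ p₀, ∀ p, p ≠ p₀ → AdmissibleCentre Z κ p
  quadratic : ∀ a b c d e k : ℝ, (κ : ℕ∞) < {z ∈ Z | a * z.1 ^ 2 + b * z.1 * z.2 + c * z.2 ^ 2 +
    d * z.1 + e * z.2 + k = 0}.encard → ∀ z ∈ Z,
      a * z.1 ^ 2 + b * z.1 * z.2 + c * z.2 ^ 2 + d * z.1 + e * z.2 + k = 0
  affine : ∀ a b u c d v : ℝ, a * d - b * c ≠ 0 →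
    (κ : ℕ∞) < {z ∈ Z | (a * z.1 + b * z.2 + u, c * z.1 + d * z.2 + v) ∈ Z}.encard →
      ∀ z : ℝ × ℝ, (a * z.1 + b * z.2 + u, c * z.1 + d * z.2 + v) ∈ Z ↔ z ∈ Z

theorem evalAt_eq_zero_of_dvd {f g : MvPolynomial (Fin 2) ℝ} (h : f ∣ g) {s : ℝ × ℝ}
    (hs : evalAt f s = 0) : evalAt g s = 0 := by
  obtain ⟨k, rfl⟩ := h
  rw [evalAt_mul, hs, zero_mul]

theorem eq_zero_of_evalAt_eq_zero {f : MvPolynomial (Fin 2) ℝ} (h : ∀ s, evalAt f s = 0) :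
    f = 0 := by
  refine MvPolynomial.funext fun x => ?_
  rw [map_zero, ← h (x 0, x 1), evalAt]
  congr 2
  ext i
  fin_cases i <;> rfl

theorem totalDegree_pos_of_irreducible {f : MvPolynomial (Fin 2) ℝ} (hf : Irreducible f) :
    0 < f.totalDegree := by
  by_contra! h
  rw [nonpos_iff_eq_zero, MvPolynomial.totalDegree_eq_zero_iff_eq_C] at h
  have h0 : f.coeff 0 ≠ 0 := by
    intro h0
    rw [h0, map_zero] at h
    exact hf.ne_zero h
  refine hf.not_isUnit ?_
  rw [h]
  exact (isUnit_iff_ne_zero.2 h0).map MvPolynomial.C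

/-- The polynomial whose zeros on the curve `f = 0` are the critical points of the distance
to `p`. -/
noncomputable def critPoly (f : MvPolynomial (Fin 2) ℝ) (p : ℝ × ℝ) : MvPolynomial (Fin 2) ℝ :=
  linPoly 1 0 (-p.1) * MvPolynomial.pderiv 1 f - linPoly 0 1 (-p.2) * MvPolynomial.pderiv 0 f

theorem totalDegree_critPoly_le (f : MvPolynomial (Fin 2) ℝ) (p : ℝ × ℝ) :
    (critPoly f p).totalDegree ≤ f.totalDegree + 1 := by
  have h : ∀ (a b c : ℝ) (i : Fin 2),
      (linPoly a b c * MvPolynomial.pderiv i f).totalDegree ≤ f.totalDegree + 1 := by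
    intro a b c i
    refine (MvPolynomial.totalDegree_mul _ _).trans ?_
    have h1 := totalDegree_linPoly_le a b c
    by_cases h2 : MvPolynomial.pderiv i f = 0
    · rw [h2, MvPolynomial.totalDegree_zero]
      omega
    · have := totalDegree_pderiv_lt h2
      omega
  exact (MvPolynomial.totalDegree_sub _ _).trans (max_le (h _ _ _ _) (h _ _ _ _))

theorem admissibleCentre_of_not_dvd {f : MvPolynomial (Fin 2) ℝ} {d : ℕ} (hf : Irreducible f)
    (hd : f.totalDegree ≤ d) {p : ℝ × ℝ} (hp : ¬ f ∣ critPoly f p)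
    (hcirc : ∀ d e k, ¬ f ∣ quadPoly 1 0 1 d e k) :
    AdmissibleCentre {z | evalAt f z = 0} (zeroBound d) p := by
  refine ⟨⟨_, encard_le_zeroBound hf hd ((totalDegree_critPoly_le f p).trans (by omega)) hp, ?_⟩,
    ?_⟩
  · intro z hz hz'
    refine locallyOntoAt_of_hasFDerivAt (continuous_evalAt f) (hasFDerivAt_evalAt f z) hz ?_
    intro h
    refine hz' ⟨hz, ?_⟩
    simp only [add_apply, smul_apply,
      ContinuousLinearMap.coe_fst', ContinuousLinearMap.coe_snd', smul_eq_mul] at h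
    rw [critPoly, evalAt_sub, evalAt_mul, evalAt_mul, evalAt_linPoly, evalAt_linPoly]
    linear_combination h
  · intro ρ
    have := encard_le_zeroBound hf hd ((totalDegree_quadPoly_le _ _ _ _ _ _).trans (by omega))
      (hcirc (-2 * p.1) (-2 * p.2) (p.1 ^ 2 + p.2 ^ 2 - ρ))
    refine (Set.encard_le_encard ?_).trans this
    rintro z ⟨hz, hz'⟩
    refine ⟨hz, ?_⟩
    rw [dsq] at hz'
    rw [evalAt_quadPoly]
    linear_combination hz'

theorem exists_forall_not_dvd_critPoly {f : MvPolynomial (Fin 2) ℝ} (hf : Irreducible f)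
    (hline : ∀ a b c, a ≠ 0 ∨ b ≠ 0 → ¬ f ∣ linPoly a b c) {z₀ : ℝ × ℝ} (hz₀ : evalAt f z₀ = 0) :
    ∃ p₀, ∀ p, p ≠ p₀ → ¬ f ∣ critPoly f p := by
  by_contra! H
  obtain ⟨p, -, hp⟩ := H 0
  obtain ⟨q, hqp, hq⟩ := H p
  have hdvd := dvd_sub hq hp
  set h := critPoly f q - critPoly f p with hh
  have heq : h = linPoly 0 0 (p.1 - q.1) * MvPolynomial.pderiv 1 f -
      linPoly 0 0 (p.2 - q.2) * MvPolynomial.pderiv 0 f := by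
    simp only [hh, critPoly, linPoly, map_sub, map_neg, map_zero]
    ring
  have hzero : h = 0 := by
    by_contra hne
    have h1 := MvPolynomial.totalDegree_le_of_dvd_of_isDomain hdvd hne
    have hpos := totalDegree_pos_of_irreducible hf
    have h2 : ∀ (c : ℝ) (i : Fin 2),
        (linPoly 0 0 c * MvPolynomial.pderiv i f).totalDegree ≤ f.totalDegree - 1 := by
      intro c i
      refine (MvPolynomial.totalDegree_mul _ _).trans ?_
      have h3 : (linPoly 0 0 c).totalDegree = 0 := by simp [linPoly]
      by_cases h4 : MvPolynomial.pderiv i f = 0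
      · rw [h4, MvPolynomial.totalDegree_zero]
        omega
      · have := totalDegree_pderiv_lt h4
        omega
    have h5 : h.totalDegree ≤ f.totalDegree - 1 := by
      rw [heq]
      exact (MvPolynomial.totalDegree_sub _ _).trans (max_le (h2 _ _) (h2 _ _))
    omega
  set v : ℝ × ℝ := (-(p.2 - q.2), p.1 - q.1) with hv
  have hconst : ∀ t : ℝ, evalAt f (z₀ + t • v) = 0 := by
    have hder : ∀ t : ℝ, HasDerivAt (fun t : ℝ => evalAt f (z₀ + t • v)) 0 t := by
      intro t
      have h1 : HasDerivAt (fun t : ℝ => z₀ + t • v) v t := by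
        simpa using ((hasDerivAt_id t).smul_const v).const_add z₀
      have h2 := (hasFDerivAt_evalAt f (z₀ + t • v)).comp_hasDerivAt t h1
      convert! h2 using 1
      have h3 : evalAt h (z₀ + t • v) = 0 := by rw [hzero]; simp [evalAt]
      rw [heq, evalAt_sub, evalAt_mul, evalAt_mul, evalAt_linPoly, evalAt_linPoly] at h3
      simp only [add_apply, smul_apply,
        ContinuousLinearMap.coe_fst', ContinuousLinearMap.coe_snd', smul_eq_mul, hv] at h3 ⊢
      linear_combination -h3
    intro t
    have := is_const_of_deriv_eq_zero (fun t => (hder t).differentiableAt)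
      (fun t => (hder t).deriv) t 0
    simpa [hz₀] using this
  have hvne : p.1 - q.1 ≠ 0 ∨ p.2 - q.2 ≠ 0 := by
    by_contra! hc
    exact hqp (Prod.ext (by linarith) (by linarith))
  have hfin := encard_common_zeros_le hf le_rfl (totalDegree_linPoly_le _ _ _)
    (hline (p.1 - q.1) (p.2 - q.2) (-((p.1 - q.1) * z₀.1 + (p.2 - q.2) * z₀.2)) hvne)
  have hinf : {s | evalAt f s = 0 ∧ evalAt (linPoly (p.1 - q.1) (p.2 - q.2)
      (-((p.1 - q.1) * z₀.1 + (p.2 - q.2) * z₀.2))) s = 0}.Infinite := by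
    refine Set.infinite_of_injective_forall_mem (f := fun t : ℝ => z₀ + t • v) ?_ ?_
    · intro t t' htt
      have := (add_right_inj _).1 htt
      refine smul_left_injective ℝ (?_ : v ≠ 0) this
      intro hv0
      rw [hv, Prod.mk_eq_zero] at hv0
      rcases hvne with h | h
      · exact h hv0.2
      · exact h (neg_eq_zero.1 hv0.1)
    · intro t
      refine ⟨hconst t, ?_⟩
      rw [evalAt_linPoly]
      simp only [hv, Prod.fst_add, Prod.snd_add, Prod.smul_fst, Prod.smul_snd, smul_eq_mul]
      ring
  rw [Set.encard_eq_top_iff.2 hinf] at hfin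
  exact absurd hfin (by simp)

theorem rigidCurve_of_not_dvd {f : MvPolynomial (Fin 2) ℝ} {d : ℕ} (hf : Irreducible f)
    (hd : f.totalDegree ≤ d) (hline : ∀ a b c, a ≠ 0 ∨ b ≠ 0 → ¬ f ∣ linPoly a b c)
    (hcirc : ∀ d e k, ¬ f ∣ quadPoly 1 0 1 d e k) {z₀ : ℝ × ℝ} (hz₀ : evalAt f z₀ = 0) :
    RigidCurve {z | evalAt f z = 0} (zeroBound d) where
  isClosed := isClosed_eq (continuous_evalAt f) continuous_const
  line a b c h := by
    refine (Set.encard_le_encard ?_).trans (encard_le_zeroBound hf hd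
      ((totalDegree_linPoly_le _ _ _).trans (by omega)) (hline a b c h))
    rintro z ⟨hz, hz'⟩
    exact ⟨hz, by rwa [evalAt_linPoly]⟩
  circle q ρ := by
    refine (Set.encard_le_encard ?_).trans (encard_le_zeroBound hf hd
      ((totalDegree_quadPoly_le _ _ _ _ _ _).trans (by omega))
      (hcirc (-2 * q.1) (-2 * q.2) (q.1 ^ 2 + q.2 ^ 2 - ρ)))
    rintro z ⟨hz, hz'⟩
    refine ⟨hz, ?_⟩
    rw [dsq] at hz'
    rw [evalAt_quadPoly]
    linear_combination hz'
  admissible := by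
    obtain ⟨p₀, hp₀⟩ := exists_forall_not_dvd_critPoly hf hline hz₀
    exact ⟨p₀, fun p hp => admissibleCentre_of_not_dvd hf hd (hp₀ p hp) hcirc⟩
  quadratic a b c d' e k h z hz := by
    by_cases hdvd : f ∣ quadPoly a b c d' e k
    · have := evalAt_eq_zero_of_dvd hdvd hz
      rwa [evalAt_quadPoly] at this
    · refine absurd h (not_lt.2 ((Set.encard_le_encard ?_).trans (encard_le_zeroBound hf hd
        ((totalDegree_quadPoly_le _ _ _ _ _ _).trans (by omega)) hdvd)))
      rintro z ⟨hz, hz'⟩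
      exact ⟨hz, by rwa [evalAt_quadPoly]⟩
  affine a b u c d' v hdet h z := by
    by_cases hdvd : f ∣ affineSubst a b u c d' v f
    · obtain ⟨k, hk⟩ := hdvd
      have hk0 : k ≠ 0 := by
        rintro rfl
        refine hf.ne_zero (eq_zero_of_evalAt_eq_zero fun s => ?_)
        have := evalAt_affineSubst a b u c d' v f
          ((d' * (s.1 - u) - b * (s.2 - v)) / (a * d' - b * c),
            (a * (s.2 - v) - c * (s.1 - u)) / (a * d' - b * c))
        rw [hk, mul_zero] at this
        have h0 : ∀ s, evalAt (0 : MvPolynomial (Fin 2) ℝ) s = 0 := fun s => by simp [evalAt]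
        rw [h0] at this
        rw [this]
        congr 1
        have e := mul_inv_cancel₀ hdet
        refine Prod.ext ?_ ?_ <;> simp only [div_eq_mul_inv]
        · linear_combination (u - s.1) * e
        · linear_combination (v - s.2) * e
      have hdeg := totalDegree_affineSubst_le a b u c d' v f
      rw [hk, MvPolynomial.totalDegree_mul_of_isDomain hf.ne_zero hk0] at hdeg
      have hkC := MvPolynomial.totalDegree_eq_zero_iff_eq_C.1 (by omega : k.totalDegree = 0)
      have hc0 : k.coeff 0 ≠ 0 := by
        intro h0
        rw [h0, map_zero] at hkC
        exact hk0 hkC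
      have := evalAt_affineSubst a b u c d' v f z
      rw [hk, hkC, evalAt_mul, evalAt_C] at this
      simp only [Set.mem_ofPred_eq]
      rw [← this, mul_eq_zero, or_iff_left hc0]
    · refine absurd h (not_lt.2 ((Set.encard_le_encard ?_).trans (encard_le_zeroBound hf hd
        ((totalDegree_affineSubst_le _ _ _ _ _ _ _).trans (by omega)) hdvd)))
      rintro z ⟨hz, hz'⟩
      refine ⟨hz, ?_⟩
      rw [evalAt_affineSubst]
      exact hz'

/-- Twice the signed area of a triangle. -/
def triDet (x y z : ℝ × ℝ) : ℝ := (y.1 - x.1) * (z.2 - x.2) - (y.2 - x.2) * (z.1 - x.1)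

theorem coeff_eq_zero_of_triDet_ne_zero {x y z : ℝ × ℝ} (h : triDet x y z ≠ 0) {a b c : ℝ}
    (hx : a * x.1 + b * x.2 + c = 0) (hy : a * y.1 + b * y.2 + c = 0)
    (hz : a * z.1 + b * z.2 + c = 0) : a = 0 ∧ b = 0 ∧ c = 0 := by
  have ha : a = 0 := by
    refine (mul_eq_zero.1 (?_ : triDet x y z * a = 0)).resolve_left h
    unfold triDet
    linear_combination (hy - hx) * (z.2 - x.2) - (hz - hx) * (y.2 - x.2)
  have hb : b = 0 := by
    refine (mul_eq_zero.1 (?_ : triDet x y z * b = 0)).resolve_left h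
    unfold triDet
    linear_combination (hz - hx) * (y.1 - x.1) - (hy - hx) * (z.1 - x.1)
  refine ⟨ha, hb, ?_⟩
  rw [ha, hb] at hx
  linarith

theorem exists_affine_of_triDet_ne_zero {x y z : ℝ × ℝ} (h : triDet x y z ≠ 0) (l m n : ℝ) :
    ∃ a b c : ℝ, l = a * x.1 + b * x.2 + c ∧ m = a * y.1 + b * y.2 + c ∧
      n = a * z.1 + b * z.2 + c := by
  set a := ((m - l) * (z.2 - x.2) - (n - l) * (y.2 - x.2)) / triDet x y z with ha
  set b := ((n - l) * (y.1 - x.1) - (m - l) * (z.1 - x.1)) / triDet x y z with hb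
  have e := mul_inv_cancel₀ h
  rw [div_eq_mul_inv] at ha hb
  refine ⟨a, b, l - a * x.1 - b * x.2, by ring, ?_, ?_⟩
  · rw [ha, hb]
    nth_rw 1 [triDet] at e
    linear_combination (l - m) * e
  · rw [ha, hb]
    nth_rw 1 [triDet] at e
    linear_combination (l - n) * e

theorem exists_line_of_triDet_eq_zero {ι : Type*} (X : Finset ι) (s : ι → ℝ × ℝ)
    (h : ∀ x ∈ X, ∀ y ∈ X, ∀ z ∈ X, triDet (s x) (s y) (s z) = 0) :
    ∃ a b c : ℝ, (a ≠ 0 ∨ b ≠ 0) ∧ ∀ x ∈ X, a * (s x).1 + b * (s x).2 + c = 0 := by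
  by_cases hX : ∃ x ∈ X, ∃ y ∈ X, s x ≠ s y
  · obtain ⟨x, hx, y, hy, hxy⟩ := hX
    refine ⟨-((s y).2 - (s x).2), (s y).1 - (s x).1,
      ((s y).2 - (s x).2) * (s x).1 - ((s y).1 - (s x).1) * (s x).2, ?_, fun z hz => ?_⟩
    · by_contra! hc
      exact hxy (Prod.ext (by linarith) (by linarith))
    · have := h x hx y hy z hz
      unfold triDet at this
      linear_combination this
  · push Not at hX
    rcases X.eq_empty_or_nonempty with rfl | ⟨x, hx⟩
    · exact ⟨1, 0, 0, by simp, by simp⟩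
    · exact ⟨1, 0, -(s x).1, by simp, fun z hz => by rw [hX z hz x hx]; ring⟩

/-- Four pairs of points for which the vectors `(s₁, s₂, t₁, t₂, 1)` are independent, the first
three of them having affinely independent first components. -/
def IndependentPairs (τ : Fin 4 → (ℝ × ℝ) × (ℝ × ℝ)) : Prop :=
  triDet (τ 0).1 (τ 1).1 (τ 2).1 ≠ 0 ∧ ∃ a b u c d v : ℝ,
    (∀ i : Fin 4, i ≠ 3 → (τ i).2 = (a * (τ i).1.1 + b * (τ i).1.2 + u,
      c * (τ i).1.1 + d * (τ i).1.2 + v)) ∧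
    (τ 3).2 ≠ (a * (τ 3).1.1 + b * (τ 3).1.2 + u, c * (τ 3).1.1 + d * (τ 3).1.2 + v)

theorem exists_independentPairs_or (X : Finset ((ℝ × ℝ) × (ℝ × ℝ))) :
    (∃ τ, IndependentPairs τ ∧ ∀ i, τ i ∈ X) ∨
    (∃ a b c : ℝ, (a ≠ 0 ∨ b ≠ 0) ∧ ∀ z ∈ X, a * z.1.1 + b * z.1.2 + c = 0) ∨
    ∃ a b u c d v : ℝ, ∀ z ∈ X,
      z.2 = (a * z.1.1 + b * z.1.2 + u, c * z.1.1 + d * z.1.2 + v) := by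
  by_cases h : ∀ x ∈ X, ∀ y ∈ X, ∀ z ∈ X, triDet x.1 y.1 z.1 = 0
  · exact Or.inr (Or.inl (exists_line_of_triDet_eq_zero X Prod.fst h))
  push Not at h
  obtain ⟨x, hx, y, hy, z, hz, hne⟩ := h
  obtain ⟨a, b, u, h1, h2, h3⟩ := exists_affine_of_triDet_ne_zero hne x.2.1 y.2.1 z.2.1
  obtain ⟨c, d, v, h4, h5, h6⟩ := exists_affine_of_triDet_ne_zero hne x.2.2 y.2.2 z.2.2
  by_cases hT : ∀ w ∈ X, w.2 = (a * w.1.1 + b * w.1.2 + u, c * w.1.1 + d * w.1.2 + v)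
  · exact Or.inr (Or.inr ⟨a, b, u, c, d, v, hT⟩)
  push Not at hT
  obtain ⟨w, hw, hw'⟩ := hT
  refine Or.inl ⟨![x, y, z, w], ⟨hne, a, b, u, c, d, v, ?_, hw'⟩, ?_⟩
  · intro i hi
    fin_cases i
    · exact Prod.ext h1 h4
    · exact Prod.ext h2 h5
    · exact Prod.ext h3 h6
    · exact absurd rfl hi
  · intro i
    fin_cases i <;> assumption

theorem IndependentPairs.exists_annihilator {τ : Fin 4 → (ℝ × ℝ) × (ℝ × ℝ)}
    (h : IndependentPairs τ) :
    ∃ n₁ n₂ n₃ n₄ n₅ : ℝ, (n₃ ≠ 0 ∨ n₄ ≠ 0) ∧ ∀ m₁ m₂ m₃ m₄ m₅ : ℝ,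
      (∀ i, m₁ * (τ i).1.1 + m₂ * (τ i).1.2 + m₃ * (τ i).2.1 + m₄ * (τ i).2.2 + m₅ = 0) →
        ∃ l : ℝ, m₁ = l * n₁ ∧ m₂ = l * n₂ ∧ m₃ = l * n₃ ∧ m₄ = l * n₄ ∧ m₅ = l * n₅ := by
  obtain ⟨hdet, a, b, u, c, d, v, hT, hne⟩ := h
  set δ₁ := (τ 3).2.1 - (a * (τ 3).1.1 + b * (τ 3).1.2 + u) with hδ₁
  set δ₂ := (τ 3).2.2 - (c * (τ 3).1.1 + d * (τ 3).1.2 + v) with hδ₂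
  have hδ : δ₁ ≠ 0 ∨ δ₂ ≠ 0 := by
    by_contra! hc
    exact hne (Prod.ext (by linarith) (by linarith))
  refine ⟨a * δ₂ - c * δ₁, b * δ₂ - d * δ₁, -δ₂, δ₁, δ₂ * u - δ₁ * v, ?_, ?_⟩
  · rw [neg_ne_zero]
    exact hδ.symm
  · intro m₁ m₂ m₃ m₄ m₅ H
    have hi : ∀ i : Fin 4, i ≠ 3 → (m₁ + m₃ * a + m₄ * c) * (τ i).1.1 +
        (m₂ + m₃ * b + m₄ * d) * (τ i).1.2 + (m₅ + m₃ * u + m₄ * v) = 0 := by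
      intro i hi
      have := H i
      rw [hT i hi] at this
      linear_combination this
    obtain ⟨h1, h2, h3⟩ := coeff_eq_zero_of_triDet_ne_zero hdet (hi 0 (by decide))
      (hi 1 (by decide)) (hi 2 (by decide))
    have h4 : m₃ * δ₁ + m₄ * δ₂ = 0 := by
      have := H 3
      rw [hδ₁, hδ₂]
      linear_combination this - (τ 3).1.1 * h1 - (τ 3).1.2 * h2 - h3
    obtain ⟨l, h5, h6⟩ : ∃ l, m₃ = l * -δ₂ ∧ m₄ = l * δ₁ := by
      rcases hδ with hδ | hδ
      · refine ⟨m₄ / δ₁, ?_, by field_simp⟩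
        field_simp
        linear_combination h4
      · refine ⟨-m₃ / δ₂, by field_simp, ?_⟩
        field_simp
        linear_combination h4
    refine ⟨l, ?_, ?_, h5, h6, ?_⟩
    · linear_combination h1 - a * h5 - c * h6
    · linear_combination h2 - b * h5 - d * h6
    · linear_combination h3 - u * h5 - v * h6

/-- The orientation preserving similarity with linear part `c + d i`. -/
def posMap (c d u v : ℝ) (z : ℝ × ℝ) : ℝ × ℝ := (c * z.1 - d * z.2 + u, d * z.1 + c * z.2 + v)

/-- The orientation reversing similarity with linear part `z ↦ (c + d i) z̄`. -/
def negMap (c d u v : ℝ) (z : ℝ × ℝ) : ℝ × ℝ := (c * z.1 + d * z.2 + u, d * z.1 - c * z.2 + v)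

/-- The images of `p` under the orientation preserving isometries that preserve `Z`. -/
def posOrbit (Z : Set (ℝ × ℝ)) (p : ℝ × ℝ) : Set (ℝ × ℝ) :=
  {q | ∃ c d u v : ℝ, c ^ 2 + d ^ 2 = 1 ∧ (∀ z, posMap c d u v z ∈ Z ↔ z ∈ Z) ∧
    q = posMap c d u v p}

/-- The images of `p` under the orientation reversing isometries that preserve `Z`. -/
def negOrbit (Z : Set (ℝ × ℝ)) (p : ℝ × ℝ) : Set (ℝ × ℝ) :=
  {q | ∃ c d u v : ℝ, c ^ 2 + d ^ 2 = 1 ∧ (∀ z, negMap c d u v z ∈ Z ↔ z ∈ Z) ∧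
    q = negMap c d u v p}

namespace RigidCurve

variable {Z : Set (ℝ × ℝ)} {κ : ℕ}

theorem eq_zero_of_translation (h : RigidCurve Z κ) {p : ℝ × ℝ} (hp : p ∈ Z) {u v : ℝ}
    (ht : ∀ z : ℝ × ℝ, (z.1 + u, z.2 + v) ∈ Z ↔ z ∈ Z) : u = 0 ∧ v = 0 := by
  by_contra hc
  have huv : u ≠ 0 ∨ v ≠ 0 := by
    by_contra! h0
    exact hc h0
  have hmem : ∀ n : ℕ, (p.1 + n * u, p.2 + n * v) ∈ Z := by
    intro n
    induction n with
    | zero => simpa using hp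
    | succ n ih =>
      have := (ht _).2 ih
      convert this using 2 <;> push_cast <;> ring
  have hfin := h.line v (-u) (-(v * p.1 - u * p.2)) (by rw [neg_ne_zero]; exact huv.symm)
  have hinf : {z ∈ Z | v * z.1 + -u * z.2 + -(v * p.1 - u * p.2) = 0}.Infinite := by
    refine Set.infinite_of_injective_forall_mem
      (f := fun n : ℕ => ((p.1 + n * u, p.2 + n * v) : ℝ × ℝ)) ?_ ?_
    · intro m n hmn
      simp only [Prod.mk.injEq, add_right_inj] at hmn
      rcases huv with h0 | h0
      · exact_mod_cast mul_right_cancel₀ h0 hmn.1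
      · exact_mod_cast mul_right_cancel₀ h0 hmn.2
    · intro n
      exact ⟨hmem n, by simp only; ring⟩
  rw [Set.encard_eq_top_iff.2 hinf] at hfin
  exact absurd hfin (by simp)

theorem encard_posOrbit_le (h : RigidCurve Z κ) {p : ℝ × ℝ} (hp : p ∈ Z) :
    (posOrbit Z p).encard ≤ κ := by
  by_cases hrot : ∃ c d u v : ℝ, c ^ 2 + d ^ 2 = 1 ∧ (∀ z, posMap c d u v z ∈ Z ↔ z ∈ Z) ∧ c ≠ 1
  · obtain ⟨c, d, u, v, hcd, hT, hc⟩ := hrot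
    have hD : (1 - c) ^ 2 + d ^ 2 ≠ 0 := by
      have : 0 < (1 - c) ^ 2 := by
        have : 1 - c ≠ 0 := sub_ne_zero.2 hc.symm
        positivity
      positivity
    set o : ℝ × ℝ := (((1 - c) * u - d * v) / ((1 - c) ^ 2 + d ^ 2),
      ((1 - c) * v + d * u) / ((1 - c) ^ 2 + d ^ 2)) with ho
    have ho1 : ((1 - c) ^ 2 + d ^ 2) * o.1 = (1 - c) * u - d * v := by
      rw [ho]
      field_simp
    have ho2 : ((1 - c) ^ 2 + d ^ 2) * o.2 = (1 - c) * v + d * u := by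
      rw [ho]
      field_simp
    refine (Set.encard_le_encard ?_).trans (h.circle o (dsq p o))
    rintro q ⟨c', d', u', v', hcd', hT', rfl⟩
    refine ⟨(hT' p).2 hp, ?_⟩
    obtain ⟨hu, hv⟩ := h.eq_zero_of_translation hp
      (u := c * u' - d * v' + u - (c' * u - d' * v + u'))
      (v := d * u' + c * v' + v - (d' * u + c' * v + v')) (by
        intro y
        obtain ⟨z, rfl⟩ : ∃ z, posMap c' d' u' v' (posMap c d u v z) = y := by
          have surj : ∀ c d u v : ℝ, c ^ 2 + d ^ 2 = 1 → ∀ y, ∃ z, posMap c d u v z = y := by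
            intro c d u v hcd y
            refine ⟨(c * (y.1 - u) + d * (y.2 - v), c * (y.2 - v) - d * (y.1 - u)), ?_⟩
            refine Prod.ext ?_ ?_ <;> simp only [posMap]
            · linear_combination (y.1 - u) * hcd
            · linear_combination (y.2 - v) * hcd
          obtain ⟨z', hz'⟩ := surj c' d' u' v' hcd' y
          obtain ⟨z, hz⟩ := surj c d u v hcd z'
          exact ⟨z, by rw [hz, hz']⟩
        rw [hT', hT, ← hT' z, ← hT (posMap c' d' u' v' z)]
        refine iff_of_eq (congrArg (· ∈ Z) ?_)
        refine Prod.ext ?_ ?_ <;> simp only [posMap] <;> ring)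
    have e1 : (1 - c) * o.1 + d * o.2 = u := by
      refine mul_left_cancel₀ hD ?_
      linear_combination (1 - c) * ho1 + d * ho2
    have e2 : -d * o.1 + (1 - c) * o.2 = v := by
      refine mul_left_cancel₀ hD ?_
      linear_combination -d * ho1 + (1 - c) * ho2
    have hfix1 : c' * o.1 - d' * o.2 + u' = o.1 := by
      refine mul_left_cancel₀ hD ?_
      linear_combination (1 - c) * (c' * e1 - d' * e2 - hu - e1) -
        d * (d' * e1 + c' * e2 - hv - e2)
    have hfix2 : d' * o.1 + c' * o.2 + v' = o.2 := by
      refine mul_left_cancel₀ hD ?_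
      linear_combination d * (c' * e1 - d' * e2 - hu - e1) +
        (1 - c) * (d' * e1 + c' * e2 - hv - e2)
    have k1 : c' * p.1 - d' * p.2 + u' - o.1 = c' * (p.1 - o.1) - d' * (p.2 - o.2) := by
      linear_combination hfix1
    have k2 : d' * p.1 + c' * p.2 + v' - o.2 = d' * (p.1 - o.1) + c' * (p.2 - o.2) := by
      linear_combination hfix2
    simp only [dsq, posMap]
    rw [k1, k2]
    linear_combination ((p.1 - o.1) ^ 2 + (p.2 - o.2) ^ 2) * hcd'
  · push Not at hrot
    refine (Set.encard_le_encard ?_).trans (h.circle p (dsq p p))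
    rintro q ⟨c, d, u, v, hcd, hT, rfl⟩
    refine ⟨(hT p).2 hp, ?_⟩
    obtain rfl := hrot c d u v hcd hT
    have hd : d = 0 := by nlinarith
    subst hd
    obtain ⟨rfl, rfl⟩ := h.eq_zero_of_translation hp (u := u) (v := v) (by
      intro z
      rw [← hT z]
      simp [posMap])
    simp [posMap]

theorem encard_negOrbit_le (h : RigidCurve Z κ) {p : ℝ × ℝ} (hp : p ∈ Z) :
    (negOrbit Z p).encard ≤ κ := by
  rcases (negOrbit Z p).eq_empty_or_nonempty with h0 | ⟨-, c, d, u, v, hcd, hT, -⟩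
  · rw [h0]
    simp
  · have hinj : Function.Injective (negMap c d u v) := by
      intro x y hxy
      simp only [negMap, Prod.mk.injEq, add_left_inj] at hxy
      refine Prod.ext ?_ ?_
      · linear_combination c * hxy.1 + d * hxy.2 - (x.1 - y.1) * hcd
      · linear_combination d * hxy.1 - c * hxy.2 - (x.2 - y.2) * hcd
    rw [← hinj.encard_image]
    refine (Set.encard_le_encard ?_).trans (h.encard_posOrbit_le hp)
    rintro _ ⟨-, ⟨c', d', u', v', hcd', hT', rfl⟩, rfl⟩
    have hcomp : ∀ z, negMap c d u v (negMap c' d' u' v' z) = posMap (c * c' + d * d')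
        (d * c' - c * d') (c * u' + d * v' + u) (d * u' - c * v' + v) z := by
      intro z
      refine Prod.ext ?_ ?_ <;> simp only [negMap, posMap] <;> ring
    refine ⟨_, _, _, _, ?_, fun z => ?_, hcomp p⟩
    · linear_combination (c' ^ 2 + d' ^ 2) * hcd + hcd'
    · rw [← hcomp, hT, hT']

end RigidCurve

theorem IndependentPairs.exists_direction {τ : Fin 4 → (ℝ × ℝ) × (ℝ × ℝ)}
    (h : IndependentPairs τ) :
    ∃ n₁ n₂ n₃ n₄ : ℝ, (n₃ ≠ 0 ∨ n₄ ≠ 0) ∧ ∀ p q p' q' : ℝ × ℝ,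
      (∀ i, dsq (τ i).1 p = dsq (τ i).2 q) → (∀ i, dsq (τ i).1 p' = dsq (τ i).2 q') →
        ∃ l : ℝ, p.1 - p'.1 = l * n₁ ∧ p.2 - p'.2 = l * n₂ ∧ q.1 - q'.1 = l * n₃ ∧
          q.2 - q'.2 = l * n₄ := by
  obtain ⟨n₁, n₂, n₃, n₄, n₅, hn, H⟩ := h.exists_annihilator
  refine ⟨-n₁, -n₂, n₃, n₄, hn, fun p q p' q' h1 h2 => ?_⟩
  obtain ⟨l, e1, e2, e3, e4, -⟩ := H (-2 * (p.1 - p'.1)) (-2 * (p.2 - p'.2)) (2 * (q.1 - q'.1))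
    (2 * (q.2 - q'.2)) (p.1 ^ 2 + p.2 ^ 2 - q.1 ^ 2 - q.2 ^ 2 -
      (p'.1 ^ 2 + p'.2 ^ 2 - q'.1 ^ 2 - q'.2 ^ 2)) (fun i => by
        have h1 := h1 i
        have h2 := h2 i
        simp only [dsq] at h1 h2
        linear_combination h1 - h2)
  exact ⟨l / 2, by linear_combination -e1 / 2, by linear_combination -e2 / 2,
    by linear_combination e3 / 2, by linear_combination e4 / 2⟩

theorem eq_zero_of_binary_quadratic_form {α β γ x₁ y₁ x₂ y₂ x₃ y₃ : ℝ}
    (h₁ : α * x₁ ^ 2 + β * x₁ * y₁ + γ * y₁ ^ 2 = 0)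
    (h₂ : α * x₂ ^ 2 + β * x₂ * y₂ + γ * y₂ ^ 2 = 0)
    (h₃ : α * x₃ ^ 2 + β * x₃ * y₃ + γ * y₃ ^ 2 = 0) (h₁₂ : x₁ * y₂ - y₁ * x₂ ≠ 0)
    (h₁₃ : x₁ * y₃ - y₁ * x₃ ≠ 0) (h₂₃ : x₂ * y₃ - y₂ * x₃ ≠ 0) : α = 0 ∧ β = 0 ∧ γ = 0 := by
  have hD := mul_ne_zero (mul_ne_zero h₁₂ h₁₃) h₂₃
  refine ⟨?_, ?_, ?_⟩ <;> refine (mul_eq_zero.1 ?_).resolve_left hD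
  · linear_combination h₁ * (x₂ * y₂ * y₃ ^ 2 - x₃ * y₃ * y₂ ^ 2) -
      h₂ * (x₁ * y₁ * y₃ ^ 2 - x₃ * y₃ * y₁ ^ 2) + h₃ * (x₁ * y₁ * y₂ ^ 2 - x₂ * y₂ * y₁ ^ 2)
  · linear_combination -h₁ * (x₂ ^ 2 * y₃ ^ 2 - x₃ ^ 2 * y₂ ^ 2) +
      h₂ * (x₁ ^ 2 * y₃ ^ 2 - x₃ ^ 2 * y₁ ^ 2) - h₃ * (x₁ ^ 2 * y₂ ^ 2 - x₂ ^ 2 * y₁ ^ 2)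
  · linear_combination h₁ * (x₂ ^ 2 * x₃ * y₃ - x₃ ^ 2 * x₂ * y₂) -
      h₂ * (x₁ ^ 2 * x₃ * y₃ - x₃ ^ 2 * x₁ * y₁) + h₃ * (x₁ ^ 2 * x₂ * y₂ - x₂ ^ 2 * x₁ * y₁)

/-- Isodistant pairs whose first components lie on a small subset of `Z` are few. -/
theorem card_le_mul_of_isodistant {Z W : Set (ℝ × ℝ)} {κ l : ℕ} {p q : ℝ × ℝ}
    (hq : ∀ ρ, {z ∈ Z | dsq z q = ρ}.encard ≤ κ) (hW : {z ∈ Z | z ∈ W}.encard ≤ l)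
    (X : Finset ((ℝ × ℝ) × (ℝ × ℝ))) (hX : ∀ z ∈ X, z.1 ∈ Z ∧ z.2 ∈ Z)
    (hiso : ∀ z ∈ X, dsq z.1 p = dsq z.2 q) (hXW : ∀ z ∈ X, z.1 ∈ W) : X.card ≤ l * κ := by
  classical
  calc X.card = ∑ s ∈ X.image Prod.fst, (X.filter fun z => z.1 = s).card :=
        Finset.card_eq_sum_card_image _ _
    _ ≤ ∑ s ∈ X.image Prod.fst, κ := by
        refine Finset.sum_le_sum fun s _ => ?_
        rw [← Finset.card_image_of_injOn (s := X.filter fun z => z.1 = s) (f := Prod.snd)]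
        · refine card_le_of_forall_mem (hq (dsq s p)) _ fun t ht => ?_
          simp only [Finset.mem_image, Finset.mem_filter] at ht
          obtain ⟨z, ⟨hz, rfl⟩, rfl⟩ := ht
          exact ⟨(hX z hz).2, (hiso z hz).symm⟩
        · intro x hx y hy hxy
          simp only [Finset.coe_filter, Set.mem_ofPred_eq] at hx hy
          exact Prod.ext (hx.2.trans hy.2.symm) hxy
    _ ≤ l * κ := by
        rw [Finset.sum_const, smul_eq_mul]
        refine Nat.mul_le_mul_right _ (card_le_of_forall_mem hW _ fun s hs => ?_)
        obtain ⟨z, hz, rfl⟩ := Finset.mem_image.1 hs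
        exact ⟨(hX z hz).1, hXW z hz⟩

namespace RigidCurve

variable {Z : Set (ℝ × ℝ)} {κ : ℕ}

theorem mem_orbit_of_affine (h : RigidCurve Z κ) {p q : ℝ × ℝ} (hp : p ∈ Z)
    {a b u c d v : ℝ} (F : Finset (ℝ × ℝ)) (hF : 2 * κ < F.card) (hFZ : ∀ z ∈ F, z ∈ Z)
    (hTF : ∀ z ∈ F, (a * z.1 + b * z.2 + u, c * z.1 + d * z.2 + v) ∈ Z)
    (hiso : ∀ z ∈ F, dsq z p = dsq (a * z.1 + b * z.2 + u, c * z.1 + d * z.2 + v) q) :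
    q ∈ posOrbit Z p ∪ negOrbit Z p := by
  have lt_of_forall : ∀ W : Set (ℝ × ℝ), (∀ z ∈ F, z ∈ W) → (κ : ℕ∞) < W.encard := by
    intro W hW
    by_contra! hc
    have := card_le_of_forall_mem hc F hW
    omega
  have exists_off : ∀ n₁ n₂ n₃ n₄ : ℝ, (n₁ ≠ 0 ∨ n₂ ≠ 0) → (n₃ ≠ 0 ∨ n₄ ≠ 0) →
      ∃ z ∈ F, n₁ * (z.2 - p.2) - n₂ * (z.1 - p.1) ≠ 0 ∧
        n₃ * (z.2 - p.2) - n₄ * (z.1 - p.1) ≠ 0 := by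
    classical
    intro n₁ n₂ n₃ n₄ h1 h2
    by_contra! hc
    have hl : ∀ n₁ n₂ : ℝ, (n₁ ≠ 0 ∨ n₂ ≠ 0) →
        (F.filter fun z => n₁ * (z.2 - p.2) - n₂ * (z.1 - p.1) = 0).card ≤ κ := by
      intro n₁ n₂ h1
      refine card_le_of_forall_mem (h.line (-n₂) n₁ (n₂ * p.1 - n₁ * p.2)
        (by rw [neg_ne_zero]; exact h1.symm)) _ fun z hz => ?_
      rw [Finset.mem_filter] at hz
      exact ⟨hFZ z hz.1, by linear_combination hz.2⟩
    have := (Finset.card_le_card (s := F) (t := (F.filter fun z =>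
      n₁ * (z.2 - p.2) - n₂ * (z.1 - p.1) = 0) ∪ (F.filter fun z =>
      n₃ * (z.2 - p.2) - n₄ * (z.1 - p.1) = 0)) (fun z hz => by
        rw [Finset.mem_union, Finset.mem_filter, Finset.mem_filter]
        by_cases h0 : n₁ * (z.2 - p.2) - n₂ * (z.1 - p.1) = 0
        · exact Or.inl ⟨hz, h0⟩
        · exact Or.inr ⟨hz, hc z hz h0⟩)).trans (Finset.card_union_le _ _)
    have := hl n₁ n₂ h1
    have := hl n₃ n₄ h2
    omega
  have hquad : ∀ z ∈ Z, dsq z p = dsq (a * z.1 + b * z.2 + u, c * z.1 + d * z.2 + v) q := by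
    have key := h.quadratic (1 - a ^ 2 - c ^ 2) (-2 * (a * b + c * d)) (1 - b ^ 2 - d ^ 2)
      (-2 * p.1 - 2 * a * (u - q.1) - 2 * c * (v - q.2))
      (-2 * p.2 - 2 * b * (u - q.1) - 2 * d * (v - q.2))
      (p.1 ^ 2 + p.2 ^ 2 - (u - q.1) ^ 2 - (v - q.2) ^ 2) (lt_of_forall _ fun z hz => ?_)
    · intro z hz
      have := key z hz
      simp only [dsq]
      linear_combination this
    · have := hiso z hz
      simp only [dsq] at this
      exact ⟨hFZ z hz, by linear_combination this⟩
  have hTp : a * p.1 + b * p.2 + u = q.1 ∧ c * p.1 + d * p.2 + v = q.2 := by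
    have := hquad p hp
    rw [(dsq_eq_zero_iff).2 rfl, eq_comm, dsq_eq_zero_iff] at this
    rw [← this]
    exact ⟨rfl, rfl⟩
  have hform : ∀ z ∈ Z, (1 - a ^ 2 - c ^ 2) * (z.1 - p.1) ^ 2 +
      (-2 * (a * b + c * d)) * (z.1 - p.1) * (z.2 - p.2) +
      (1 - b ^ 2 - d ^ 2) * (z.2 - p.2) ^ 2 = 0 := by
    intro z hz
    have := hquad z hz
    rw [show u = q.1 - a * p.1 - b * p.2 by linarith [hTp.1],
      show v = q.2 - c * p.1 - d * p.2 by linarith [hTp.2]] at this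
    simp only [dsq] at this
    linear_combination this
  obtain ⟨z₁, hz₁, h1, h1'⟩ := exists_off 1 0 1 0 (by simp) (by simp)
  have n1 : z₁.1 - p.1 ≠ 0 ∨ z₁.2 - p.2 ≠ 0 := by
    right
    simpa using h1
  obtain ⟨z₂, hz₂, h2, -⟩ := exists_off (z₁.1 - p.1) (z₁.2 - p.2) (z₁.1 - p.1) (z₁.2 - p.2) n1 n1
  have n2 : z₂.1 - p.1 ≠ 0 ∨ z₂.2 - p.2 ≠ 0 := by
    by_contra! h0
    rw [h0.1, h0.2] at h2
    simp at h2
  obtain ⟨z₃, hz₃, h3, h4⟩ := exists_off (z₁.1 - p.1) (z₁.2 - p.2) (z₂.1 - p.1) (z₂.2 - p.2) n1 n2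
  obtain ⟨e1, e2, e3⟩ := eq_zero_of_binary_quadratic_form (hform _ (hFZ _ hz₁))
    (hform _ (hFZ _ hz₂)) (hform _ (hFZ _ hz₃)) h2 h3 h4
  have hdet2 : (a * d - b * c) ^ 2 = 1 := by
    linear_combination -(b ^ 2 + d ^ 2) * e1 - e3 + (a * b + c * d) / 2 * e2
  have hT := h.affine a b u c d v (by
    intro h0
    rw [h0] at hdet2
    norm_num at hdet2) (lt_of_forall _ fun z hz => ⟨hFZ z hz, hTF z hz⟩)
  rcases mul_self_eq_one_iff.1 ((sq _).symm.trans hdet2) with hdet | hdet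
  · left
    have hd : d = a := by linear_combination d * e1 - c * e2 / 2 + a * hdet
    have hb : b = -c := by linear_combination b * e1 - a * e2 / 2 - c * hdet
    subst hd hb
    refine ⟨d, c, u, v, by linear_combination -e1, fun z => ?_, ?_⟩
    · rw [← hT z]
      refine iff_of_eq (congrArg (· ∈ Z) ?_)
      refine Prod.ext ?_ ?_ <;> simp only [posMap] <;> ring
    · refine Prod.ext ?_ ?_ <;> simp only [posMap]
      · linear_combination -hTp.1
      · linear_combination -hTp.2
  · right
    have hd : d = -a := by linear_combination d * e1 - c * e2 / 2 + a * hdet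
    have hb : b = c := by linear_combination b * e1 - a * e2 / 2 - c * hdet
    subst hd hb
    refine ⟨a, b, u, v, by linear_combination -e1, fun z => ?_, ?_⟩
    · rw [← hT z]
      refine iff_of_eq (congrArg (· ∈ Z) ?_)
      refine Prod.ext ?_ ?_ <;> simp only [negMap] <;> ring
    · refine Prod.ext ?_ ?_ <;> simp only [negMap]
      · linear_combination -hTp.1
      · linear_combination -hTp.2

theorem exists_independentPairs (h : RigidCurve Z κ) {p q : ℝ × ℝ} (hp : p ∈ Z)
    (hpos : q ∉ posOrbit Z p) (hneg : q ∉ negOrbit Z p)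
    (X : Finset ((ℝ × ℝ) × (ℝ × ℝ))) (hX : ∀ z ∈ X, z.1 ∈ Z ∧ z.2 ∈ Z)
    (hiso : ∀ z ∈ X, dsq z.1 p = dsq z.2 q) (hcard : κ * κ + 2 * κ < X.card) :
    ∃ τ, IndependentPairs τ ∧ ∀ i, τ i ∈ X := by
  classical
  rcases exists_independentPairs_or X with hτ | ⟨a, b, c, hab, hl⟩ | ⟨a, b, u, c, d, v, hT⟩
  · exact hτ
  · have := card_le_mul_of_isodistant (W := {z | a * z.1 + b * z.2 + c = 0}) (h.circle q)
      (h.line a b c hab) X hX hiso hl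
    omega
  · have hc : (X.image Prod.fst).card = X.card := Finset.card_image_of_injOn fun x hx y hy hxy =>
      Prod.ext hxy (by rw [hT x hx, hT y hy, hxy])
    have := h.mem_orbit_of_affine (q := q) hp (a := a) (b := b) (u := u) (c := c) (d := d) (v := v)
      (X.image Prod.fst) (by omega)
      (fun s hs => by
        obtain ⟨z, hz, rfl⟩ := Finset.mem_image.1 hs
        exact (hX z hz).1)
      (fun s hs => by
        obtain ⟨z, hz, rfl⟩ := Finset.mem_image.1 hs
        rw [← hT z hz]
        exact (hX z hz).2)
      (fun s hs => by
        obtain ⟨z, hz, rfl⟩ := Finset.mem_image.1 hs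
        rw [← hT z hz]
        exact hiso z hz)
    exact absurd this (by simp [hpos, hneg])

open Classical in
theorem card_filter_le (h : RigidCurve Z κ) (S : Finset (ℝ × ℝ)) (hS : ∀ s ∈ S, s ∈ Z)
    {τ : Fin 4 → (ℝ × ℝ) × (ℝ × ℝ)} (hτ : IndependentPairs τ)
    (Γ : Finset ((ℝ × ℝ) × (ℝ × ℝ))) (hΓ : Γ ⊆ S ×ˢ S) :
    (Γ.filter fun c => ∀ i, dsq (τ i).1 c.1 = dsq (τ i).2 c.2).card ≤ κ := by
  set Γ' := Γ.filter fun c => ∀ i, dsq (τ i).1 c.1 = dsq (τ i).2 c.2 with hΓ'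
  rcases Γ'.eq_empty_or_nonempty with h0 | ⟨c₀, hc₀⟩
  · simp [h0]
  obtain ⟨n₁, n₂, n₃, n₄, hn, H⟩ := hτ.exists_direction
  have hiso : ∀ c ∈ Γ', ∀ i, dsq (τ i).1 c.1 = dsq (τ i).2 c.2 := fun c hc =>
    (Finset.mem_filter.1 hc).2
  rw [← Finset.card_image_of_injOn (s := Γ') (f := Prod.snd)]
  · refine card_le_of_forall_mem (h.line n₄ (-n₃) (n₃ * c₀.2.2 - n₄ * c₀.2.1)
      (by rw [neg_ne_zero]; exact hn.symm)) _ fun q hq => ?_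
    obtain ⟨c, hc, rfl⟩ := Finset.mem_image.1 hq
    obtain ⟨l, -, -, e3, e4⟩ := H c.1 c.2 c₀.1 c₀.2 (hiso c hc) (hiso c₀ hc₀)
    exact ⟨hS _ (Finset.mem_product.1 (hΓ (Finset.mem_filter.1 hc).1)).2,
      by linear_combination n₄ * e3 - n₃ * e4⟩
  · intro c hc c' hc' hcc
    obtain ⟨l, e1, e2, e3, e4⟩ := H c.1 c.2 c'.1 c'.2 (hiso c hc) (hiso c' hc')
    have hcc : c.2 = c'.2 := hcc
    rw [hcc, sub_self, eq_comm] at e3 e4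
    have hl : l = 0 := by
      rcases hn with hn | hn
      · exact (mul_eq_zero.1 e3).resolve_right hn
      · exact (mul_eq_zero.1 e4).resolve_right hn
    subst hl
    exact Prod.ext (Prod.ext (by linarith) (by linarith)) hcc

open Classical in
theorem sum_card_isodistantPairs_le (h : RigidCurve Z κ) (S : Finset (ℝ × ℝ))
    (hS : ∀ s ∈ S, s ∈ Z) {r : ℕ} (hr : 0 < r) :
    ∑ c ∈ S ×ˢ S, (isodistantPairs S c.1 c.2).card ≤
      (2 + 2 * κ) * κ * S.card ^ 2 + (κ * κ + 2 * κ) * (6 * r * κ ^ 2) * S.card ^ 2 +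
        κ * (r ^ 2 * ((κ * (S.card / r + 1)) * (κ * (S.card / r + 1))) ^ 4) := by
  obtain ⟨p₀, hp₀⟩ := h.admissible
  set B : (ℝ × ℝ) × (ℝ × ℝ) → Prop := fun c =>
    (c.1 = p₀ ∨ c.2 = p₀) ∨ c.2 ∈ posOrbit Z c.1 ∨ c.2 ∈ negOrbit Z c.1 with hB
  rw [← Finset.sum_filter_add_sum_filter_not _ B, add_assoc]
  refine add_le_add ?_ ?_
  · have hcard : ((S ×ˢ S).filter B).card ≤ (2 + 2 * κ) * S.card := by
      have hsub : (S ×ˢ S).filter B ⊆ (({p₀} ×ˢ S) ∪ (S ×ˢ {p₀})) ∪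
          S.biUnion fun p => ({p} : Finset (ℝ × ℝ)) ×ˢ
            ((S.filter (· ∈ posOrbit Z p)) ∪ (S.filter (· ∈ negOrbit Z p))) := by
        rintro ⟨p, q⟩ hc
        simp only [Finset.mem_filter, Finset.mem_product, hB] at hc
        simp only [Finset.mem_union, Finset.mem_product, Finset.mem_singleton, Finset.mem_biUnion,
          Finset.mem_filter]
        obtain ⟨⟨hp, hq⟩, (h1 | h1) | h1 | h1⟩ := hc
        · exact Or.inl (Or.inl ⟨h1, hq⟩)
        · exact Or.inl (Or.inr ⟨hp, h1⟩)
        · exact Or.inr ⟨p, hp, rfl, Or.inl ⟨hq, h1⟩⟩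
        · exact Or.inr ⟨p, hp, rfl, Or.inr ⟨hq, h1⟩⟩
      have h1 := (Finset.card_le_card hsub).trans (Finset.card_union_le _ _)
      have h2 := Finset.card_union_le (({p₀} : Finset (ℝ × ℝ)) ×ˢ S) (S ×ˢ {p₀})
      rw [Finset.card_product, Finset.card_product, Finset.card_singleton] at h2
      have h3 : (S.biUnion fun p => ({p} : Finset (ℝ × ℝ)) ×ˢ
            ((S.filter (· ∈ posOrbit Z p)) ∪ (S.filter (· ∈ negOrbit Z p)))).card ≤
          S.card * (2 * κ) := by
        refine Finset.card_biUnion_le_card_mul _ _ _ fun p hp => ?_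
        rw [Finset.card_product, Finset.card_singleton, one_mul]
        refine (Finset.card_union_le _ _).trans ?_
        have e1 := card_le_of_forall_mem (h.encard_posOrbit_le (hS p hp))
          (S.filter (· ∈ posOrbit Z p)) fun z hz => (Finset.mem_filter.1 hz).2
        have e2 := card_le_of_forall_mem (h.encard_negOrbit_le (hS p hp))
          (S.filter (· ∈ negOrbit Z p)) fun z hz => (Finset.mem_filter.1 hz).2
        omega
      linarith
    have hle : ∀ c ∈ (S ×ˢ S).filter B, (isodistantPairs S c.1 c.2).card ≤ S.card * κ :=
      fun c _ => card_isodistantPairs_le hS (h.circle c.2)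
    refine (Finset.sum_le_card_nsmul _ _ _ hle).trans ?_
    rw [smul_eq_mul]
    refine (Nat.mul_le_mul_right _ hcard).trans (le_of_eq ?_)
    ring
  · refine (_root_.sum_card_isodistantPairs_le (k := 3) (κ := κ) (L := κ * κ + 2 * κ) (t := κ) hr
      h.isClosed (fun c => ?_) S hS _ (fun c hc => ?_) IndependentPairs ?_ ?_).trans ?_
    · have hsub : {z ∈ Z | z.1 = c} ⊆ {z ∈ Z | 1 * z.1 + 0 * z.2 + -c = 0} := fun z hz =>
        ⟨hz.1, by linear_combination hz.2⟩
      exact (Set.encard_le_encard hsub).trans (h.line 1 0 (-c) (by simp))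
    · rw [Finset.mem_filter, hB] at hc
      have := hc.2
      push Not at this
      exact ⟨hp₀ _ this.1.1, hp₀ _ this.1.2⟩
    · intro c hc X hX hiso hcard
      rw [Finset.mem_filter, hB, Finset.mem_product] at hc
      have := hc.2
      push Not at this
      refine h.exists_independentPairs (hS _ hc.1.1) this.2.1 this.2.2 X (fun z hz => ?_) hiso hcard
      have := Finset.mem_product.1 (hX hz)
      exact ⟨hS _ this.1, hS _ this.2⟩
    · exact fun τ hτ => h.card_filter_le S hS hτ _ (Finset.filter_subset _ _)
    · refine Nat.add_le_add_right (Nat.mul_le_mul_left _ ?_) _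
      refine (Finset.card_filter_le _ _).trans (le_of_eq ?_)
      rw [Finset.card_product, sq]

end RigidCurve

theorem exists_block_count {n m A : ℕ} (hn : 0 < n) (hmn : m ≤ n) (h : n ^ 7 ≤ A * m ^ 8) :
    0 < m ∧ n ≤ A * m ^ 2 ∧ ∃ r, 0 < r ∧ r ≤ 2 * m ∧ m ^ 2 ≤ r * n ∧ r * n ≤ (1 + A) * m ^ 2 := by
  have hm : 0 < m := by
    rcases Nat.eq_zero_or_pos m with rfl | hm
    · have : 0 < n ^ 7 := by positivity
      simp only [ne_eq, OfNat.ofNat_ne_zero, not_false_eq_true, zero_pow, mul_zero] at h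
      omega
    · exact hm
  have hA : n ≤ A * m ^ 2 := by
    refine Nat.le_of_mul_le_mul_right (c := n ^ 6) ?_ (by positivity)
    calc n * n ^ 6 = n ^ 7 := by ring
      _ ≤ A * m ^ 8 := h
      _ = A * m ^ 2 * m ^ 6 := by ring
      _ ≤ A * m ^ 2 * n ^ 6 := by gcongr
  refine ⟨hm, hA, m ^ 2 / n + 1, Nat.succ_pos _, ?_, ?_, ?_⟩
  · have : m ^ 2 / n ≤ m := Nat.div_le_of_le_mul (by nlinarith)
    omega
  · have := Nat.div_add_mod (m ^ 2) n
    have := Nat.mod_lt (m ^ 2) hn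
    nlinarith
  · have := Nat.div_mul_le_self (m ^ 2) n
    nlinarith

theorem block_size_mul_le {m r : ℕ} (κ : ℕ) (hr : r ≤ 2 * m) :
    κ * (m / r + 1) * r ≤ 3 * κ * m := by
  have := Nat.div_mul_le_self m r
  calc κ * (m / r + 1) * r = κ * (m / r * r + r) := by ring
    _ ≤ κ * (m + 2 * m) := by gcongr
    _ = 3 * κ * m := by ring

theorem block_term_mul_le {n m A r : ℕ} (κ : ℕ) (hn : 0 < n) (hr0 : 0 < r) (hr : r ≤ 2 * m)
    (hm : m ^ 2 ≤ r * n) (h : n ^ 7 ≤ A * m ^ 8) :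
    r ^ 2 * ((κ * (m / r + 1)) * (κ * (m / r + 1))) ^ 4 * n ≤ (3 * κ) ^ 8 * A * m ^ 4 := by
  have h1 : n * m ^ 4 ≤ A * r ^ 6 := by
    refine Nat.le_of_mul_le_mul_right (c := n ^ 6) ?_ (by positivity)
    calc n * m ^ 4 * n ^ 6 = m ^ 4 * n ^ 7 := by ring
      _ ≤ m ^ 4 * (A * m ^ 8) := by gcongr
      _ = A * (m ^ 2) ^ 6 := by ring
      _ ≤ A * (r * n) ^ 6 := by gcongr
      _ = A * r ^ 6 * n ^ 6 := by ring
  refine Nat.le_of_mul_le_mul_right (c := r ^ 6) ?_ (by positivity)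
  calc r ^ 2 * ((κ * (m / r + 1)) * (κ * (m / r + 1))) ^ 4 * n * r ^ 6
      = (κ * (m / r + 1) * r) ^ 8 * n := by ring
    _ ≤ (3 * κ * m) ^ 8 * n := by
        exact Nat.mul_le_mul_right _ (Nat.pow_le_pow_left (block_size_mul_le κ hr) 8)
    _ = (3 * κ) ^ 8 * m ^ 4 * (n * m ^ 4) := by ring
    _ ≤ (3 * κ) ^ 8 * m ^ 4 * (A * r ^ 6) := by gcongr
    _ = (3 * κ) ^ 8 * A * m ^ 4 * r ^ 6 := by ring

theorem numDist_mono {S P : Finset (ℝ × ℝ)} (h : S ⊆ P) : numDist S ≤ numDist P :=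
  Finset.card_le_card (Finset.image_subset_image (Finset.product_subset_product h h))

theorem RigidCurve.card_le_mul_numDist (κ A : ℕ) :
    ∃ C : ℕ, ∀ Z : Set (ℝ × ℝ), RigidCurve Z κ → ∀ S P : Finset (ℝ × ℝ), S ⊆ P → (∀ s ∈ S, s ∈ Z) →
      P.card ^ 7 ≤ A * S.card ^ 8 → P.card ≤ C * numDist P := by
  classical
  refine ⟨(2 + 2 * κ) * κ * A + (κ * κ + 2 * κ) * (6 * κ ^ 2) * (1 + A) + κ * ((3 * κ) ^ 8 * A),
    fun Z hZ S P hSP hS h => ?_⟩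
  rcases Nat.eq_zero_or_pos P.card with h0 | hn
  · omega
  obtain ⟨hm, hA, r, hr0, hr, hmr, hrn⟩ := exists_block_count hn (Finset.card_le_card hSP) h
  have h1 := hZ.sum_card_isodistantPairs_le S hS hr0
  have h2 := sq_mul_sq_le_numDist_mul_sum (Finset.Subset.refl S)
  have h3 := block_term_mul_le κ hn hr0 hr hmr h
  set Q := ∑ c ∈ S ×ˢ S, (isodistantPairs S c.1 c.2).card
  set T := r ^ 2 * ((κ * (S.card / r + 1)) * (κ * (S.card / r + 1))) ^ 4
  set n := P.card
  set m := S.card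
  set C := (2 + 2 * κ) * κ * A + (κ * κ + 2 * κ) * (6 * κ ^ 2) * (1 + A) + κ * ((3 * κ) ^ 8 * A)
  have hQ : Q * n ≤ C * m ^ 4 := by
    calc Q * n
        ≤ ((2 + 2 * κ) * κ * m ^ 2 + (κ * κ + 2 * κ) * (6 * r * κ ^ 2) * m ^ 2 + κ * T) * n :=
          Nat.mul_le_mul_right _ h1
      _ = (2 + 2 * κ) * κ * m ^ 2 * n + (κ * κ + 2 * κ) * (6 * κ ^ 2) * m ^ 2 * (r * n) +
          κ * (T * n) := by ring
      _ ≤ (2 + 2 * κ) * κ * m ^ 2 * (A * m ^ 2) +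
          (κ * κ + 2 * κ) * (6 * κ ^ 2) * m ^ 2 * ((1 + A) * m ^ 2) +
          κ * ((3 * κ) ^ 8 * A * m ^ 4) := by gcongr
      _ = C * m ^ 4 := by ring
  refine (?_ : n ≤ C * numDist S).trans (Nat.mul_le_mul_left _ (numDist_mono hSP))
  refine Nat.le_of_mul_le_mul_right (c := m ^ 4) ?_ (by positivity)
  calc n * m ^ 4 = n * (m ^ 2 * m ^ 2) := by ring
    _ ≤ n * (numDist S * Q) := Nat.mul_le_mul_left _ h2
    _ = numDist S * (Q * n) := by ring
    _ ≤ numDist S * (C * m ^ 4) := Nat.mul_le_mul_left _ hQ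
    _ = C * numDist S * m ^ 4 := by ring

theorem dsq_injective {T : ℝ × ℝ → ℝ × ℝ} (hT : ∀ x y, dsq (T x) (T y) = dsq x y) :
    Function.Injective T := fun x y hxy => by
  rw [← dsq_eq_zero_iff, ← hT, hxy, dsq_eq_zero_iff]

open Classical in
theorem numDist_image {T : ℝ × ℝ → ℝ × ℝ} (hT : ∀ x y, dsq (T x) (T y) = dsq x y)
    (P : Finset (ℝ × ℝ)) : numDist (P.image T) = numDist P := by
  unfold numDist
  congr 1
  ext ρ
  simp only [Finset.mem_image, Finset.mem_product]
  constructor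
  · rintro ⟨⟨_, _⟩, ⟨⟨x, hx, rfl⟩, y, hy, rfl⟩, rfl⟩
    exact ⟨(x, y), ⟨hx, hy⟩, (hT x y).symm⟩
  · rintro ⟨⟨x, y⟩, ⟨hx, hy⟩, rfl⟩
    exact ⟨(T x, T y), ⟨⟨x, hx, rfl⟩, y, hy, rfl⟩, hT x y⟩

open Classical in
theorem sum_card_isodistantPairs_le_of_fiber (S P : Finset (ℝ × ℝ))
    (Γ : Finset ((ℝ × ℝ) × (ℝ × ℝ))) (hΓ : Γ ⊆ P ×ˢ P) (N : ℕ)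
    (h : ∀ s ∈ S, ∀ t ∈ S, ∀ p ∈ P,
      ((P.filter fun q => (p, q) ∈ Γ ∧ dsq s p = dsq t q)).card ≤ N) :
    ∑ c ∈ Γ, (isodistantPairs S c.1 c.2).card ≤ N * S.card ^ 2 * P.card := by
  calc ∑ c ∈ Γ, (isodistantPairs S c.1 c.2).card
      = ∑ z ∈ S ×ˢ S, (Γ.filter fun c => dsq z.1 c.1 = dsq z.2 c.2).card := by
        simp only [isodistantPairs]
        exact Finset.sum_card_bipartiteAbove_eq_sum_card_bipartiteBelow
          (fun c z : (ℝ × ℝ) × (ℝ × ℝ) => dsq z.1 c.1 = dsq z.2 c.2)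
    _ ≤ ∑ z ∈ S ×ˢ S, P.card * N := by
        refine Finset.sum_le_sum fun z hz => ?_
        rw [Finset.mem_product] at hz
        refine (Finset.card_le_card (t := P.biUnion fun p => ({p} : Finset (ℝ × ℝ)) ×ˢ
          (P.filter fun q => (p, q) ∈ Γ ∧ dsq z.1 p = dsq z.2 q)) fun c hc => ?_).trans
          (Finset.card_biUnion_le_card_mul _ _ _ fun p hp => ?_)
        · rw [Finset.mem_filter] at hc
          obtain ⟨h1, h2⟩ := Finset.mem_product.1 (hΓ hc.1)
          simp only [Finset.mem_biUnion, Finset.mem_product, Finset.mem_singleton,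
            Finset.mem_filter]
          exact ⟨c.1, h1, rfl, h2, hc.1, hc.2⟩
        · rw [Finset.card_product, Finset.card_singleton, one_mul]
          exact h _ hz.1 _ hz.2 _ hp
    _ = N * S.card ^ 2 * P.card := by
        rw [Finset.sum_const, Finset.card_product, smul_eq_mul]
        ring

theorem le_mul_numDist_of_sum_le {S P : Finset (ℝ × ℝ)} {C : ℕ} (hSP : S ⊆ P) (hS : 0 < S.card)
    (h : ∑ c ∈ P ×ˢ P, (isodistantPairs S c.1 c.2).card ≤ C * S.card ^ 2 * P.card) :
    P.card ≤ C * numDist P := by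
  have hP : 0 < P.card := hS.trans_le (Finset.card_le_card hSP)
  refine Nat.le_of_mul_le_mul_right (c := S.card ^ 2 * P.card) ?_ (by positivity)
  calc P.card * (S.card ^ 2 * P.card) = S.card ^ 2 * P.card ^ 2 := by ring
    _ ≤ _ := sq_mul_sq_le_numDist_mul_sum hSP
    _ ≤ numDist P * (C * S.card ^ 2 * P.card) := Nat.mul_le_mul_left _ h
    _ = C * numDist P * (S.card ^ 2 * P.card) := by ring

/-- The circle of squared radius `R` around the origin. -/
def originCircle (R : ℝ) : Set (ℝ × ℝ) := {z | z.1 ^ 2 + z.2 ^ 2 = R}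

theorem encard_originCircle_inter_line_le {a b : ℝ} (hab : a ≠ 0 ∨ b ≠ 0) (c R : ℝ) :
    {z ∈ originCircle R | a * z.1 + b * z.2 + c = 0}.encard ≤ (2 : ℕ) := by
  have hD : a ^ 2 + b ^ 2 ≠ 0 := by
    rcases hab with h | h <;> positivity
  rcases Set.eq_empty_or_nonempty {z ∈ originCircle R | a * z.1 + b * z.2 + c = 0} with h0 | ⟨x, hx⟩
  · rw [h0]
    simp
  set l₀ := -2 * (x.2 * a - x.1 * b) / (a ^ 2 + b ^ 2) with hl₀
  refine (Set.encard_le_encard (t := {x, (x.1 - l₀ * b, x.2 + l₀ * a)}) fun y hy => ?_).trans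
    ((Set.encard_insert_le _ _).trans (by rw [Set.encard_singleton, one_add_one_eq_two]; rfl))
  obtain ⟨hx1, hx2⟩ := hx
  obtain ⟨hy1, hy2⟩ := hy
  have hx1 : x.1 ^ 2 + x.2 ^ 2 = R := hx1
  have hy1 : y.1 ^ 2 + y.2 ^ 2 = R := hy1
  obtain ⟨l, e1, e2⟩ : ∃ l, y.1 = x.1 - l * b ∧ y.2 = x.2 + l * a := by
    refine ⟨(a * (y.2 - x.2) - b * (y.1 - x.1)) / (a ^ 2 + b ^ 2), ?_, ?_⟩
    · field_simp
      linear_combination a * (hy2 - hx2)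
    · field_simp
      linear_combination b * (hy2 - hx2)
  rw [e1, e2] at hy1
  have : l * (l * (a ^ 2 + b ^ 2) + 2 * (x.2 * a - x.1 * b)) = 0 := by
    linear_combination hy1 - hx1
  rcases mul_eq_zero.1 this with h | h
  · left
    rw [h] at e1 e2
    exact Prod.ext (by linarith) (by linarith)
  · right
    have : l = l₀ := by
      rw [hl₀]
      field_simp
      linear_combination h
    rw [Set.mem_singleton_iff, ← this, ← e1, ← e2]

theorem encard_originCircle_inter_circle_le {p : ℝ × ℝ} (hp : p ≠ 0) (R ρ : ℝ) :
    {z ∈ originCircle R | dsq z p = ρ}.encard ≤ (2 : ℕ) := by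
  have hp' : -2 * p.1 ≠ 0 ∨ -2 * p.2 ≠ 0 := by
    by_contra! h
    exact hp (Prod.ext (by simpa using h.1) (by simpa using h.2))
  refine (Set.encard_le_encard fun z hz => ?_).trans (encard_originCircle_inter_line_le hp'
    (p.1 ^ 2 + p.2 ^ 2 + R - ρ) R)
  obtain ⟨h1, h2⟩ := hz
  refine ⟨h1, ?_⟩
  have h1 : z.1 ^ 2 + z.2 ^ 2 = R := h1
  simp only [dsq] at h2
  linear_combination h2 - h1

theorem admissibleCentre_originCircle {p : ℝ × ℝ} (hp : p ≠ 0) (R : ℝ) :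
    AdmissibleCentre (originCircle R) 2 p := by
  refine ⟨⟨{z ∈ originCircle R | p.2 * z.1 + -p.1 * z.2 + 0 = 0},
    encard_originCircle_inter_line_le ?_ 0 R, fun z hz hzE => ?_⟩,
    fun ρ => encard_originCircle_inter_circle_le hp R ρ⟩
  · by_contra! h
    exact hp (Prod.ext (by simpa using h.2) h.1)
  · have h1 : HasFDerivAt (fun w : ℝ × ℝ => w.1) (ContinuousLinearMap.fst ℝ ℝ ℝ) z :=
      hasFDerivAt_fst
    have h2 : HasFDerivAt (fun w : ℝ × ℝ => w.2) (ContinuousLinearMap.snd ℝ ℝ ℝ) z :=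
      hasFDerivAt_snd
    have hL := ((h1.pow 2).add (h2.pow 2)).sub_const R
    have hz' : z.1 ^ 2 + z.2 ^ 2 = R := hz
    have := locallyOntoAt_of_hasFDerivAt (F := fun w : ℝ × ℝ => w.1 ^ 2 + w.2 ^ 2 - R) (p := p)
      (by fun_prop) hL (by simp only [hz', sub_self]) (by
        intro h0
        refine hzE ⟨hz, ?_⟩
        simp at h0
        linear_combination h0 / 2)
    have hset : originCircle R = {w : ℝ × ℝ | w.1 ^ 2 + w.2 ^ 2 - R = 0} := by
      ext w
      simp [originCircle, sub_eq_zero]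
    rw [hset]
    exact this

theorem quartic_coeff_eq_zero {c₀ c₁ c₂ c₃ c₄ : ℝ} (F : Finset ℝ) (hF : 4 < F.card)
    (h : ∀ x ∈ F, c₄ * x ^ 4 + c₃ * x ^ 3 + c₂ * x ^ 2 + c₁ * x + c₀ = 0) :
    c₄ = 0 ∧ c₃ = 0 ∧ c₂ = 0 ∧ c₁ = 0 ∧ c₀ = 0 := by
  open Polynomial in
  set P : ℝ[X] := C c₄ * X ^ 4 + C c₃ * X ^ 3 + C c₂ * X ^ 2 + C c₁ * X + C c₀ with hP
  have hdeg : P.natDegree ≤ 4 := by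
    rw [hP]
    compute_degree
  have h0 : P = 0 := Polynomial.eq_zero_of_natDegree_lt_card_of_eval_eq_zero' P F
    (fun x hx => by simpa [hP] using h x hx) (by omega)
  refine ⟨?_, ?_, ?_, ?_, ?_⟩
  · simpa [hP, Polynomial.coeff_X, Polynomial.coeff_C] using congrArg (Polynomial.coeff · 4) h0
  · simpa [hP, Polynomial.coeff_X, Polynomial.coeff_C] using congrArg (Polynomial.coeff · 3) h0
  · simpa [hP, Polynomial.coeff_X, Polynomial.coeff_C] using congrArg (Polynomial.coeff · 2) h0
  · simpa [hP, Polynomial.coeff_X, Polynomial.coeff_C] using congrArg (Polynomial.coeff · 1) h0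
  · simpa [hP, Polynomial.coeff_X, Polynomial.coeff_C] using congrArg (Polynomial.coeff · 0) h0

/-- A conic through many points of a circle is that circle. -/
theorem conic_coeff_of_originCircle {R α β γ δ ε η : ℝ} (F : Finset (ℝ × ℝ)) (hF : 8 < F.card)
    (hFR : ∀ z ∈ F, z ∈ originCircle R)
    (h : ∀ z ∈ F, α * z.1 ^ 2 + β * z.1 * z.2 + γ * z.2 ^ 2 + δ * z.1 + ε * z.2 + η = 0) :
    α = γ ∧ β = 0 ∧ δ = 0 ∧ ε = 0 ∧ η + γ * R = 0 := by
  classical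
  have hcard : 4 < (F.image Prod.fst).card := by
    have : F.card ≤ 2 * (F.image Prod.fst).card := by
      refine Finset.card_le_mul_card_image _ _ fun x _ => ?_
      refine card_le_of_forall_mem (encard_originCircle_inter_line_le (a := 1) (b := 0)
        (by simp) (-x) R) _ fun z hz => ?_
      rw [Finset.mem_filter] at hz
      exact ⟨hFR z hz.1, by linear_combination hz.2⟩
    omega
  obtain ⟨h4, h3, h2, h1, h0⟩ := quartic_coeff_eq_zero (c₄ := -β ^ 2 - (α - γ) ^ 2)
    (c₃ := -2 * β * ε - 2 * (α - γ) * δ)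
    (c₂ := R * β ^ 2 - ε ^ 2 - δ ^ 2 - 2 * (α - γ) * (η + γ * R))
    (c₁ := 2 * R * β * ε - 2 * δ * (η + γ * R)) (c₀ := R * ε ^ 2 - (η + γ * R) ^ 2)
    (F.image Prod.fst) hcard (fun x hx => by
      obtain ⟨z, hz, rfl⟩ := Finset.mem_image.1 hx
      have e1 : z.1 ^ 2 + z.2 ^ 2 = R := hFR z hz
      have e2 := h z hz
      have e3 : z.2 * (β * z.1 + ε) = -((α - γ) * z.1 ^ 2 + δ * z.1 + (η + γ * R)) := by
        linear_combination e2 - γ * e1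
      have e4 : (R - z.1 ^ 2) * (β * z.1 + ε) ^ 2 =
          ((α - γ) * z.1 ^ 2 + δ * z.1 + (η + γ * R)) ^ 2 := by
        rw [show R - z.1 ^ 2 = z.2 ^ 2 by linarith, ← mul_pow, e3, neg_sq]
      linear_combination e4)
  have hβ : β = 0 := by nlinarith [sq_nonneg β, sq_nonneg (α - γ)]
  have hαγ : α - γ = 0 := by nlinarith [sq_nonneg β, sq_nonneg (α - γ)]
  rw [hβ, hαγ] at h2
  have hε : ε = 0 := by nlinarith [sq_nonneg ε, sq_nonneg δ]
  have hδ : δ = 0 := by nlinarith [sq_nonneg ε, sq_nonneg δ]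
  rw [hε] at h0
  exact ⟨by linarith, hβ, hδ, hε, by nlinarith⟩

theorem exists_independentPairs_of_originCircle {R : ℝ} {p q : ℝ × ℝ} (hp : p ≠ 0)
    (hq : q ≠ 0) (hpq : p.1 ^ 2 + p.2 ^ 2 ≠ q.1 ^ 2 + q.2 ^ 2)
    (X : Finset ((ℝ × ℝ) × (ℝ × ℝ))) (hX : ∀ z ∈ X, z.1 ∈ originCircle R ∧ z.2 ∈ originCircle R)
    (hiso : ∀ z ∈ X, dsq z.1 p = dsq z.2 q) (hcard : 8 < X.card) :
    ∃ τ, IndependentPairs τ ∧ ∀ i, τ i ∈ X := by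
  classical
  rcases exists_independentPairs_or X with hτ | ⟨a, b, c, hab, hl⟩ | ⟨a, b, u, c, d, v, hT⟩
  · exact hτ
  · have := card_le_mul_of_isodistant (W := {z | a * z.1 + b * z.2 + c = 0})
      (fun ρ => encard_originCircle_inter_circle_le hq R ρ)
      (encard_originCircle_inter_line_le hab c R) X hX hiso hl
    omega
  · exfalso
    have hc : (X.image Prod.fst).card = X.card := Finset.card_image_of_injOn fun x hx y hy hxy =>
      Prod.ext hxy (by rw [hT x hx, hT y hy, hxy])
    have hmem : ∀ s ∈ X.image Prod.fst, s ∈ originCircle R := fun s hs => by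
      obtain ⟨z, hz, rfl⟩ := Finset.mem_image.1 hs
      exact (hX z hz).1
    have hTmem : ∀ s ∈ X.image Prod.fst,
        (a * s.1 + b * s.2 + u) ^ 2 + (c * s.1 + d * s.2 + v) ^ 2 = R := fun s hs => by
      obtain ⟨z, hz, rfl⟩ := Finset.mem_image.1 hs
      have : z.2.1 ^ 2 + z.2.2 ^ 2 = R := (hX z hz).2
      rw [hT z hz] at this
      exact this
    obtain ⟨h1, h2, h3, h4, h5⟩ := conic_coeff_of_originCircle (R := R) (α := a ^ 2 + c ^ 2)
      (β := 2 * (a * b + c * d)) (γ := b ^ 2 + d ^ 2) (δ := 2 * (a * u + c * v))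
      (ε := 2 * (b * u + d * v)) (η := u ^ 2 + v ^ 2 - R) (X.image Prod.fst) (by omega) hmem
      (fun s hs => by linear_combination hTmem s hs)
    have hlin : ∀ s ∈ X.image Prod.fst, (-2 * p.1 + 2 * (a * q.1 + c * q.2)) * s.1 +
        (-2 * p.2 + 2 * (b * q.1 + d * q.2)) * s.2 +
        (2 * (u * q.1 + v * q.2) + (p.1 ^ 2 + p.2 ^ 2) - (q.1 ^ 2 + q.2 ^ 2)) = 0 := fun s hs => by
      have e1 : s.1 ^ 2 + s.2 ^ 2 = R := hmem s hs
      have e2 := hTmem s hs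
      obtain ⟨z, hz, rfl⟩ := Finset.mem_image.1 hs
      have e3 := hiso z hz
      rw [hT z hz] at e3
      simp only [dsq] at e3
      linear_combination e3 - e1 + e2
    have hpq' : -2 * p.1 + 2 * (a * q.1 + c * q.2) = 0 ∧
        -2 * p.2 + 2 * (b * q.1 + d * q.2) = 0 := by
      by_contra h0
      have := card_le_of_forall_mem (encard_originCircle_inter_line_le
        (not_and_or.1 h0) (2 * (u * q.1 + v * q.2) + (p.1 ^ 2 + p.2 ^ 2) - (q.1 ^ 2 + q.2 ^ 2)) R)
        (X.image Prod.fst) fun s hs => ⟨hmem s hs, hlin s hs⟩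
      omega
    have hdet : (a * d - b * c) ^ 2 = (b ^ 2 + d ^ 2) ^ 2 := by
      linear_combination (b ^ 2 + d ^ 2) * h1 - (a * b + c * d) / 2 * h2
    by_cases hμ : b ^ 2 + d ^ 2 = 0
    · have hb : b = 0 := by nlinarith [sq_nonneg b, sq_nonneg d]
      have hd : d = 0 := by nlinarith [sq_nonneg b, sq_nonneg d]
      rw [hμ] at h1
      have ha : a = 0 := by nlinarith [sq_nonneg a, sq_nonneg c]
      have hc : c = 0 := by nlinarith [sq_nonneg a, sq_nonneg c]
      rw [ha, hb, hc, hd] at hpq'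
      exact hp (Prod.ext (by simpa using hpq'.1) (by simpa using hpq'.2))
    · have hdet0 : a * d - b * c ≠ 0 := by
        intro h0
        rw [h0] at hdet
        exact hμ (by simpa using hdet.symm)
      have hu : u = 0 := by
        refine (mul_eq_zero.1 ?_).resolve_left hdet0
        linear_combination d / 2 * h3 - c / 2 * h4
      have hv : v = 0 := by
        refine (mul_eq_zero.1 ?_).resolve_left hdet0
        linear_combination a / 2 * h4 - b / 2 * h3
      obtain ⟨s, hs⟩ : (X.image Prod.fst).Nonempty := Finset.card_pos.1 (by omega)
      have := hlin s hs
      rw [hpq'.1, hpq'.2, hu, hv] at this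
      exact hpq (by linear_combination this)

open Classical in
theorem card_filter_le_one_of_originCircle {R : ℝ} {τ : Fin 4 → (ℝ × ℝ) × (ℝ × ℝ)}
    (hτ : IndependentPairs τ)
    (hR : ∀ i, (τ i).1 ∈ originCircle R ∧ (τ i).2 ∈ originCircle R)
    (Γ : Finset ((ℝ × ℝ) × (ℝ × ℝ)))
    (hΓ : ∀ c ∈ Γ, c.1.1 ^ 2 + c.1.2 ^ 2 ≠ c.2.1 ^ 2 + c.2.2 ^ 2) :
    (Γ.filter fun c => ∀ i, dsq (τ i).1 c.1 = dsq (τ i).2 c.2).card ≤ 1 := by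
  obtain ⟨n₁, n₂, n₃, n₄, n₅, -, H⟩ := hτ.exists_annihilator
  have key : ∀ c ∈ Γ.filter fun c => ∀ i, dsq (τ i).1 c.1 = dsq (τ i).2 c.2, ∃ l : ℝ,
      -2 * c.1.1 = l * n₁ ∧ -2 * c.1.2 = l * n₂ ∧ 2 * c.2.1 = l * n₃ ∧ 2 * c.2.2 = l * n₄ ∧
      l * (n₁ ^ 2 + n₂ ^ 2 - n₃ ^ 2 - n₄ ^ 2) = 4 * n₅ ∧
      n₁ ^ 2 + n₂ ^ 2 - n₃ ^ 2 - n₄ ^ 2 ≠ 0 := by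
    intro c hc
    rw [Finset.mem_filter] at hc
    obtain ⟨l, e1, e2, e3, e4, e5⟩ := H (-2 * c.1.1) (-2 * c.1.2) (2 * c.2.1) (2 * c.2.2)
      (c.1.1 ^ 2 + c.1.2 ^ 2 - c.2.1 ^ 2 - c.2.2 ^ 2) (fun i => by
        have h1 : (τ i).1.1 ^ 2 + (τ i).1.2 ^ 2 = R := (hR i).1
        have h2 : (τ i).2.1 ^ 2 + (τ i).2.2 ^ 2 = R := (hR i).2
        have h3 := hc.2 i
        simp only [dsq] at h3
        linear_combination h3 - h1 + h2)
    have hne := hΓ c hc.1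
    have e6 : l * (l * (n₁ ^ 2 + n₂ ^ 2 - n₃ ^ 2 - n₄ ^ 2)) = l * (4 * n₅) := by
      linear_combination 4 * e5 - (l * n₁ - 2 * c.1.1) * e1 - (l * n₂ - 2 * c.1.2) * e2 +
        (l * n₃ + 2 * c.2.1) * e3 + (l * n₄ + 2 * c.2.2) * e4
    have hl : l ≠ 0 := by
      rintro rfl
      exact hne (by linear_combination e5)
    have e7 := mul_left_cancel₀ hl e6
    refine ⟨l, e1, e2, e3, e4, e7, fun h0 => hne ?_⟩
    rw [h0] at e7
    linear_combination e5 - l / 4 * e7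
  refine Finset.card_le_one.2 fun c hc c' hc' => ?_
  obtain ⟨l, e1, e2, e3, e4, e5, h0⟩ := key c hc
  obtain ⟨l', e1', e2', e3', e4', e5', -⟩ := key c' hc'
  obtain rfl : l = l' := mul_right_cancel₀ h0 (e5.trans e5'.symm)
  refine Prod.ext (Prod.ext ?_ ?_) (Prod.ext ?_ ?_) <;> linarith

open Classical in
theorem sum_card_isodistantPairs_le_of_originCircle {R : ℝ} (hR : R ≠ 0) {S P : Finset (ℝ × ℝ)}
    (hS : ∀ s ∈ S, s ∈ originCircle R) {r : ℕ} (hr : 0 < r) :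
    ∑ c ∈ P ×ˢ P, (isodistantPairs S c.1 c.2).card ≤
      4 * S.card ^ 2 * P.card + 8 * (6 * r * 2 ^ 2) * P.card ^ 2 +
        1 * (r ^ 2 * ((2 * (S.card / r + 1)) * (2 * (S.card / r + 1))) ^ 4) := by
  set B : (ℝ × ℝ) × (ℝ × ℝ) → Prop := fun c => c.1 = 0 ∨ c.2 = 0
  set D : (ℝ × ℝ) × (ℝ × ℝ) → Prop := fun c => c.1.1 ^ 2 + c.1.2 ^ 2 = c.2.1 ^ 2 + c.2.2 ^ 2
  rw [← Finset.sum_filter_add_sum_filter_not _ B,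
    ← Finset.sum_filter_add_sum_filter_not ((P ×ˢ P).filter fun c => ¬ B c) D]
  have hB : ∑ c ∈ (P ×ˢ P).filter B, (isodistantPairs S c.1 c.2).card ≤
      2 * S.card ^ 2 * P.card := by
    have hsub : (P ×ˢ P).filter B ⊆ ({0} ×ˢ P) ∪ (P ×ˢ {0}) := by
      rintro ⟨p, q⟩ hc
      simp only [Finset.mem_filter, Finset.mem_product, B] at hc
      simp only [Finset.mem_union, Finset.mem_product, Finset.mem_singleton]
      obtain ⟨⟨hp, hq⟩, h | h⟩ := hc
      · exact Or.inl ⟨h, hq⟩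
      · exact Or.inr ⟨hp, h⟩
    have h1 := (Finset.card_le_card hsub).trans (Finset.card_union_le _ _)
    rw [Finset.card_product, Finset.card_product, Finset.card_singleton] at h1
    have hle : ∀ c ∈ (P ×ˢ P).filter B, (isodistantPairs S c.1 c.2).card ≤ S.card ^ 2 :=
      fun c _ => (Finset.card_filter_le _ _).trans (by rw [Finset.card_product, sq])
    refine (Finset.sum_le_card_nsmul _ _ _ hle).trans ?_
    rw [smul_eq_mul]
    calc _ ≤ (1 * P.card + P.card * 1) * S.card ^ 2 := Nat.mul_le_mul_right _ h1
      _ = _ := by ring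
  have hD : ∑ c ∈ ((P ×ˢ P).filter fun c => ¬ B c).filter D, (isodistantPairs S c.1 c.2).card ≤
      2 * S.card ^ 2 * P.card := by
    refine sum_card_isodistantPairs_le_of_fiber S P _
      ((Finset.filter_subset _ _).trans (Finset.filter_subset _ _)) 2 fun s hs t ht p hp => ?_
    have ht' : t.1 ^ 2 + t.2 ^ 2 = R := hS t ht
    have ht0 : -2 * t.1 ≠ 0 ∨ -2 * t.2 ≠ 0 := by
      by_contra! h
      refine hR ?_
      rw [← ht', show t.1 = 0 by linarith [h.1], show t.2 = 0 by linarith [h.2]]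
      norm_num
    refine card_le_of_forall_mem (encard_originCircle_inter_line_le ht0
      (t.1 ^ 2 + t.2 ^ 2 + (p.1 ^ 2 + p.2 ^ 2) - dsq s p) (p.1 ^ 2 + p.2 ^ 2)) _ fun q hq => ?_
    simp only [Finset.mem_filter] at hq
    obtain ⟨-, ⟨-, hq1⟩, hq2⟩ := hq
    have hq1 : p.1 ^ 2 + p.2 ^ 2 = q.1 ^ 2 + q.2 ^ 2 := hq1
    refine ⟨hq1.symm, ?_⟩
    rw [hq2, dsq]
    linear_combination hq1
  have hG := sum_card_isodistantPairs_le (k := 3) (κ := 2) (L := 8) (t := 1) hr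
    (Z := originCircle R) (isClosed_eq (by fun_prop) continuous_const)
    (fun c => by
      have hsub : {z ∈ originCircle R | z.1 = c} ⊆
          {z ∈ originCircle R | 1 * z.1 + 0 * z.2 + -c = 0} := fun z hz =>
        ⟨hz.1, by linear_combination hz.2⟩
      exact (Set.encard_le_encard hsub).trans (encard_originCircle_inter_line_le (by simp) _ R))
    S hS (((P ×ˢ P).filter fun c => ¬ B c).filter fun c => ¬ D c)
    (fun c hc => by
      simp only [Finset.mem_filter, B, not_or] at hc
      exact ⟨admissibleCentre_originCircle hc.1.2.1 R, admissibleCentre_originCircle hc.1.2.2 R⟩)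
    (fun τ => IndependentPairs τ ∧ ∀ i, (τ i).1 ∈ originCircle R ∧ (τ i).2 ∈ originCircle R)
    (fun c hc X hX hiso hcard => by
      simp only [Finset.mem_filter, B, not_or] at hc
      have hXZ : ∀ z ∈ X, z.1 ∈ originCircle R ∧ z.2 ∈ originCircle R := fun z hz =>
        ⟨hS _ (Finset.mem_product.1 (hX hz)).1, hS _ (Finset.mem_product.1 (hX hz)).2⟩
      obtain ⟨τ, hτ, hτX⟩ := exists_independentPairs_of_originCircle hc.1.2.1 hc.1.2.2 hc.2 X hXZ
        hiso hcard
      exact ⟨τ, ⟨hτ, fun i => hXZ _ (hτX i)⟩, hτX⟩)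
    (fun τ hτ => card_filter_le_one_of_originCircle hτ.1 hτ.2 _ fun c hc =>
      (Finset.mem_filter.1 hc).2)
  have hcard : (((P ×ˢ P).filter fun c => ¬ B c).filter fun c => ¬ D c).card ≤ P.card ^ 2 :=
    ((Finset.card_filter_le _ _).trans (Finset.card_filter_le _ _)).trans
      (by rw [Finset.card_product, sq])
  refine (add_le_add hB (add_le_add hD (hG.trans (Nat.add_le_add_right
    (Nat.mul_le_mul_left (8 * (6 * r * 2 ^ 2)) hcard) _)))).trans (le_of_eq ?_)
  ring

theorem card_le_mul_numDist_of_originCircle (A : ℕ) :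
    ∃ C : ℕ, ∀ R : ℝ, R ≠ 0 → ∀ S P : Finset (ℝ × ℝ), S ⊆ P → (∀ s ∈ S, s ∈ originCircle R) →
      P.card ^ 7 ≤ A * S.card ^ 8 → P.card ≤ C * numDist P := by
  classical
  refine ⟨4 + 192 * (1 + A) + (3 * 2) ^ 8 * A, fun R hR S P hSP hS h => ?_⟩
  rcases Nat.eq_zero_or_pos P.card with h0 | hn
  · omega
  have hmn := Finset.card_le_card hSP
  obtain ⟨hm, hA, r, hr0, hr, hmr, hrn⟩ := exists_block_count hn hmn h
  refine le_mul_numDist_of_sum_le hSP hm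
    ((sum_card_isodistantPairs_le_of_originCircle hR hS hr0).trans ?_)
  have h3 := block_term_mul_le 2 hn hr0 hr hmr h
  set T := r ^ 2 * ((2 * (S.card / r + 1)) * (2 * (S.card / r + 1))) ^ 4
  set n := P.card
  set m := S.card
  have hT : T ≤ (3 * 2) ^ 8 * A * m ^ 2 * n := by
    refine Nat.le_of_mul_le_mul_right (c := n) ?_ hn
    calc T * n ≤ (3 * 2) ^ 8 * A * m ^ 4 := h3
      _ = (3 * 2) ^ 8 * A * m ^ 2 * (m * m) := by ring
      _ ≤ (3 * 2) ^ 8 * A * m ^ 2 * (n * n) := by gcongr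
      _ = (3 * 2) ^ 8 * A * m ^ 2 * n * n := by ring
  calc 4 * m ^ 2 * n + 8 * (6 * r * 2 ^ 2) * n ^ 2 + 1 * T
      = 4 * m ^ 2 * n + 192 * (r * n) * n + T := by ring
    _ ≤ 4 * m ^ 2 * n + 192 * ((1 + A) * m ^ 2) * n + (3 * 2) ^ 8 * A * m ^ 2 * n := by gcongr
    _ = _ := by ring

theorem numDist_pos {P : Finset (ℝ × ℝ)} (h : 0 < P.card) : 0 < numDist P := by
  obtain ⟨x, hx⟩ := Finset.card_pos.1 h
  exact Finset.card_pos.2 (((Finset.Nonempty.product ⟨x, hx⟩ ⟨x, hx⟩)).image _)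

theorem card_le_mul_numDist_of_card_le {S P : Finset (ℝ × ℝ)} {A K : ℕ} (hS : S.card ≤ K)
    (h : P.card ^ 7 ≤ A * S.card ^ 8) : P.card ≤ A * K ^ 8 * numDist P := by
  rcases Nat.eq_zero_or_pos P.card with h0 | hn
  · omega
  calc P.card ≤ P.card ^ 7 := Nat.le_self_pow (by norm_num) _
    _ ≤ A * S.card ^ 8 := h
    _ ≤ A * K ^ 8 := by gcongr
    _ ≤ A * K ^ 8 * numDist P := Nat.le_mul_of_pos_right _ (numDist_pos hn)

theorem card_le_mul_numDist_of_circle (A : ℕ) :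
    ∃ C : ℕ, ∀ (o : ℝ × ℝ) (R : ℝ) (S P : Finset (ℝ × ℝ)), S ⊆ P → (∀ s ∈ S, dsq s o = R) →
      P.card ^ 7 ≤ A * S.card ^ 8 → P.card ≤ C * numDist P := by
  classical
  obtain ⟨C, hC⟩ := card_le_mul_numDist_of_originCircle A
  refine ⟨C + A * 1 ^ 8, fun o R S P hSP hS h => ?_⟩
  rcases eq_or_ne R 0 with rfl | hR
  · have hcard : S.card ≤ 1 := Finset.card_le_one.2 fun x hx y hy =>
      (dsq_eq_zero_iff.1 (hS x hx)).trans (dsq_eq_zero_iff.1 (hS y hy)).symm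
    exact (card_le_mul_numDist_of_card_le hcard h).trans
      (Nat.mul_le_mul_right _ (Nat.le_add_left _ _))
  · have hT : ∀ x y : ℝ × ℝ, dsq (x - o) (y - o) = dsq x y := fun x y => by
      simp [dsq]
    have hinj := dsq_injective (T := fun x => x - o) hT
    have := hC R hR (S.image fun x => x - o) (P.image fun x => x - o)
      (Finset.image_subset_image hSP) (fun s hs => by
        obtain ⟨x, hx, rfl⟩ := Finset.mem_image.1 hs
        exact hS x hx) (by
          rw [Finset.card_image_of_injective _ hinj, Finset.card_image_of_injective _ hinj]
          exact h)
    rw [Finset.card_image_of_injective _ hinj, numDist_image hT] at this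
    exact this.trans (Nat.mul_le_mul_right _ (Nat.le_add_right _ _))

theorem card_le_of_forall_comparable {r : ℕ} {C : Finset (ℕ × ℕ)}
    (hr : ∀ z ∈ C, z.1 < r ∧ z.2 < r)
    (h : ∀ z ∈ C, ∀ w ∈ C, z.1 ≤ w.1 ∧ z.2 ≤ w.2 ∨ w.1 ≤ z.1 ∧ w.2 ≤ z.2) : C.card ≤ 2 * r := by
  rw [← Finset.card_range (2 * r)]
  refine Finset.card_le_card_of_injOn (fun z => z.1 + z.2) (fun z hz => ?_) fun z hz w hw hzw => ?_
  · have := hr z hz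
    simp only [Finset.coe_range, Set.mem_Iio]
    omega
  · have := h z hz w hw
    have hzw : z.1 + z.2 = w.1 + w.2 := hzw
    exact Prod.ext (by omega) (by omega)

theorem card_le_of_forall_anticomparable {r : ℕ} {C : Finset (ℕ × ℕ)}
    (hr : ∀ z ∈ C, z.1 < r ∧ z.2 < r)
    (h : ∀ z ∈ C, ∀ w ∈ C, z.1 ≤ w.1 ∧ w.2 ≤ z.2 ∨ w.1 ≤ z.1 ∧ z.2 ≤ w.2) : C.card ≤ 2 * r := by
  rw [← Finset.card_range (2 * r)]
  refine Finset.card_le_card_of_injOn (fun z => z.1 + (r - z.2)) (fun z hz => ?_)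
    fun z hz w hw hzw => ?_
  · have := hr z hz
    simp only [Finset.coe_range, Set.mem_Iio]
    omega
  · have := h z hz w hw
    have := hr z hz
    have := hr w hw
    have hzw : z.1 + (r - z.2) = w.1 + (r - w.2) := hzw
    exact Prod.ext (by omega) (by omega)

open Classical in
/-- A parabola with vertical axis meets linearly many cells of a grid. -/
theorem card_cells_parabola_le (U V : Finset ℝ) {b₁ b₂ : ℝ → ℕ} (h₁ : Monotone b₁)
    (h₂ : Monotone b₂) (r : ℕ) (w h : ℝ) :
    ((Finset.range r ×ˢ Finset.range r).filter fun z =>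
      ∃ x ∈ U, ∃ y ∈ V, b₁ x = z.1 ∧ b₂ y = z.2 ∧ y = (x + w) ^ 2 + h).card ≤ 4 * r := by
  set C₁ := (Finset.range r ×ˢ Finset.range r).filter fun z =>
    ∃ x : ℝ, 0 ≤ x + w ∧ b₁ x = z.1 ∧ b₂ ((x + w) ^ 2 + h) = z.2
  set C₂ := (Finset.range r ×ˢ Finset.range r).filter fun z =>
    ∃ x : ℝ, x + w ≤ 0 ∧ b₁ x = z.1 ∧ b₂ ((x + w) ^ 2 + h) = z.2
  have hsub : ((Finset.range r ×ˢ Finset.range r).filter fun z =>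
      ∃ x ∈ U, ∃ y ∈ V, b₁ x = z.1 ∧ b₂ y = z.2 ∧ y = (x + w) ^ 2 + h) ⊆ C₁ ∪ C₂ := by
    intro z hz
    obtain ⟨hz, x, -, y, -, e1, e2, rfl⟩ := Finset.mem_filter.1 hz
    rcases le_total 0 (x + w) with h0 | h0
    · exact Finset.mem_union_left _ (Finset.mem_filter.2 ⟨hz, x, h0, e1, e2⟩)
    · exact Finset.mem_union_right _ (Finset.mem_filter.2 ⟨hz, x, h0, e1, e2⟩)
  have hC₁ : C₁.card ≤ 2 * r := by
    refine card_le_of_forall_comparable (fun z hz => ?_) fun z hz z' hz' => ?_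
    · have := (Finset.mem_filter.1 hz).1
      rwa [Finset.mem_product, Finset.mem_range, Finset.mem_range] at this
    · obtain ⟨-, x, h0, e1, e2⟩ := Finset.mem_filter.1 hz
      obtain ⟨-, x', h0', e1', e2'⟩ := Finset.mem_filter.1 hz'
      rw [← e1, ← e2, ← e1', ← e2']
      rcases le_total x x' with hx | hx
      · exact Or.inl ⟨h₁ hx, h₂ (by nlinarith)⟩
      · exact Or.inr ⟨h₁ hx, h₂ (by nlinarith)⟩
  have hC₂ : C₂.card ≤ 2 * r := by
    refine card_le_of_forall_anticomparable (fun z hz => ?_) fun z hz z' hz' => ?_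
    · have := (Finset.mem_filter.1 hz).1
      rwa [Finset.mem_product, Finset.mem_range, Finset.mem_range] at this
    · obtain ⟨-, x, h0, e1, e2⟩ := Finset.mem_filter.1 hz
      obtain ⟨-, x', h0', e1', e2'⟩ := Finset.mem_filter.1 hz'
      rw [← e1, ← e2, ← e1', ← e2']
      rcases le_total x x' with hx | hx
      · exact Or.inl ⟨h₁ hx, h₂ (by nlinarith)⟩
      · exact Or.inr ⟨h₁ hx, h₂ (by nlinarith)⟩
  have := (Finset.card_le_card hsub).trans (Finset.card_union_le _ _)
  omega

open Classical in
theorem sum_card_parabola_le (U V : Finset ℝ) (Γ : Finset (ℝ × ℝ)) {r : ℕ} (hr : 0 < r) :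
    ∑ c ∈ Γ, ((U ×ˢ V).filter fun z => z.2 = (z.1 + c.1) ^ 2 + c.2).card ≤
      1 * (4 * r) * Γ.card + 1 * (r ^ 2 * ((U.card / r + 1) * (V.card / r + 1)) ^ 2) := by
  obtain ⟨b₁, h₁, hb₁, hB₁⟩ := exists_monotone_blocks U r hr
  obtain ⟨b₂, h₂, hb₂, hB₂⟩ := exists_monotone_blocks V r hr
  refine sum_incidences_le (k := 1) U V b₁ b₂ Γ (fun c x y => y = (x + c.1) ^ 2 + c.2)
    (fun τ => (τ 0).1 ≠ (τ 1).1) hb₁ hb₂ hB₁ hB₂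
    (fun c _ => card_cells_parabola_le U V h₁ h₂ r c.1 c.2) ?_ ?_
  · intro c _ X _ hX hcard
    obtain ⟨x, hx, y, hy, hxy⟩ := Finset.one_lt_card.1 hcard
    refine ⟨![x, y], fun h => hxy (Prod.ext h ?_), fun i => ?_⟩
    · have h : x.1 = y.1 := h
      rw [hX x hx, hX y hy, h]
    · fin_cases i <;> assumption
  · intro τ hτ
    refine Finset.card_le_one.2 fun c hc c' hc' => ?_
    have h0 := (Finset.mem_filter.1 hc).2 0
    have h1 := (Finset.mem_filter.1 hc).2 1
    have h0' := (Finset.mem_filter.1 hc').2 0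
    have h1' := (Finset.mem_filter.1 hc').2 1
    have e : c.1 = c'.1 := by
      refine sub_eq_zero.1 ((mul_eq_zero.1 ?_).resolve_left (sub_ne_zero.2 hτ))
      linear_combination (-h0 + h1 + h0' - h1') / 2
    refine Prod.ext e ?_
    rw [e] at h0
    linear_combination h0' - h0

/-- The horizontal axis. -/
def xAxis : Set (ℝ × ℝ) := {z | z.2 = 0}

theorem encard_xAxis_inter_circle_le (p : ℝ × ℝ) (ρ : ℝ) :
    {z ∈ xAxis | dsq z p = ρ}.encard ≤ (2 : ℕ) := by
  rcases Set.eq_empty_or_nonempty {z ∈ xAxis | dsq z p = ρ} with h0 | ⟨x, hx⟩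
  · rw [h0]
    simp
  refine (Set.encard_le_encard (t := {x, (2 * p.1 - x.1, 0)}) fun y hy => ?_).trans
    ((Set.encard_insert_le _ _).trans (by rw [Set.encard_singleton, one_add_one_eq_two]; rfl))
  obtain ⟨hx1, hx2⟩ := hx
  obtain ⟨hy1, hy2⟩ := hy
  have hx1 : x.2 = 0 := hx1
  have hy1 : y.2 = 0 := hy1
  simp only [dsq, hx1, hy1] at hx2 hy2
  have : (y.1 - x.1) * (y.1 - (2 * p.1 - x.1)) = 0 := by linear_combination hy2 - hx2
  rcases mul_eq_zero.1 this with h | h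
  · exact Or.inl (Prod.ext (by linarith) (by rw [hx1, hy1]))
  · exact Or.inr (Prod.ext (by linarith) hy1)

theorem admissibleCentre_xAxis (p : ℝ × ℝ) : AdmissibleCentre xAxis 2 p := by
  refine ⟨⟨{(p.1, 0)}, ?_, fun z hz hzE => ?_⟩, encard_xAxis_inter_circle_le p⟩
  · rw [Set.encard_singleton]
    norm_num
  · refine locallyOntoAt_of_hasFDerivAt (F := Prod.snd) continuous_snd hasFDerivAt_snd hz ?_
    intro h0
    refine hzE (Prod.ext ?_ hz)
    simpa [sub_eq_zero] using h0

open Classical in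
theorem card_le_numDist_of_xAxis {S : Finset (ℝ × ℝ)} (hS : ∀ s ∈ S, s ∈ xAxis) :
    S.card ≤ numDist S := by
  rcases S.eq_empty_or_nonempty with rfl | hne
  · simp
  obtain ⟨x, hx, hmin⟩ := S.exists_min_image Prod.fst hne
  refine Finset.card_le_card_of_injOn (fun s => dsq s x) (fun s hs => ?_) fun s hs t ht hst => ?_
  · exact Finset.mem_coe.2 (Finset.mem_image.2 ⟨(s, x), Finset.mem_product.2 ⟨hs, hx⟩, rfl⟩)
  · have hs2 : s.2 = 0 := hS s hs
    have ht2 : t.2 = 0 := hS t ht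
    have h1 := hmin s hs
    have h2 := hmin t ht
    simp only [dsq, hs2, ht2, add_left_inj] at hst
    refine Prod.ext ?_ (hs2.trans ht2.symm)
    have := (pow_left_inj₀ (sub_nonneg.2 h1) (sub_nonneg.2 h2) two_ne_zero).1 hst
    linarith

open Classical in
theorem card_vertical_mul_le {S P : Finset (ℝ × ℝ)} (hSP : S ⊆ P) (hS : ∀ s ∈ S, s ∈ xAxis)
    (hm : 8 ≤ S.card) (c : ℝ) :
    (P.filter fun p => p.1 = c).card * S.card ^ 4 ≤ 2 * (72 * 16 ^ 2) * numDist P ^ 4 := by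
  set m := S.card
  set Δ := numDist P with hΔ
  have hmΔ : m ≤ Δ := (card_le_numDist_of_xAxis hS).trans (numDist_mono hSP)
  have hmem : ∀ p ∈ P, ∀ q ∈ P, dsq p q ∈ (P ×ˢ P).image fun z => dsq z.1 z.2 := fun p hp q hq =>
    Finset.mem_image.2 ⟨(p, q), Finset.mem_product.2 ⟨hp, hq⟩, rfl⟩
  set V := (P ×ˢ P).image fun z => dsq z.1 z.2
  set U := (S ×ˢ S).image fun z => z.1.1 - z.2.1
  set Y := (P.filter fun p => p.1 = c).image fun p => p.2 ^ 2
  have hV : V.card = Δ := rfl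
  have hU : U.card ≤ 2 * Δ := by
    have hsub : U.image (fun u => u ^ 2) ⊆ V := by
      intro v hv
      obtain ⟨u, hu, rfl⟩ := Finset.mem_image.1 hv
      obtain ⟨z, hz, rfl⟩ := Finset.mem_image.1 hu
      rw [Finset.mem_product] at hz
      have h1 : z.1.2 = 0 := hS _ hz.1
      have h2 : z.2.2 = 0 := hS _ hz.2
      have := hmem _ (hSP hz.1) _ (hSP hz.2)
      rw [dsq, h1, h2] at this
      simpa using this
    refine (Finset.card_le_mul_card_image (f := fun u => u ^ 2) U 2 fun v _ => ?_).trans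
      (Nat.mul_le_mul_left _ (Finset.card_le_card hsub))
    refine (Finset.card_le_card (t := {√v, -√v}) fun u hu => ?_).trans Finset.card_le_two
    rw [Finset.mem_insert, Finset.mem_singleton]
    have hu := (Finset.mem_filter.1 hu).2
    rw [← hu, Real.sqrt_sq_eq_abs]
    rcases abs_choice u with h | h
    · exact Or.inl h.symm
    · exact Or.inr (by rw [h, neg_neg])
  have hY : (P.filter fun p => p.1 = c).card ≤ 2 * Y.card := by
    refine Finset.card_le_mul_card_image _ 2 fun v _ => ?_
    refine (Finset.card_le_card (t := {(c, √v), (c, -√v)}) fun p hp => ?_).trans Finset.card_le_two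
    rw [Finset.mem_insert, Finset.mem_singleton]
    obtain ⟨hp, hv⟩ := Finset.mem_filter.1 hp
    obtain ⟨-, hp⟩ := Finset.mem_filter.1 hp
    rw [← hv, Real.sqrt_sq_eq_abs]
    rcases abs_choice p.2 with h | h
    · exact Or.inl (Prod.ext hp h.symm)
    · exact Or.inr (Prod.ext hp (by rw [h, neg_neg]))
  set Γ := (S ×ˢ Y).image fun z => (z.1.1 - c, z.2) with hΓ
  have hΓcard : Γ.card = m * Y.card := by
    rw [hΓ, Finset.card_image_of_injOn, Finset.card_product]
    rintro ⟨s, y⟩ hs ⟨t, y'⟩ ht hst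
    simp only [Prod.mk.injEq, sub_left_inj] at hst
    simp only [Finset.coe_product, Set.mem_prod, Finset.mem_coe] at hs ht
    exact Prod.ext (Prod.ext hst.1 ((hS s hs.1).trans (hS t ht.1).symm)) hst.2
  set r := m / 8
  have hr : 0 < r := Nat.div_pos hm (by norm_num)
  have hr8 : 8 * r ≤ m := Nat.mul_div_le m 8
  have hr16 : m ≤ 16 * r := by omega
  have hsum := sum_card_parabola_le U V Γ hr
  have hlow : m * Γ.card ≤
      ∑ c ∈ Γ, ((U ×ˢ V).filter fun z => z.2 = (z.1 + c.1) ^ 2 + c.2).card := by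
    rw [mul_comm, ← smul_eq_mul]
    refine Finset.card_nsmul_le_sum _ _ _ fun g hg => ?_
    obtain ⟨⟨s, y⟩, hsy, rfl⟩ := Finset.mem_image.1 hg
    obtain ⟨hs, hy⟩ := Finset.mem_product.1 hsy
    obtain ⟨p, hp, hpy⟩ := Finset.mem_image.1 hy
    obtain ⟨hp, hpc⟩ := Finset.mem_filter.1 hp
    refine Finset.card_le_card_of_injOn (fun x => (x.1 - s.1, dsq x p)) (fun x hx => ?_)
      fun x hx x' hx' hxx => ?_
    · refine Finset.mem_coe.2 (Finset.mem_filter.2 ⟨Finset.mem_product.2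
        ⟨Finset.mem_image.2 ⟨(x, s), Finset.mem_product.2 ⟨hx, hs⟩, rfl⟩, hmem _ (hSP hx) _ hp⟩,
        ?_⟩)
      have hx2 : x.2 = 0 := hS x hx
      have hpy : p.2 ^ 2 = y := hpy
      simp only [dsq, hx2, ← hpy, hpc]
      ring
    · simp only [Prod.mk.injEq, sub_left_inj] at hxx
      exact Prod.ext hxx.1 ((hS x hx).trans (hS x' hx').symm)
  set k := Y.card
  rw [hΓcard] at hsum hlow
  have hmain : m ^ 2 * k ≤ 2 * (r ^ 2 * ((U.card / r + 1) * (V.card / r + 1)) ^ 2) := by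
    have h1 := hlow.trans hsum
    have h2 : 8 * r * (m * k) ≤ m * (m * k) := Nat.mul_le_mul_right _ hr8
    nlinarith
  have hUr : (U.card / r + 1) * r ≤ 3 * Δ := by
    have := Nat.div_mul_le_self U.card r
    nlinarith
  have hVr : (V.card / r + 1) * r ≤ 2 * Δ := by
    have := Nat.div_mul_le_self V.card r
    nlinarith
  have hkey : m ^ 2 * k * r ^ 2 ≤ 72 * Δ ^ 4 := by
    refine Nat.le_of_mul_le_mul_right (c := r ^ 2) ?_ (by positivity)
    calc m ^ 2 * k * r ^ 2 * r ^ 2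
        ≤ 2 * (r ^ 2 * ((U.card / r + 1) * (V.card / r + 1)) ^ 2) * r ^ 2 * r ^ 2 := by gcongr
      _ = 2 * (((U.card / r + 1) * r) ^ 2 * ((V.card / r + 1) * r) ^ 2) * r ^ 2 := by ring
      _ ≤ 2 * ((3 * Δ) ^ 2 * (2 * Δ) ^ 2) * r ^ 2 := by
        refine Nat.mul_le_mul_right _ (Nat.mul_le_mul_left _ (Nat.mul_le_mul ?_ ?_))
        · exact Nat.pow_le_pow_left hUr 2
        · exact Nat.pow_le_pow_left hVr 2
      _ = 72 * Δ ^ 4 * r ^ 2 := by ring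
  calc (P.filter fun p => p.1 = c).card * m ^ 4 ≤ 2 * k * m ^ 4 := Nat.mul_le_mul_right _ hY
    _ = 2 * (m ^ 2 * k * m ^ 2) := by ring
    _ ≤ 2 * (m ^ 2 * k * (16 * r) ^ 2) := by gcongr
    _ = 2 * 16 ^ 2 * (m ^ 2 * k * r ^ 2) := by ring
    _ ≤ 2 * 16 ^ 2 * (72 * Δ ^ 4) := by gcongr
    _ = _ := by ring

theorem triDet_ne_zero_of_hyperbola {x y z : ℝ × ℝ} {c : ℝ} (hc : c ≠ 0)
    (hx : (x.1 - x.2) * (x.1 + x.2) = c) (hy : (y.1 - y.2) * (y.1 + y.2) = c)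
    (hz : (z.1 - z.2) * (z.1 + z.2) = c) (hxy : x ≠ y) (hxz : x ≠ z) (hyz : y ≠ z) :
    triDet x y z ≠ 0 := by
  have key : ∀ v w : ℝ × ℝ, (v.1 - v.2) * (v.1 + v.2) = c → (w.1 - w.2) * (w.1 + w.2) = c →
      v ≠ w → (v.1 - v.2) - (w.1 - w.2) ≠ 0 := by
    intro v w hv hw hvw h
    have h0 : v.1 - v.2 ≠ 0 := fun h0 => hc (by rw [← hv, h0, zero_mul])
    have h1 : w.1 - w.2 = v.1 - v.2 := by linarith
    rw [h1] at hw
    have h2 := mul_left_cancel₀ h0 (hv.trans hw.symm)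
    exact hvw (Prod.ext (by linarith) (by linarith))
  intro h
  refine mul_ne_zero hc (mul_ne_zero (key y x hy hx hxy.symm)
    (mul_ne_zero (key z x hz hx hxz.symm) (key z y hz hy hyz.symm))) ?_
  rw [triDet] at h
  linear_combination (2 * (x.1 - x.2) * (y.1 - y.2) * (z.1 - z.2)) * h
    - ((y.1 - y.2) - (x.1 - x.2)) * (x.1 - x.2) * (y.1 - y.2) * hz
    + ((y.1 - y.2) - (x.1 - x.2)) * (y.1 - y.2) * (z.1 - z.2) * hx
    + ((z.1 - z.2) - (x.1 - x.2)) * (x.1 - x.2) * (z.1 - z.2) * hy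
    - ((z.1 - z.2) - (x.1 - x.2)) * (y.1 - y.2) * (z.1 - z.2) * hx

open Classical in
theorem sum_card_isodistantPairs_le_of_xAxis {S P : Finset (ℝ × ℝ)} {k : ℕ}
    (hS : ∀ s ∈ S, s ∈ xAxis) (hk : ∀ c, (P.filter fun p => p.1 = c).card ≤ k) {r : ℕ}
    (hr : 0 < r) :
    ∑ c ∈ P ×ˢ P, (isodistantPairs S c.1 c.2).card ≤
      4 * S.card ^ 2 * P.card + 2 * (6 * r * 2 ^ 2) * P.card ^ 2 +
        2 * k * (r ^ 2 * ((2 * (S.card / r + 1)) * (2 * (S.card / r + 1))) ^ 3) := by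
  set D : (ℝ × ℝ) × (ℝ × ℝ) → Prop := fun c => c.1.2 ^ 2 = c.2.2 ^ 2
  rw [← Finset.sum_filter_add_sum_filter_not _ D]
  have hD : ∑ c ∈ (P ×ˢ P).filter D, (isodistantPairs S c.1 c.2).card ≤
      4 * S.card ^ 2 * P.card := by
    refine sum_card_isodistantPairs_le_of_fiber S P _ (Finset.filter_subset _ _) 4
      fun s hs t ht p hp => ?_
    have hs2 : s.2 = 0 := hS s hs
    have ht2 : t.2 = 0 := hS t ht
    refine (Finset.card_le_card (t := {t.1 + (s.1 - p.1), t.1 - (s.1 - p.1)} ×ˢ {p.2, -p.2})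
      fun q hq => ?_).trans ?_
    · simp only [Finset.mem_filter] at hq
      obtain ⟨-, ⟨-, hq1⟩, hq2⟩ := hq
      have hq1 : p.2 ^ 2 = q.2 ^ 2 := hq1
      simp only [dsq, hs2, ht2] at hq2
      have h1 : (q.1 - t.1) ^ 2 = (s.1 - p.1) ^ 2 := by linear_combination -hq2 + hq1
      simp only [Finset.mem_product, Finset.mem_insert, Finset.mem_singleton]
      refine ⟨?_, sq_eq_sq_iff_eq_or_eq_neg.1 hq1.symm⟩
      rcases sq_eq_sq_iff_eq_or_eq_neg.1 h1 with h | h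
      · exact Or.inl (by linarith)
      · exact Or.inr (by linarith)
    · rw [Finset.card_product]
      exact Nat.mul_le_mul Finset.card_le_two Finset.card_le_two
  have hG := sum_card_isodistantPairs_le (k := 2) (κ := 2) (L := 2) (t := 2 * k) hr
    (Z := xAxis) (isClosed_eq continuous_snd continuous_const)
    (fun c => by
      refine (Set.encard_le_encard (t := {(c, 0)}) fun z hz => Prod.ext hz.2 hz.1).trans ?_
      rw [Set.encard_singleton]
      norm_num)
    S hS ((P ×ˢ P).filter fun c => ¬ D c)
    (fun c _ => ⟨admissibleCentre_xAxis _, admissibleCentre_xAxis _⟩)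
    (fun τ => triDet ((τ 0).1.1, (τ 0).2.1) ((τ 1).1.1, (τ 1).2.1) ((τ 2).1.1, (τ 2).2.1) ≠ 0 ∧
      ∀ i, (τ i).1 ∈ xAxis ∧ (τ i).2 ∈ xAxis)
    (fun c hc X hX hiso hcard => by
      have hXZ : ∀ z ∈ X, z.1.2 = 0 ∧ z.2.2 = 0 := fun z hz =>
        ⟨hS _ (Finset.mem_product.1 (hX hz)).1, hS _ (Finset.mem_product.1 (hX hz)).2⟩
      have hcD : c.2.2 ^ 2 - c.1.2 ^ 2 ≠ 0 := fun h =>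
        (Finset.mem_filter.1 hc).2 (sub_eq_zero.1 h).symm
      obtain ⟨x, hx, y, hy, z, hz, hxy, hxz, hyz⟩ := Finset.two_lt_card.1 hcard
      have hcurve : ∀ w ∈ X, ((w.1.1 - c.1.1, w.2.1 - c.2.1).1 - (w.1.1 - c.1.1, w.2.1 - c.2.1).2) *
          ((w.1.1 - c.1.1, w.2.1 - c.2.1).1 + (w.1.1 - c.1.1, w.2.1 - c.2.1).2) =
            c.2.2 ^ 2 - c.1.2 ^ 2 := fun w hw => by
        have := hiso w hw
        simp only [dsq, (hXZ w hw).1, (hXZ w hw).2] at this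
        linear_combination this
      have hne : ∀ v ∈ X, ∀ w ∈ X, v ≠ w →
          (v.1.1 - c.1.1, v.2.1 - c.2.1) ≠ (w.1.1 - c.1.1, w.2.1 - c.2.1) := by
        intro v hv w hw hvw h
        simp only [Prod.mk.injEq, sub_left_inj] at h
        exact hvw (Prod.ext (Prod.ext h.1 ((hXZ v hv).1.trans (hXZ w hw).1.symm))
          (Prod.ext h.2 ((hXZ v hv).2.trans (hXZ w hw).2.symm)))
      have hdet := triDet_ne_zero_of_hyperbola hcD (hcurve x hx) (hcurve y hy) (hcurve z hz)
        (hne x hx y hy hxy) (hne x hx z hz hxz) (hne y hy z hz hyz)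
      have hτ : ∀ i, ![x, y, z] i ∈ X := by
        intro i
        fin_cases i <;> assumption
      refine ⟨![x, y, z], ⟨fun h => hdet ?_, fun i => hXZ _ (hτ i)⟩, hτ⟩
      simp only [triDet, Matrix.cons_val] at h ⊢
      linear_combination h)
    (fun τ hτ => by
      obtain ⟨hdet, hτZ⟩ := hτ
      rcases Finset.eq_empty_or_nonempty (((P ×ˢ P).filter fun c => ¬ D c).filter fun c =>
        ∀ i, dsq (τ i).1 c.1 = dsq (τ i).2 c.2) with h0 | ⟨c₀, hc₀⟩
      · rw [h0]
        exact Nat.zero_le _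
      have hc₀ := (Finset.mem_filter.1 hc₀).2
      have key : ∀ c ∈ ((P ×ˢ P).filter fun c => ¬ D c).filter fun c =>
          ∀ i, dsq (τ i).1 c.1 = dsq (τ i).2 c.2, c.1.1 = c₀.1.1 ∧ c.2.1 = c₀.2.1 ∧
            c.1.2 ^ 2 - c.2.2 ^ 2 = c₀.1.2 ^ 2 - c₀.2.2 ^ 2 := by
        intro c hc
        have hc := (Finset.mem_filter.1 hc).2
        have hlin : ∀ i, -2 * (c.1.1 - c₀.1.1) * (τ i).1.1 + 2 * (c.2.1 - c₀.2.1) * (τ i).2.1 +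
            (c.1.1 ^ 2 + c.1.2 ^ 2 - c.2.1 ^ 2 - c.2.2 ^ 2 -
              (c₀.1.1 ^ 2 + c₀.1.2 ^ 2 - c₀.2.1 ^ 2 - c₀.2.2 ^ 2)) = 0 := fun i => by
          have h1 := hc i
          have h2 := hc₀ i
          have e1 : (τ i).1.2 = 0 := (hτZ i).1
          have e2 : (τ i).2.2 = 0 := (hτZ i).2
          simp only [dsq, e1, e2] at h1 h2
          linear_combination h1 - h2
        obtain ⟨ha, hb, he⟩ := coeff_eq_zero_of_triDet_ne_zero hdet (hlin 0) (hlin 1) (hlin 2)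
        have ha : c.1.1 = c₀.1.1 := by linarith
        have hb : c.2.1 = c₀.2.1 := by linarith
        refine ⟨ha, hb, ?_⟩
        rw [ha, hb] at he
        linear_combination he
      refine (Finset.card_le_mul_card_image (f := Prod.fst) _ 2 fun p _ => ?_).trans
        (Nat.mul_le_mul_left _ ((Finset.card_le_card fun p hp => ?_).trans (hk c₀.1.1)))
      · rw [← Finset.card_image_of_injOn (f := Prod.snd)]
        · set e := √(p.2 ^ 2 - (c₀.1.2 ^ 2 - c₀.2.2 ^ 2))
          refine (Finset.card_le_card (t := {(c₀.2.1, e), (c₀.2.1, -e)}) fun q hq => ?_).trans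
            Finset.card_le_two
          obtain ⟨c, hc, rfl⟩ := Finset.mem_image.1 hq
          obtain ⟨hc', rfl⟩ := Finset.mem_filter.1 hc
          obtain ⟨-, h1, h2⟩ := key c hc'
          have : e = |c.2.2| := by
            rw [← Real.sqrt_sq_eq_abs]
            exact congrArg Real.sqrt (by linear_combination h2)
          rw [this, Finset.mem_insert, Finset.mem_singleton]
          rcases abs_choice c.2.2 with h | h
          · exact Or.inl (Prod.ext h1 h.symm)
          · exact Or.inr (Prod.ext h1 (by rw [h, neg_neg]))
        · intro c hc c' hc' hcc
          exact Prod.ext ((Finset.mem_filter.1 hc).2.trans (Finset.mem_filter.1 hc').2.symm) hcc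
      · obtain ⟨c, hc, rfl⟩ := Finset.mem_image.1 hp
        exact Finset.mem_filter.2 ⟨(Finset.mem_product.1 (Finset.mem_filter.1
          (Finset.mem_filter.1 hc).1).1).1, (key c hc).1⟩)
  have hcard : ((P ×ˢ P).filter fun c => ¬ D c).card ≤ P.card ^ 2 :=
    (Finset.card_filter_le _ _).trans (by rw [Finset.card_product, sq])
  refine (add_le_add hD (hG.trans (Nat.add_le_add_right
    (Nat.mul_le_mul_left (2 * (6 * r * 2 ^ 2)) hcard) _))).trans (le_of_eq ?_)
  ring

theorem card_le_mul_numDist_of_xAxis (A : ℕ) :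
    ∃ C : ℕ, ∀ S P : Finset (ℝ × ℝ), S ⊆ P → (∀ s ∈ S, s ∈ xAxis) →
      P.card ^ 7 ≤ A * S.card ^ 8 → P.card ≤ C * numDist P := by
  classical
  set C₁ := 2 * (72 * 16 ^ 2)
  refine ⟨1 + A * 7 ^ 8 + (4 + 48 * (1 + A) + 2 * 6 ^ 6 * (C₁ * A)), fun S P hSP hS h => ?_⟩
  rcases Nat.lt_or_ge S.card 8 with h8 | h8
  · exact (card_le_mul_numDist_of_card_le (Nat.le_of_lt_succ h8) h).trans
      (Nat.mul_le_mul_right _ (by omega))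
  rcases Nat.lt_or_ge P.card (numDist P) with hlt | hΔ
  · exact hlt.le.trans (Nat.le_mul_of_pos_left _ (by omega))
  have hmn := Finset.card_le_card hSP
  have hn : 0 < P.card := by omega
  obtain ⟨hm, hA, r, hr0, hr, hmr, hrn⟩ := exists_block_count hn hmn h
  set k := C₁ * numDist P ^ 4 / S.card ^ 4
  have hk : ∀ c, (P.filter fun p => p.1 = c).card ≤ k := fun c =>
    (Nat.le_div_iff_mul_le (by positivity)).2 (card_vertical_mul_le hSP hS h8 c)
  have hkm : k * S.card ^ 4 ≤ C₁ * numDist P ^ 4 := Nat.div_mul_le_self _ _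
  refine (le_mul_numDist_of_sum_le (C := 4 + 48 * (1 + A) + 2 * 6 ^ 6 * (C₁ * A)) hSP hm
    ((sum_card_isodistantPairs_le_of_xAxis hS hk hr0).trans ?_)).trans
    (Nat.mul_le_mul_right _ (Nat.le_add_left _ _))
  have hblock := block_size_mul_le 2 hr
  set T := r ^ 2 * ((2 * (S.card / r + 1)) * (2 * (S.card / r + 1))) ^ 3
  have hT : T * r ^ 4 ≤ 6 ^ 6 * S.card ^ 6 := by
    calc T * r ^ 4 = (2 * (S.card / r + 1) * r) ^ 6 := by ring
      _ ≤ (3 * 2 * S.card) ^ 6 := Nat.pow_le_pow_left hblock 6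
      _ = _ := by ring
  set n := P.card
  set m := S.card
  have hkn : k * n ^ 3 ≤ C₁ * A * m ^ 4 := by
    refine Nat.le_of_mul_le_mul_right (c := m ^ 4) ?_ (by positivity)
    calc k * n ^ 3 * m ^ 4 = k * m ^ 4 * n ^ 3 := by ring
      _ ≤ C₁ * n ^ 4 * n ^ 3 := by
        exact Nat.mul_le_mul_right _
          (hkm.trans (Nat.mul_le_mul_left _ (Nat.pow_le_pow_left hΔ 4)))
      _ = C₁ * n ^ 7 := by ring
      _ ≤ C₁ * (A * m ^ 8) := Nat.mul_le_mul_left _ h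
      _ = _ := by ring
  have hkT : k * T ≤ 6 ^ 6 * (C₁ * A) * m ^ 2 * n := by
    refine Nat.le_of_mul_le_mul_right (c := r ^ 4 * n ^ 4) ?_ (by positivity)
    calc k * T * (r ^ 4 * n ^ 4) = (k * n ^ 3) * (T * r ^ 4) * n := by ring
      _ ≤ (C₁ * A * m ^ 4) * (6 ^ 6 * m ^ 6) * n :=
        Nat.mul_le_mul_right _ (Nat.mul_le_mul hkn hT)
      _ = 6 ^ 6 * (C₁ * A) * m ^ 2 * n * (m ^ 2) ^ 4 := by ring
      _ ≤ 6 ^ 6 * (C₁ * A) * m ^ 2 * n * (r * n) ^ 4 :=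
        Nat.mul_le_mul_left _ (Nat.pow_le_pow_left hmr 4)
      _ = _ := by ring
  calc 4 * m ^ 2 * n + 2 * (6 * r * 2 ^ 2) * n ^ 2 + 2 * k * T
      = 4 * m ^ 2 * n + 48 * (r * n) * n + 2 * (k * T) := by ring
    _ ≤ 4 * m ^ 2 * n + 48 * ((1 + A) * m ^ 2) * n + 2 * (6 ^ 6 * (C₁ * A) * m ^ 2 * n) := by
      gcongr
    _ = _ := by ring

theorem card_le_mul_numDist_of_line (A : ℕ) :
    ∃ C : ℕ, ∀ a b c : ℝ, a ≠ 0 ∨ b ≠ 0 → ∀ S P : Finset (ℝ × ℝ), S ⊆ P →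
      (∀ s ∈ S, a * s.1 + b * s.2 + c = 0) →
      P.card ^ 7 ≤ A * S.card ^ 8 → P.card ≤ C * numDist P := by
  classical
  obtain ⟨C, hC⟩ := card_le_mul_numDist_of_xAxis A
  refine ⟨C, fun a b c hab S P hSP hS h => ?_⟩
  have hpos : 0 < a ^ 2 + b ^ 2 := by
    rcases hab with h | h <;> positivity
  set l := √(a ^ 2 + b ^ 2)
  have hl : l ≠ 0 := (Real.sqrt_pos.2 hpos).ne'
  have hl2 : l ^ 2 = a ^ 2 + b ^ 2 := Real.sq_sqrt hpos.le
  set T : ℝ × ℝ → ℝ × ℝ := fun s =>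
    ((b * s.1 - a * s.2) / l, (a * s.1 + b * s.2 + c) / l) with hTdef
  have hT : ∀ x y : ℝ × ℝ, dsq (T x) (T y) = dsq x y := fun x y => by
    simp only [dsq, hTdef]
    field_simp
    rw [hl2]
    ring
  have hinj := dsq_injective hT
  have := hC (S.image T) (P.image T) (Finset.image_subset_image hSP) (fun s hs => by
    obtain ⟨x, hx, rfl⟩ := Finset.mem_image.1 hs
    change (a * x.1 + b * x.2 + c) / l = 0
    rw [hS x hx, zero_div]) (by
      rw [Finset.card_image_of_injective _ hinj, Finset.card_image_of_injective _ hinj]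
      exact h)
  rwa [Finset.card_image_of_injective _ hinj, numDist_image hT] at this

theorem card_le_mul_numDist_of_irreducible (d A : ℕ) :
    ∃ C : ℕ, ∀ g : MvPolynomial (Fin 2) ℝ, Irreducible g → g.totalDegree ≤ d →
      ∀ S P : Finset (ℝ × ℝ), S ⊆ P → (∀ s ∈ S, evalAt g s = 0) →
        P.card ^ 7 ≤ A * S.card ^ 8 → P.card ≤ C * numDist P := by
  obtain ⟨C₁, h₁⟩ := card_le_mul_numDist_of_line A
  obtain ⟨C₂, h₂⟩ := card_le_mul_numDist_of_circle A
  obtain ⟨C₃, h₃⟩ := RigidCurve.card_le_mul_numDist (zeroBound d) A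
  refine ⟨C₁ + C₂ + C₃, fun g hg hd S P hSP hS h => ?_⟩
  by_cases hline : ∃ a b c, (a ≠ 0 ∨ b ≠ 0) ∧ g ∣ linPoly a b c
  · obtain ⟨a, b, c, hab, hdvd⟩ := hline
    refine (h₁ a b c hab S P hSP (fun s hs => ?_) h).trans (Nat.mul_le_mul_right _ (by omega))
    rw [← evalAt_linPoly]
    exact evalAt_eq_zero_of_dvd hdvd (hS s hs)
  by_cases hcirc : ∃ u v w, g ∣ quadPoly 1 0 1 u v w
  · obtain ⟨u, v, w, hdvd⟩ := hcirc
    refine (h₂ (-u / 2, -v / 2) (u ^ 2 / 4 + v ^ 2 / 4 - w) S P hSP (fun s hs => ?_) h).trans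
      (Nat.mul_le_mul_right _ (by omega))
    have := evalAt_eq_zero_of_dvd hdvd (hS s hs)
    rw [evalAt_quadPoly] at this
    rw [dsq]
    linear_combination this
  push Not at hline hcirc
  rcases S.eq_empty_or_nonempty with rfl | ⟨s, hs⟩
  · have := h₂ 0 0 ∅ P hSP (by simp) h
    exact this.trans (Nat.mul_le_mul_right _ (by omega))
  · exact (h₃ _ (rigidCurve_of_not_dvd hg hd hline hcirc (hS s hs)) S P hSP hS h).trans
      (Nat.mul_le_mul_right _ (by omega))

open Classical in
theorem card_filter_evalAt_le (P : Finset (ℝ × ℝ)) {d M : ℕ}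
    (h : ∀ g : MvPolynomial (Fin 2) ℝ, Irreducible g → g.totalDegree ≤ d →
      (P.filter fun s => evalAt g s = 0).card ≤ M) (f : MvPolynomial (Fin 2) ℝ) (hf : f ≠ 0)
    (hd : f.totalDegree ≤ d) :
    (P.filter fun s => evalAt f s = 0).card ≤ f.totalDegree * M := by
  induction f using WfDvdMonoid.induction_on_irreducible with
  | zero => exact absurd rfl hf
  | unit u hu =>
    have : (P.filter fun s => evalAt u s = 0) = ∅ := by
      refine Finset.filter_eq_empty_iff.2 fun s _ hs => ?_
      have := hu.map (MvPolynomial.eval ![s.1, s.2])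
      rw [show MvPolynomial.eval ![s.1, s.2] u = 0 from hs] at this
      exact not_isUnit_zero this
    rw [this]
    exact Nat.zero_le _
  | mul f g hf0 hg ih =>
    rw [MvPolynomial.totalDegree_mul_of_isDomain hg.ne_zero hf0] at hd ⊢
    have h1 := ih hf0 (by omega)
    have h2 := h g hg (by omega)
    have hpos := totalDegree_pos_of_irreducible hg
    have hsub : (P.filter fun s => evalAt (g * f) s = 0) ⊆
        (P.filter fun s => evalAt g s = 0) ∪ (P.filter fun s => evalAt f s = 0) := by
      intro s hs
      rw [← Finset.filter_or]
      simpa [evalAt_mul] using hs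
    calc _ ≤ _ := (Finset.card_le_card hsub).trans (Finset.card_union_le _ _)
      _ ≤ 1 * M + f.totalDegree * M := by rw [one_mul]; exact add_le_add h2 h1
      _ ≤ g.totalDegree * M + f.totalDegree * M := by gcongr; exact hpos
      _ = _ := (add_mul _ _ _).symm

open Classical in
theorem exists_irreducible_card_filter_le (P : Finset (ℝ × ℝ)) {d : ℕ} (hd : 1 ≤ d)
    {f : MvPolynomial (Fin 2) ℝ} (hf : f ≠ 0) (hfd : f.totalDegree ≤ d)
    (hpos : 0 < (P.filter fun s => evalAt f s = 0).card) :
    ∃ g : MvPolynomial (Fin 2) ℝ, Irreducible g ∧ g.totalDegree ≤ d ∧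
      (P.filter fun s => evalAt f s = 0).card ≤ d * (P.filter fun s => evalAt g s = 0).card := by
  by_contra! H
  set m := (P.filter fun s => evalAt f s = 0).card
  have h1 := card_filter_evalAt_le P (M := (m - 1) / d) (fun g hg hgd => by
    rw [Nat.le_div_iff_mul_le hd, mul_comm]
    exact Nat.le_sub_one_of_lt (H g hg hgd)) f hf hfd
  have h2 : f.totalDegree * ((m - 1) / d) ≤ m - 1 :=
    (Nat.mul_le_mul_right _ hfd).trans (Nat.mul_div_le _ _)
  change m ≤ _ at h1
  omega

theorem card_le_mul_numDist_of_evalAt (d A : ℕ) (hd : 1 ≤ d) :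
    ∃ C : ℕ, ∀ f : MvPolynomial (Fin 2) ℝ, f ≠ 0 → f.totalDegree ≤ d →
      ∀ S P : Finset (ℝ × ℝ), S ⊆ P → (∀ s ∈ S, evalAt f s = 0) →
        P.card ^ 7 ≤ A * S.card ^ 8 → P.card ≤ C * numDist P := by
  classical
  obtain ⟨C, hC⟩ := card_le_mul_numDist_of_irreducible d (A * d ^ 8)
  refine ⟨C, fun f hf hfd S P hSP hS h => ?_⟩
  rcases Nat.eq_zero_or_pos P.card with h0 | hn
  · omega
  have hm := (exists_block_count hn (Finset.card_le_card hSP) h).1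
  have hSf : S.card ≤ (P.filter fun s => evalAt f s = 0).card :=
    Finset.card_le_card fun s hs => Finset.mem_filter.2 ⟨hSP hs, hS s hs⟩
  obtain ⟨g, hg, hgd, hfg⟩ := exists_irreducible_card_filter_le P hd hf hfd (hm.trans_le hSf)
  refine hC g hg hgd _ P (Finset.filter_subset _ _) (fun s hs => (Finset.mem_filter.1 hs).2) ?_
  calc P.card ^ 7 ≤ A * S.card ^ 8 := h
    _ ≤ A * (d * (P.filter fun s => evalAt g s = 0).card) ^ 8 :=
      Nat.mul_le_mul_left _ (Nat.pow_le_pow_left (hSf.trans hfg) 8)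
    _ = _ := by ring

theorem pow_seven_le_of_rpow_le {a : ℝ} (ha : 0 < a) {n m : ℕ}
    (h : a * (n : ℝ) ^ ((7 : ℝ) / 8) ≤ m) : n ^ 7 ≤ ⌈(1 / a) ^ 8⌉₊ * m ^ 8 := by
  have h1 : ((n : ℝ) ^ ((7 : ℝ) / 8)) ^ 8 = (n : ℝ) ^ 7 := by
    rw [← Real.rpow_natCast, ← Real.rpow_mul (Nat.cast_nonneg n), ← Real.rpow_natCast]
    norm_num
  have h2 : (n : ℝ) ^ ((7 : ℝ) / 8) ≤ 1 / a * m := by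
    rw [one_div, ← div_eq_inv_mul, le_div_iff₀ ha, mul_comm]
    exact h
  have h3 : (n : ℝ) ^ 7 ≤ ⌈(1 / a) ^ 8⌉₊ * (m : ℝ) ^ 8 := by
    rw [← h1]
    calc _ ≤ (1 / a * m) ^ 8 := pow_le_pow_left₀ (by positivity) h2 8
      _ = (1 / a) ^ 8 * (m : ℝ) ^ 8 := mul_pow _ _ _
      _ ≤ _ := by gcongr; exact Nat.le_ceil _
  exact_mod_cast h3

/-- The coordinates of a point of the Euclidean plane. -/
def planeCoords (x : EuclideanSpace ℝ (Fin 2)) : ℝ × ℝ := (x 0, x 1)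

theorem planeCoords_injective : Function.Injective planeCoords := fun x y h => by
  ext i
  fin_cases i
  · exact congrArg Prod.fst h
  · exact congrArg Prod.snd h

theorem dsq_planeCoords (x y : EuclideanSpace ℝ (Fin 2)) :
    dsq (planeCoords x) (planeCoords y) = dist x y ^ 2 := by
  rw [EuclideanSpace.dist_eq, Real.sq_sqrt (by positivity), Fin.sum_univ_two, Real.dist_eq,
    Real.dist_eq, sq_abs, sq_abs]
  rfl

theorem finite_setOf_dist {X : Type*} [PseudoMetricSpace X] (P : Finset X) :
    {d : ℝ | ∃ p ∈ P, ∃ q ∈ P, p ≠ q ∧ d = dist p q}.Finite := by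
  classical
  refine ((P ×ˢ P).image fun z => dist z.1 z.2).finite_toSet.subset ?_
  rintro _ ⟨p, hp, q, hq, -, rfl⟩
  exact Finset.mem_coe.2 (Finset.mem_image.2 ⟨(p, q), Finset.mem_product.2 ⟨hp, hq⟩, rfl⟩)

open Classical in
theorem numDist_image_planeCoords_le (P : Finset (EuclideanSpace ℝ (Fin 2))) :
    numDist (P.image planeCoords) ≤
      {d : ℝ | ∃ p ∈ P, ∃ q ∈ P, p ≠ q ∧ d = dist p q}.ncard + 1 := by
  set E := {d : ℝ | ∃ p ∈ P, ∃ q ∈ P, p ≠ q ∧ d = dist p q}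
  have hfin : E.Finite := finite_setOf_dist P
  rw [Set.ncard_eq_toFinset_card E hfin]
  refine (Finset.card_le_card (t := insert 0 (hfin.toFinset.image fun d => d ^ 2))
    fun ρ hρ => ?_).trans ((Finset.card_insert_le _ _).trans
      (Nat.add_le_add_right Finset.card_image_le 1))
  obtain ⟨⟨_, _⟩, hz, rfl⟩ := Finset.mem_image.1 hρ
  obtain ⟨hx, hy⟩ := Finset.mem_product.1 hz
  obtain ⟨p, hp, rfl⟩ := Finset.mem_image.1 hx
  obtain ⟨q, hq, rfl⟩ := Finset.mem_image.1 hy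
  rw [dsq_planeCoords]
  rcases eq_or_ne p q with rfl | hpq
  · simp
  · exact Finset.mem_insert_of_mem (Finset.mem_image.2
      ⟨dist p q, hfin.mem_toFinset.2 ⟨p, hp, q, hq, hpq, rfl⟩, rfl⟩)

/-- If a set `P` of `n ≥ 2` points in the plane has a plane algebraic curve of degree at most
`d` containing at least `a · n^(7/8)` of its points, then `P` determines at least `b · n`
distinct distances. -/
theorem few_distances_implies_no_heavy_curve (d : ℕ) (hd : 1 ≤ d) :
    ∀ a : ℝ, 0 < a → ∃ b : ℝ, 0 < b ∧
      ∀ n : ℕ, 2 ≤ n →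
      ∀ P : Finset (EuclideanSpace ℝ (Fin 2)), P.card = n →
      ∀ f : MvPolynomial (Fin 2) ℝ, f ≠ 0 → f.totalDegree ≤ d →
        a * (n : ℝ) ^ ((7 : ℝ) / 8) ≤
          (((P : Set (EuclideanSpace ℝ (Fin 2))) ∩
            {x : EuclideanSpace ℝ (Fin 2) | MvPolynomial.eval (fun i => x i) f = 0}).ncard : ℝ) →
        b * (n : ℝ) ≤
          (({d : ℝ | ∃ p ∈ P, ∃ q ∈ P, p ≠ q ∧ d = dist p q}).ncard : ℝ) := by
  classical
  intro a ha
  obtain ⟨C, hC⟩ := card_le_mul_numDist_of_evalAt d ⌈(1 / a) ^ 8⌉₊ hd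
  refine ⟨1 / (2 * (C + 1)), by positivity, ?_⟩
  rintro n hn P rfl f hf hfd h
  have hset : (P : Set (EuclideanSpace ℝ (Fin 2))) ∩
      {x : EuclideanSpace ℝ (Fin 2) | MvPolynomial.eval (fun i => x i) f = 0} =
      (P.filter fun x => evalAt f (planeCoords x) = 0 : Finset _) := by
    ext x
    have : ![x 0, x 1] = fun i => x i := by
      ext i
      fin_cases i <;> rfl
    rw [Finset.mem_coe, Finset.mem_filter, evalAt, planeCoords, this]
    rfl
  rw [hset, Set.ncard_coe_finset] at h
  have h7 := pow_seven_le_of_rpow_le ha h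
  have hcard := Finset.card_image_of_injective P planeCoords_injective
  have key := hC f hf hfd ((P.filter fun x => evalAt f (planeCoords x) = 0).image planeCoords)
    (P.image planeCoords) (Finset.image_subset_image (Finset.filter_subset _ _)) (fun s hs => by
      obtain ⟨x, hx, rfl⟩ := Finset.mem_image.1 hs
      exact (Finset.mem_filter.1 hx).2) (by
      rw [hcard, Finset.card_image_of_injective _ planeCoords_injective]
      exact h7)
  rw [hcard] at key
  have hle := numDist_image_planeCoords_le P
  have hpos : 1 ≤ {d : ℝ | ∃ p ∈ P, ∃ q ∈ P, p ≠ q ∧ d = dist p q}.ncard := by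
    obtain ⟨p, hp, q, hq, hpq⟩ := Finset.one_lt_card.1 hn
    exact (Set.ncard_pos (finite_setOf_dist P)).2 ⟨dist p q, p, hp, q, hq, hpq, rfl⟩
  set D := {d : ℝ | ∃ p ∈ P, ∃ q ∈ P, p ≠ q ∧ d = dist p q}.ncard
  have hnat : P.card ≤ 2 * (C + 1) * D := by
    calc P.card ≤ C * numDist (P.image planeCoords) := key
      _ ≤ (C + 1) * (2 * D) := Nat.mul_le_mul (Nat.le_succ C) (by omega)
      _ = _ := by ring
  have hreal : (P.card : ℝ) ≤ 2 * (C + 1) * D := by exact_mod_cast hnat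
  rw [one_div, ← div_eq_inv_mul, div_le_iff₀ (by positivity), mul_comm]
  exact hreal
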